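/- Let n ≥ 5 and let N be a perfect group of order n!. Suppose f : Sₙ → Aut(N) is a group homomorphism and g : Sₙ → N is a bijective map satisfying g(στ) = g(σ) · f(σ)(g(τ)) for all σ, τ ∈ Sₙ. Then the center Z(N) of N has exactly two elements, the quotient N/Z(N) is isomorphic to the alternating group Aₙ, and f(σ) is an inner automorphism of N for every σ ∈ Aₙ (so that f(Aₙ) ⊆ Inn(N)); in other words, N is isomorphic to the double cover 2Aₙ of Aₙ. -/

import Mathlib

namespace W9

/-- `S` is a Sylow `q`-subgroup of `M`. -/
def SylIn {E : Type*} [Group E] (q : ℕ) (S M : Subgroup E) : Prop :=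
  S ≤ M ∧ Nat.card S = q ^ (Nat.card M).factorization q

/-- `g` normalizes `S`. -/
def Nz {E : Type*} [Group E] (g : E) (S : Subgroup E) : Prop := ∀ t, t ∈ S ↔ g * t * g⁻¹ ∈ S

section
variable {E : Type*} [Group E]

theorem Nz.iff {g : E} {S : Subgroup E} : Nz g S ↔ g ∈ Subgroup.normalizer (S : Set E) := by
  rw [Subgroup.mem_normalizer_iff]; rfl

theorem Nz.one (S : Subgroup E) : Nz 1 S := fun t => by simp
theorem Nz.mul {g h : E} {S : Subgroup E} (hg : Nz g S) (hh : Nz h S) : Nz (g * h) S := by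
  rw [Nz.iff] at *; exact mul_mem hg hh
theorem Nz.inv {g : E} {S : Subgroup E} (hg : Nz g S) : Nz g⁻¹ S := by
  rw [Nz.iff] at *; exact inv_mem hg
theorem Nz.pow {g : E} {S : Subgroup E} (hg : Nz g S) (k : ℕ) : Nz (g ^ k) S := by
  rw [Nz.iff] at *; exact pow_mem hg k
theorem Nz.of_mem {g : E} {S : Subgroup E} (hg : g ∈ S) : Nz g S := by
  rw [Nz.iff]; exact Subgroup.le_normalizer hg

theorem Nz.of_le [Finite E] {g : E} {S : Subgroup E} (h : ∀ t ∈ S, g * t * g⁻¹ ∈ S) : Nz g S := by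
  have h1 : S.map (MulAut.conj g).toMonoidHom ≤ S := by
    rintro _ ⟨t, ht, rfl⟩; exact h t ht
  have h2 : S.map (MulAut.conj g).toMonoidHom = S := by
    apply Subgroup.eq_of_le_of_card_ge h1
    rw [Subgroup.card_map_of_injective (MulAut.conj g).injective]
  intro t
  refine ⟨h t, fun ht => ?_⟩
  rw [← h2] at ht
  obtain ⟨u, hu, hu2⟩ := ht
  simp at hu2
  rwa [← hu2]

theorem conj_inv_mem {g t : E} {S : Subgroup E} (hg : Nz g S) (ht : t ∈ S) : g⁻¹ * t * g ∈ S := by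
  have := (hg.inv t).1 ht; simpa using this

/-- `g S g⁻¹`. -/
def cj (g : E) (S : Subgroup E) : Subgroup E := S.map (MulAut.conj g).toMonoidHom

theorem mem_cj {g t : E} {S : Subgroup E} : t ∈ cj g S ↔ g⁻¹ * t * g ∈ S := by
  constructor
  · rintro ⟨u, hu, rfl⟩; simpa [mul_assoc] using hu
  · intro h; exact ⟨_, h, by simp [mul_assoc]⟩

theorem mem_cj' {g t : E} {S : Subgroup E} : g * t * g⁻¹ ∈ cj g S ↔ t ∈ S := by
  rw [mem_cj]; simp [mul_assoc]

theorem card_cj (g : E) (S : Subgroup E) : Nat.card (cj g S) = Nat.card S :=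
  Subgroup.card_map_of_injective (MulAut.conj g).injective

theorem cj_mul (g h : E) (S : Subgroup E) : cj (g * h) S = cj g (cj h S) := by
  ext t; simp only [mem_cj]; simp [mul_assoc]

theorem cj_one (S : Subgroup E) : cj 1 S = S := by ext t; simp [mem_cj]

theorem Nz.iff_cj {g : E} {S : Subgroup E} : Nz g S ↔ cj g S = S := by
  constructor
  · intro h; ext t; rw [mem_cj, h]; simp [mul_assoc]
  · intro h t; rw [← mem_cj' (g := g), h]

theorem cj_le_cj {g : E} {S T : Subgroup E} (h : S ≤ T) : cj g S ≤ cj g T := Subgroup.map_mono h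

theorem SylIn.cj {q : ℕ} {S M : Subgroup E} (h : SylIn q S M) (g : E) :
    SylIn q (cj g S) (cj g M) := ⟨cj_le_cj h.1, by rw [card_cj, card_cj]; exact h.2⟩

theorem SylIn.cj' {q : ℕ} {S M : Subgroup E} (h : SylIn q S M) {g : E} (hg : Nz g M) :
    SylIn q (W9.cj g S) M := by
  have := h.cj g; rwa [Nz.iff_cj.1 hg] at this

theorem SylIn.isPGroup {q : ℕ} {S M : Subgroup E} (h : SylIn q S M) : IsPGroup q S :=
  IsPGroup.of_card h.2

/-- from Sylow of type M to SylIn -/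
theorem sylIn_map [Finite E] {q : ℕ} [Fact q.Prime] {M : Subgroup E} (P : Sylow q M) :
    SylIn q ((P : Subgroup M).map M.subtype) M := by
  refine ⟨Subgroup.map_subtype_le _, ?_⟩
  rw [Subgroup.card_map_of_injective M.subtype_injective]
  exact P.card_eq_multiplicity

theorem exists_sylow_of_sylIn [Finite E] {q : ℕ} [Fact q.Prime] {S M : Subgroup E} (h : SylIn q S M) :
    ∃ P : Sylow q M, (P : Subgroup M).map M.subtype = S := by
  refine ⟨Sylow.ofCard (S.subgroupOf M) ?_, ?_⟩
  · rw [← h.2]; exact Nat.card_congr (Subgroup.subgroupOfEquivOfLe h.1).toEquiv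
  · simp [h.1]

theorem T1 [Finite E] {q : ℕ} [Fact q.Prime] {R M : Subgroup E} (hR : R ≤ M) (hq : IsPGroup q R) :
    ∃ S, SylIn q S M ∧ R ≤ S := by
  have h : IsPGroup q (R.subgroupOf M) := hq.of_equiv (Subgroup.subgroupOfEquivOfLe hR).symm
  obtain ⟨P, hP⟩ := h.exists_le_sylow
  refine ⟨_, sylIn_map P, fun r hr => ⟨⟨r, hR hr⟩, hP ?_, rfl⟩⟩
  simpa [Subgroup.mem_subgroupOf] using hr

theorem T1' [Finite E] (q : ℕ) [Fact q.Prime] (M : Subgroup E) : ∃ S, SylIn q S M := by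
  obtain ⟨S, h, _⟩ := T1 (q := q) (bot_le : ⊥ ≤ M) IsPGroup.of_bot
  exact ⟨S, h⟩

theorem T2 [Finite E] {q : ℕ} [Fact q.Prime] {S S' M : Subgroup E} (h : SylIn q S M)
    (h' : SylIn q S' M) : ∃ m ∈ M, cj m S = S' := by
  obtain ⟨P, rfl⟩ := exists_sylow_of_sylIn h
  obtain ⟨P', rfl⟩ := exists_sylow_of_sylIn h'
  obtain ⟨m, hm⟩ := MulAction.exists_smul_eq M P P'
  refine ⟨m, m.2, ?_⟩
  rw [← hm, Sylow.coe_subgroup_smul]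
  ext t
  rw [mem_cj]
  constructor
  · rintro ⟨u, hu, hu2⟩
    refine ⟨m * u * m⁻¹, ⟨u, hu, rfl⟩, ?_⟩
    simp at hu2 ⊢; rw [hu2]; group
  · rintro ⟨_, ⟨u, hu, rfl⟩, rfl⟩
    exact ⟨u, hu, by simp [mul_assoc]⟩

/-- a q-subgroup conjugates into a Sylow -/
theorem T2' [Finite E] {q : ℕ} [Fact q.Prime] {S R M : Subgroup E} (h : SylIn q S M)
    (hR : R ≤ M) (hq : IsPGroup q R) : ∃ m ∈ M, cj m R ≤ S := by
  obtain ⟨S', h', hRS⟩ := T1 hR hq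
  obtain ⟨m, hm, rfl⟩ := T2 h' h
  exact ⟨m, hm, cj_le_cj hRS⟩

/-- q-subgroup of M of Sylow order in a bigger group. -/
theorem SylIn.of_le [Finite E] {q : ℕ} [Fact q.Prime] {S M L : Subgroup E} (h : SylIn q S L) (hS : S ≤ M) (hM : M ≤ L) :
    SylIn q S M := by
  refine ⟨hS, ?_⟩
  obtain ⟨S', h', hSS⟩ := T1 hS h.isPGroup
  have h1 : Nat.card S ≤ Nat.card S' := Subgroup.card_le_of_le hSS
  have h2 : Nat.card S' ≤ Nat.card S := by
    rw [h'.2, h.2]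
    apply Nat.pow_le_pow_right (Nat.Prime.pos Fact.out)
    exact (Nat.factorization_le_iff_dvd Nat.card_pos.ne' Nat.card_pos.ne').2 (Subgroup.card_dvd_of_le hM) q
  rw [le_antisymm h1 h2, h'.2]

theorem SylIn.maximal [Finite E] {q : ℕ} [Fact q.Prime] {S M R : Subgroup E} (h : SylIn q S M) (hS : S ≤ R) (hM : R ≤ M)
    (hq : IsPGroup q R) : R = S := by
  obtain ⟨S', h', hSS⟩ := T1 hM hq
  have : S = S' := Subgroup.eq_of_le_of_card_ge (hS.trans hSS) (by rw [h.2, h'.2])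
  exact le_antisymm (hSS.trans this.ge) hS

theorem SylIn.card_dvd [Finite E] {q : ℕ} [Fact q.Prime] {S M R : Subgroup E} (h : SylIn q S M)
   (hM : R ≤ M) (hq : IsPGroup q R) : Nat.card R ∣ Nat.card S := by
  obtain ⟨m, hm, h'⟩ := T2' h hM hq
  rw [← card_cj m]; exact Subgroup.card_dvd_of_le h'

theorem fixed_pt {α : Type*} {p : ℕ} (hp : p.Prime) (φ : Equiv.Perm α) (hφ : φ ^ p = 1)
    (X : Set α) [Finite X] (hX : ∀ a ∈ X, φ a ∈ X) (hc : ¬ p ∣ Nat.card X) : ∃ a ∈ X, φ a = a := by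
  have := Fact.mk hp
  have := Fintype.ofFinite X
  have hpow : ∀ k : ℕ, ∀ a ∈ X, (φ ^ k) a ∈ X := by
    intro k; induction k with
    | zero => simp
    | succ k ih => intro a ha; rw [pow_succ']; exact hX _ (ih a ha)
  have h1 : ∀ a, a ∈ X ↔ φ a ∈ X := by
    intro a; refine ⟨hX a, fun h => ?_⟩
    have := hpow (p - 1) _ h
    rw [← Equiv.Perm.mul_apply, ← pow_succ, Nat.sub_add_cancel hp.one_le, hφ] at this
    exact this
  let ψ : Equiv.Perm X := φ.subtypePerm (fun a => (h1 a).symm)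
  obtain ⟨a, ha⟩ := Equiv.Perm.exists_fixed_point_of_prime (p := p) (n := 1) (σ := ψ)
    (by rwa [← Nat.card_eq_fintype_card])
    (by ext a; simp [ψ, Equiv.Perm.subtypePerm_pow, hφ])
  exact ⟨a, a.2, by simpa [ψ] using congrArg Subtype.val ha⟩

theorem T4 [Finite E] {p : ℕ} (hp : p.Prime) {x : E} (hx : x ^ p = 1)
    (X : Set E) (hX : ∀ a ∈ X, x * a * x⁻¹ ∈ X) (hc : ¬ p ∣ Nat.card X) : ∃ a ∈ X, x * a = a * x := by
  obtain ⟨a, ha, h⟩ := fixed_pt hp (MulAut.conj x).toEquiv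
    (by
      have : (MulAut.conj x) ^ p = 1 := by rw [← map_pow, hx, map_one]
      ext a
      have h2 : ∀ k : ℕ, ((MulAut.conj x).toEquiv ^ k) a = ((MulAut.conj x) ^ k) a := by
        intro k; induction k with
        | zero => rfl
        | succ k ih => rw [pow_succ', pow_succ', Equiv.Perm.mul_apply, ih]; rfl
      rw [h2, this]; rfl) X hX hc
  refine ⟨a, ha, ?_⟩
  have h' : x * a * x⁻¹ = a := h
  exact mul_inv_eq_iff_eq_mul.1 h'

theorem T3 [Finite E] {p q : ℕ} (hp : p.Prime) [Fact q.Prime] {x : E} (hx : x ^ p = 1) {M : Subgroup E}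
    (hM : Nz x M) (hpM : ¬ p ∣ Nat.card M) : ∃ S, SylIn q S M ∧ Nz x S := by
  let φ : Equiv.Perm (Subgroup E) := ⟨cj x, cj x⁻¹, fun S => by rw [← cj_mul]; simp [cj_one],
    fun S => by rw [← cj_mul]; simp [cj_one]⟩
  have hφ : ∀ k : ℕ, ∀ S, (φ ^ k) S = cj (x ^ k) S := by
    intro k S; induction k with
    | zero => simp [cj_one]
    | succ k ih => rw [pow_succ', pow_succ', Equiv.Perm.mul_apply, ih, cj_mul]; rfl
  obtain ⟨S, hS, h⟩ := fixed_pt hp φ (by ext1 S; rw [hφ, hx, cj_one]; rfl) {S | SylIn q S M}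
    (fun S hS => SylIn.cj' hS hM) (by
      intro hd; apply hpM
      have e : Nat.card (Sylow q M) = Nat.card {S | SylIn q S M} := by
        refine Nat.card_congr (Equiv.ofBijective
          (fun P => (⟨(P : Subgroup M).map M.subtype, sylIn_map P⟩ : {S | SylIn q S M})) ⟨?_, ?_⟩)
        · intro P P' h
          apply Sylow.ext
          exact Subgroup.map_injective M.subtype_injective (congrArg Subtype.val h)
        · rintro ⟨S, hS⟩
          obtain ⟨P, hP⟩ := exists_sylow_of_sylIn hS
          exact ⟨P, Subtype.ext hP⟩
      rw [← e] at hd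
      have P : Sylow q M := default
      exact (hd.trans P.card_dvd_index).trans (Subgroup.index_dvd_card _))
  exact ⟨S, hS, Nz.iff_cj.2 h⟩

theorem T5 [Finite E] {p : ℕ} [Fact p.Prime] {P M : Subgroup E} (hP : SylIn p P M)
    (h : ∀ m ∈ M, Nz m P → ∀ t ∈ P, m * t = t * m) :
    ∃ Q : Subgroup E, Q ≤ M ∧ (∀ m ∈ M, Nz m Q) ∧ ¬ p ∣ Nat.card Q ∧ (∀ m ∈ M, ∃ a ∈ Q, ∃ b ∈ P, m = a * b) ∧
      Nat.card Q * Nat.card P = Nat.card M := by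
  obtain ⟨P', hP'⟩ := exists_sylow_of_sylIn hP
  have hm : ∀ m : M, m ∈ (P' : Subgroup M) ↔ (m : E) ∈ P := by
    intro m; rw [← hP']; simp
  have hN : Subgroup.normalizer (P' : Set M) ≤ Subgroup.centralizer (P' : Set M) := by
    intro m hmN
    rw [Subgroup.mem_centralizer_iff]
    intro t ht
    apply Subtype.ext
    refine (h m m.2 ?_ t ((hm t).1 ht)).symm
    apply Nz.of_le
    intro u hu
    have hu' := (hm ⟨u, hP.1 hu⟩).2 hu
    have := (Subgroup.mem_normalizer_iff.1 hmN _).1 hu'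
    exact (hm _).1 this
  obtain ⟨Q', hQn, hc, hnd⟩ : ∃ Q' : Subgroup M, Q'.Normal ∧ Q'.IsComplement' P' ∧ ¬ p ∣ Nat.card Q' :=
    ⟨_, inferInstance, MonoidHom.ker_transferSylow_isComplement' P' hN,
      MonoidHom.not_dvd_card_ker_transferSylow P' hN⟩
  have hcard := hc.card_mul_card
  have hcQ : Nat.card (Q'.map M.subtype) = Nat.card Q' := Subgroup.card_map_of_injective M.subtype_injective
  refine ⟨Q'.map M.subtype, Subgroup.map_subtype_le _, ?_, ?_, ?_, ?_⟩
  · intro m hmM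
    apply Nz.of_le
    rintro _ ⟨t, ht, rfl⟩
    exact ⟨⟨m, hmM⟩ * t * ⟨m, hmM⟩⁻¹, hQn.conj_mem t ht _, rfl⟩
  · rwa [hcQ]
  · intro m hmM
    obtain ⟨⟨a, b⟩, hab⟩ := hc.2 ⟨m, hmM⟩
    exact ⟨a, ⟨a, a.2, rfl⟩, b, (hm b).1 b.2, by simpa using (congrArg Subtype.val hab).symm⟩
  · rw [hcQ, ← hcard, ← hP', Subgroup.card_map_of_injective M.subtype_injective]

end
end W9

namespace W9
open Polynomial

theorem L0 {K V : Type*} [Field K] [AddCommGroup V] [Module K V] [FiniteDimensional K V] {p : ℕ}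
    (hp : p.Prime) (hpK : (p : K) ≠ 0) (φ : Module.End K V) (hφ : φ ^ p = 1) (h1 : φ ≠ 1)
    (hk : ∀ k : ℕ, k.Coprime p → ∃ ψ : Module.End K V, Function.Injective ψ ∧ ψ * φ = φ ^ k * ψ) :
    p - 1 ≤ Module.finrank K V := by
  set m := minpoly K φ with hm
  have hint : IsIntegral K φ := Algebra.IsIntegral.isIntegral φ
  have hm0 : m ≠ 0 := minpoly.ne_zero hint
  have hdiv : m ∣ (∑ i ∈ Finset.range p, X ^ i) * (X - 1) := by
    rw [geom_sum_mul]
    apply minpoly.dvd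
    simp [hφ]
  let L := AlgebraicClosure K
  have hnc : ¬ IsCoprime m (∑ i ∈ Finset.range p, X ^ i) := by
    intro hc
    have h2 := hc.dvd_of_dvd_mul_left hdiv
    have h3 := (minpoly.dvd_iff).1 h2
    apply h1
    simpa [sub_eq_zero] using h3
  have hL : (p : L) ≠ 0 := by
    rw [← map_natCast (algebraMap K L)]
    exact (_root_.map_ne_zero _).2 hpK
  obtain ⟨ζ, hz1, hz2⟩ : ∃ ζ : L, aeval ζ m = 0 ∧ aeval ζ (∑ i ∈ Finset.range p, X ^ i : K[X]) = 0 := by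
    rw [Polynomial.isCoprime_iff_aeval_ne_zero_of_isAlgClosed K L] at hnc
    push Not at hnc
    exact hnc
  have hzp : ζ ^ p = 1 := by
    have : aeval ζ ((∑ i ∈ Finset.range p, X ^ i) * (X - 1) : K[X]) = 0 := by
      rw [map_mul, hz2, zero_mul]
    rw [geom_sum_mul] at this
    simpa [sub_eq_zero] using this
  have hz : ζ ≠ 1 := by
    rintro rfl
    apply hL; simpa using hz2
  have hord : orderOf ζ = p := by
    have := Fact.mk hp
    exact orderOf_eq_prime hzp hz
  have hroot : ∀ k : ℕ, k.Coprime p → aeval (ζ ^ k) m = 0 := by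
    intro k hkp
    obtain ⟨ψ, hψ, hc⟩ := hk k hkp
    have hpow : ∀ i : ℕ, ψ * φ ^ i = (φ ^ k) ^ i * ψ := by
      intro i; induction i with
      | zero => simp
      | succ i ih => rw [pow_succ, ← mul_assoc, ih, mul_assoc, hc, ← mul_assoc, ← pow_succ]
    have hq : ∀ q : K[X], ψ * aeval φ q = aeval (φ ^ k) q * ψ := by
      intro q
      induction q using Polynomial.induction_on' with
      | add a b ha hb => simp only [map_add, mul_add, add_mul, ha, hb]
      | monomial i a =>
        rw [aeval_monomial, aeval_monomial, mul_assoc, ← hpow, ← mul_assoc, ← mul_assoc,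
          Algebra.commutes a ψ]
    have h0 := hq m
    rw [hm, minpoly.aeval, mul_zero, ← hm] at h0
    have hs : Function.Surjective ψ := LinearMap.surjective_of_injective hψ
    have h0' : aeval (φ ^ k) m = 0 := by
      ext v
      obtain ⟨w, rfl⟩ := hs v
      have := congrArg (fun f => f w) h0
      simpa using this.symm
    have hd : m ∣ m.comp (X ^ k) := by
      apply minpoly.dvd
      rw [aeval_comp]; simpa using h0'
    obtain ⟨r, hr⟩ := hd
    have := congrArg (aeval ζ) hr
    rw [aeval_comp, map_mul, hz1, zero_mul] at this
    simpa using this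
  have hdeg : p - 1 ≤ m.natDegree := by
    classical
    have hm0' : m.map (algebraMap K L) ≠ 0 := (Polynomial.map_ne_zero_iff (algebraMap K L).injective).2 hm0
    have hsub : ((Finset.Ico 1 p).image (fun k => ζ ^ k)) ⊆ (m.map (algebraMap K L)).roots.toFinset := by
      intro y hy
      simp only [Finset.mem_image, Finset.mem_Ico] at hy
      obtain ⟨k, hk', rfl⟩ := hy
      rw [Multiset.mem_toFinset, mem_roots hm0', IsRoot.def, eval_map_algebraMap]
      exact hroot k (((Nat.Prime.coprime_iff_not_dvd hp).2 (fun hd => by have := Nat.le_of_dvd (by omega) hd; omega)).symm)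
    have hc := Finset.card_le_card hsub
    rw [Finset.card_image_of_injOn, Nat.card_Ico] at hc
    · calc p - 1 ≤ _ := hc
        _ ≤ _ := Multiset.toFinset_card_le _
        _ ≤ _ := Polynomial.card_roots' _
        _ = _ := Polynomial.natDegree_map _
    · intro a ha b hb hab
      simp only [Finset.coe_Ico, Set.mem_Ico] at ha hb
      exact pow_injOn_Iio_orderOf (by simp [hord, ha.2]) (by simp [hord, hb.2]) hab
  refine hdeg.trans ?_
  rw [← LinearMap.charpoly_natDegree φ]
  exact Polynomial.natDegree_le_of_dvd (LinearMap.minpoly_dvd_charpoly φ) (LinearMap.charpoly_monic φ).ne_zero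

theorem L0g {A : Type*} [Group A] [Finite A] {p q : ℕ} (hp : p.Prime) (hq : q.Prime) (hpq : p ≠ q)
    (hcomm : ∀ a b : A, a * b = b * a) (hexp : ∀ a : A, a ^ q = 1) (φ : A →* A)
    (hφ : ∀ a, φ^[p] a = a) (h1 : ∃ a, φ a ≠ a)
    (hk : ∀ k : ℕ, k.Coprime p → ∃ ψ : A →* A, Function.Injective ψ ∧ ∀ a, ψ (φ a) = φ^[k] (ψ a)) :
    q ^ (p - 1) ≤ Nat.card A := by
  have := Fact.mk hq
  letI : CommGroup A := { ‹Group A› with mul_comm := hcomm }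
  obtain ⟨_⟩ : Nonempty (Module (ZMod q) (Additive A)) := ⟨AddCommGroup.zmodModule (n := q)
    (fun a => by
      have := hexp a.toMul
      exact congrArg Additive.ofMul this)⟩
  have hfin : Module.Finite (ZMod q) (Additive A) := Module.Finite.of_finite
  let Φ (χ : A →* A) : Module.End (ZMod q) (Additive A) := AddMonoidHom.toZModLinearMap q χ.toAdditive
  have hpow : ∀ (k : ℕ) (a : Additive A), ((Φ φ) ^ k) a = Additive.ofMul (φ^[k] a.toMul) := by
    intro k a; induction k with
    | zero => rfl
    | succ k ih => rw [pow_succ', Module.End.mul_apply, ih, Function.iterate_succ_apply']; rfl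
  have h := L0 (K := ZMod q) (V := Additive A) hp
    (by rw [Ne, ZMod.natCast_eq_zero_iff, Nat.prime_dvd_prime_iff_eq hq hp]; exact hpq.symm) (Φ φ)
    (by ext a; rw [hpow, hφ]; rfl)
    (by
      rintro h; obtain ⟨a, ha⟩ := h1; apply ha
      have := congrArg (fun f => f (Additive.ofMul a)) h
      exact this)
    (by
      intro k hkp
      obtain ⟨ψ, hi, hψ⟩ := hk k hkp
      refine ⟨Φ ψ, hi, ?_⟩
      ext a
      rw [Module.End.mul_apply, Module.End.mul_apply, hpow]
      exact congrArg Additive.ofMul (hψ a.toMul))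
  have hc : Nat.card (Additive A) = _ := Module.natCard_eq_pow_finrank (K := ZMod q) (V := Additive A)
  rw [Nat.card_zmod] at hc
  change q ^ (p - 1) ≤ Nat.card (Additive A)
  rw [hc]
  exact Nat.pow_le_pow_right hq.pos h

theorem L0g2 {A : Type*} [Group A] [Finite A] {p : ℕ} (hp : p.Prime) (hpq : p ≠ 2)
    (hcomm : ∀ a b : A, a * b = b * a) (hexp : ∀ a : A, a ^ 2 = 1) (φ : A →* A)
    (hφ : ∀ a, φ^[p] a = a) (h1 : ∃ a, φ a ≠ a) (u : A →* A) (hu : Function.Injective u)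
    (hu1 : ∃ a, u a ≠ a) (huφ : ∀ a, u (φ a) = φ (u a))
    (Ψ : Set (A →* A)) (hΨu : ∀ ψ ∈ Ψ, ∀ a, u (ψ a) = ψ (u a))
    (hirr : ∀ B : Subgroup A, (∀ ψ ∈ Ψ, ∀ b ∈ B, ψ b ∈ B) → B = ⊥ ∨ B = ⊤)
    (hk : ∀ k : ℕ, k.Coprime p → ∃ ψ ∈ Ψ, Function.Injective ψ ∧ ∀ a, ψ (φ a) = φ^[k] (ψ a)) :
    2 ^ (2 * (p - 1)) ≤ Nat.card A := by
  letI : CommGroup A := { ‹Group A› with mul_comm := hcomm }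
  letI : Module (ZMod 2) (Additive A) := AddCommGroup.zmodModule (n := 2)
    (fun a => by
      have := hexp a.toMul
      exact congrArg Additive.ofMul this)
  have hfin : Module.Finite (ZMod 2) (Additive A) := Module.Finite.of_finite
  let Φ (χ : A →* A) : Module.End (ZMod 2) (Additive A) := AddMonoidHom.toZModLinearMap 2 χ.toAdditive
  have hΦ : ∀ χ (a : Additive A), Φ χ a = Additive.ofMul (χ a.toMul) := fun _ _ => rfl
  set m := minpoly (ZMod 2) (Φ u) with hm
  have hint : IsIntegral (ZMod 2) (Φ u) := Algebra.IsIntegral.isIntegral _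
  have hm0 : m ≠ 0 := minpoly.ne_zero hint
  have hcm : ∀ χ : A →* A, (∀ a, u (χ a) = χ (u a)) → ∀ r : (ZMod 2)[X], Commute (Φ χ) (aeval (Φ u) r) := by
    intro χ hχ r
    have h : Commute (Φ χ) (Φ u) := by
      ext a; exact congrArg Additive.ofMul (hχ a.toMul).symm
    induction r using Polynomial.induction_on' with
    | add a b ha hb => rw [map_add]; exact ha.add_right hb
    | monomial i a =>
      rw [aeval_monomial]
      exact (Algebra.commute_algebraMap_right a (Φ χ)).mul_right (h.pow_right i)
  obtain ⟨a1, ha1⟩ := hu1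
  have hirred : Irreducible m := by
    refine ⟨?_, ?_⟩
    · intro hun
      have hh : Nontrivial (Module.End (ZMod 2) (Additive A)) := by
        refine ⟨⟨Φ u, 1, fun h => ha1 ?_⟩⟩
        exact congrArg (fun f => (f (Additive.ofMul a1)).toMul) h
      exact minpoly.not_isUnit _ _ hun
    · intro a b hab
      let B : Subgroup A := AddSubgroup.toSubgroup' (LinearMap.ker (aeval (Φ u) a)).toAddSubgroup
      have hB : ∀ x : A, x ∈ B ↔ aeval (Φ u) a (Additive.ofMul x) = 0 := fun x => Iff.rfl
      have hBinv : ∀ ψ ∈ Ψ, ∀ b ∈ B, ψ b ∈ B := by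
        intro ψ hψ x hx
        rw [hB] at hx ⊢
        have h := congrArg (fun f => f (Additive.ofMul x)) (hcm ψ (hΨu ψ hψ) a).eq
        simp only [Module.End.mul_apply] at h
        rw [hx, map_zero] at h
        exact h.symm
      rcases hirr B hBinv with h | h
      · left
        have : aeval (Φ u) b = 0 := by
          ext v
          have h2 : aeval (Φ u) a (aeval (Φ u) b v) = 0 := by
            rw [← Module.End.mul_apply, ← map_mul, ← hab, hm, minpoly.aeval]; rfl
          have h3 : (aeval (Φ u) b v).toMul ∈ B := (hB _).2 h2
          rw [h, Subgroup.mem_bot] at h3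
          exact congrArg Additive.ofMul h3
        obtain ⟨c, hc⟩ := minpoly.dvd _ _ this
        rw [← hm] at hc
        have hb0 : b ≠ 0 := by rintro rfl; apply hm0; rw [hab, mul_zero]
        refine IsUnit.of_mul_eq_one c ?_
        apply mul_left_cancel₀ hb0
        rw [mul_one]
        conv_rhs => rw [hc, hab]
        ring
      · right
        have : aeval (Φ u) a = 0 := by
          ext v
          have h3 : v.toMul ∈ B := by rw [h]; trivial
          exact (hB _).1 h3
        obtain ⟨c, hc⟩ := minpoly.dvd _ _ this
        rw [← hm] at hc
        have hb0 : a ≠ 0 := by rintro rfl; apply hm0; rw [hab, zero_mul]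
        refine IsUnit.of_mul_eq_one c ?_
        apply mul_left_cancel₀ hb0
        rw [mul_one]
        conv_rhs => rw [hc, hab]
        ring
  have hmon : m.Monic := minpoly.monic hint
  have hdeg : 2 ≤ m.natDegree := by
    by_contra hlt
    have hpos := hirred.natDegree_pos
    have h1' : m.natDegree = 1 := by omega
    have hX := hmon.eq_X_add_C h1'
    have h0 : aeval (Φ u) m = 0 := minpoly.aeval _ _
    rw [hX] at h0
    have hc : ∀ c : ZMod 2, c = 0 ∨ c = 1 := by decide
    rcases hc (m.coeff 0) with h | h
    · rw [h] at h0
      simp only [map_zero, add_zero, aeval_X] at h0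
      apply ha1
      have h5 : ∀ a, u a = 1 := fun a => congrArg (fun f => (f (Additive.ofMul a)).toMul) h0
      exact hu (by rw [h5, h5])
    · rw [h] at h0
      simp only [map_one, map_add, aeval_X] at h0
      apply ha1
      have h5 : u a1 * a1 = 1 := congrArg (fun f => (f (Additive.ofMul a1)).toMul) h0
      have h6 := hexp a1
      rw [pow_two] at h6
      exact mul_right_cancel (h5.trans h6.symm)
  have hFi : Fact (Irreducible m) := ⟨hirred⟩
  let K := AdjoinRoot m
  let ρ : K →+* Module.End (ZMod 2) (Additive A) :=
    Ideal.Quotient.lift (Ideal.span {m}) (aeval (Φ u)).toRingHom (by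
      intro a ha
      rw [Ideal.mem_span_singleton] at ha
      obtain ⟨c, rfl⟩ := ha
      simp [hm])
  have hρ : ∀ r : (ZMod 2)[X], ρ (AdjoinRoot.mk m r) = aeval (Φ u) r := fun r => rfl
  letI : Module K (Additive A) := Module.compHom (Additive A) ρ
  have hsm : ∀ (c : K) (v : Additive A), c • v = ρ c v := fun _ _ => rfl
  have hfin2 : Module.Finite K (Additive A) := Module.Finite.of_finite
  have hcK : Nat.card K = 2 ^ m.natDegree := by
    have hb := (AdjoinRoot.powerBasis hm0).finite
    rw [Module.natCard_eq_pow_finrank (K := ZMod 2) (V := K), Nat.card_zmod,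
      (AdjoinRoot.powerBasis hm0).finrank, AdjoinRoot.powerBasis_dim]
  have hlin : ∀ χ : A →* A, (∀ a, u (χ a) = χ (u a)) → ∃ f : Module.End K (Additive A), ∀ v, f v = Φ χ v := by
    intro χ hχ
    refine ⟨{ toFun := Φ χ, map_add' := map_add _, map_smul' := ?_ }, fun v => rfl⟩
    intro c v
    obtain ⟨r, rfl⟩ := AdjoinRoot.mk_surjective c
    rw [hsm, hsm, RingHom.id_apply, hρ]
    exact congrArg (fun f => f v) (hcm χ hχ r).eq
  obtain ⟨F, hF⟩ := hlin φ huφ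
  have hpow : ∀ (k : ℕ) (a : Additive A), (F ^ k) a = Additive.ofMul (φ^[k] a.toMul) := by
    intro k a; induction k with
    | zero => rfl
    | succ k ih => rw [pow_succ', Module.End.mul_apply, ih, Function.iterate_succ_apply', hF]; rfl
  have hchar : CharP K 2 := charP_of_injective_algebraMap (algebraMap (ZMod 2) K).injective 2
  have h := L0 (K := K) (V := Additive A) hp
    (by rw [Ne, CharP.cast_eq_zero_iff K 2, Nat.prime_dvd_prime_iff_eq Nat.prime_two hp]; exact hpq.symm) F
    (by ext a; rw [hpow, hφ]; rfl)
    (by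
      rintro h; obtain ⟨a, ha⟩ := h1; apply ha
      have := congrArg (fun f => f (Additive.ofMul a)) h
      simp only [hF] at this
      exact this)
    (by
      intro k hkp
      obtain ⟨ψ, hψΨ, hi, hψ⟩ := hk k hkp
      obtain ⟨G, hG⟩ := hlin ψ (hΨu ψ hψΨ)
      refine ⟨G, ?_, ?_⟩
      · intro a b hab
        rw [hG, hG] at hab
        exact hi hab
      ext a
      rw [Module.End.mul_apply, Module.End.mul_apply, hpow, hG, hF, hG]
      exact congrArg Additive.ofMul (hψ a.toMul))
  have hc : Nat.card (Additive A) = _ := Module.natCard_eq_pow_finrank (K := K) (V := Additive A)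
  change _ ≤ Nat.card (Additive A)
  rw [hc, hcK, ← pow_mul]
  exact Nat.pow_le_pow_right (by norm_num) (Nat.mul_le_mul hdeg h)

end W9

namespace W9
variable {E : Type*} [Group E]

/-- `A` realizes every power automorphism of `x`. -/
def Full (p : ℕ) (A : Subgroup E) (x : E) : Prop :=
  ∀ k : ℕ, k.Coprime p → ∃ y ∈ A, y * x * y⁻¹ = x ^ k

/-- conjugation on a normalized subgroup -/
def cjH {g : E} {S : Subgroup E} (h : Nz g S) : S →* S where
  toFun s := ⟨g * s * g⁻¹, (h s).1 s.2⟩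
  map_one' := by ext; simp
  map_mul' a b := by ext; simp [mul_assoc]

theorem sec_normal {S0 S1 : Subgroup E}
    (hc : ∀ s ∈ S1, ∀ t ∈ S1, s * t * s⁻¹ * t⁻¹ ∈ S0) : (S0.subgroupOf S1).Normal := by
  refine ⟨fun a ha b => ?_⟩
  rw [Subgroup.mem_subgroupOf] at *
  have := mul_mem (hc b b.2 a a.2) ha
  simpa using this

section
variable {S0 S1 : Subgroup E} [hn : (S0.subgroupOf S1).Normal]

/-- action on the section -/
def act {g : E} (h1 : Nz g S1) (h0 : Nz g S0) : S1 ⧸ S0.subgroupOf S1 →* S1 ⧸ S0.subgroupOf S1 :=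
  QuotientGroup.map _ _ (cjH h1) (by
    intro s hs
    rw [Subgroup.mem_comap, Subgroup.mem_subgroupOf]
    rw [Subgroup.mem_subgroupOf] at hs
    exact (h0 s).1 hs)

theorem act_mk {g : E} (h1 : Nz g S1) (h0 : Nz g S0) (s : S1) :
    act h1 h0 (s : S1 ⧸ S0.subgroupOf S1) = ((⟨g * s * g⁻¹, (h1 s).1 s.2⟩ : S1) : S1 ⧸ S0.subgroupOf S1) := rfl

theorem mk_eq {s t : S1} : (s : S1 ⧸ S0.subgroupOf S1) = t ↔ (s : E) * (t : E)⁻¹ ∈ S0 := by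
  rw [eq_comm, QuotientGroup.eq_iff_div_mem, div_eq_mul_inv, Subgroup.mem_subgroupOf]
  rw [← inv_mem_iff]
  simp

theorem act_iter {g : E} (h1 : Nz g S1) (h0 : Nz g S0) (k : ℕ) (a : S1 ⧸ S0.subgroupOf S1) :
    (act h1 h0)^[k] a = act (h1.pow k) (h0.pow k) a := by
  induction a using QuotientGroup.induction_on with
  | H s =>
  induction k with
  | zero => rw [Function.iterate_zero, id, act_mk, mk_eq]; simp
  | succ k ih =>
    rw [Function.iterate_succ_apply', ih, act_mk, act_mk, act_mk, mk_eq]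
    simp [pow_succ', mul_assoc]

theorem act_inj {g : E} (h1 : Nz g S1) (h0 : Nz g S0) :
    Function.Injective (act h1 h0) := by
  rw [injective_iff_map_eq_one]
  intro a
  induction a using QuotientGroup.induction_on with
  | H s =>
  intro h
  rw [act_mk, ← QuotientGroup.mk_one, mk_eq] at h
  rw [← QuotientGroup.mk_one, mk_eq]
  simp at h ⊢
  exact (h0 _).2 h
end

theorem SL1 [Finite E] {p q : ℕ} (hp : p.Prime) (hq : q.Prime) (hpq : p ≠ q) {S0 S1 : Subgroup E} (h01 : S0 ≤ S1)
    (hc : ∀ s ∈ S1, ∀ t ∈ S1, s * t * s⁻¹ * t⁻¹ ∈ S0) (he : ∀ s ∈ S1, s ^ q ∈ S0)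
    {x : E} (hx : x ^ p = 1) (hx1 : Nz x S1) (hx0 : Nz x S0)
    (hne : ∃ s ∈ S1, x * s * x⁻¹ * s⁻¹ ∉ S0) {A : Subgroup E} (hA1 : ∀ y ∈ A, Nz y S1)
    (hA0 : ∀ y ∈ A, Nz y S0) (hF : Full p A x) : q ^ (p - 1) * Nat.card S0 ≤ Nat.card S1 := by
  have hn := sec_normal hc
  have h := L0g (A := S1 ⧸ S0.subgroupOf S1) hp hq hpq
    (by
      intro a b
      induction a using QuotientGroup.induction_on with
      | H s =>
      induction b using QuotientGroup.induction_on with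
      | H t =>
      rw [← QuotientGroup.mk_mul, ← QuotientGroup.mk_mul, mk_eq]
      have := hc s s.2 t t.2
      simpa [mul_assoc] using this)
    (by
      intro a
      induction a using QuotientGroup.induction_on with
      | H s =>
      rw [← QuotientGroup.mk_pow, ← QuotientGroup.mk_one, mk_eq]
      simpa using he s s.2)
    (act hx1 hx0)
    (by
      intro a
      rw [act_iter]
      induction a using QuotientGroup.induction_on with
      | H s =>
      rw [act_mk, mk_eq]
      simp [hx])
    (by
      obtain ⟨s, hs, h⟩ := hne
      refine ⟨((⟨s, hs⟩ : S1) : S1 ⧸ S0.subgroupOf S1), ?_⟩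
      rw [act_mk, Ne, mk_eq]
      exact h)
    (by
      intro k hk
      obtain ⟨y, hy, hyx⟩ := hF k hk
      refine ⟨act (hA1 y hy) (hA0 y hy), act_inj _ _, ?_⟩
      intro a
      rw [act_iter]
      induction a using QuotientGroup.induction_on with
      | H s =>
      simp only [act_mk]
      rw [mk_eq]
      simp only [← hyx]
      simp [mul_assoc])
  have h2 := Subgroup.card_eq_card_quotient_mul_card_subgroup (S0.subgroupOf S1)
  rw [Nat.card_congr (Subgroup.subgroupOfEquivOfLe h01).toEquiv] at h2
  rw [h2]
  exact Nat.mul_le_mul_right _ h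

/-- R2 -/
theorem SL2 [Finite E] {p : ℕ} (hp : p.Prime) (hpq : p ≠ 2) {S0 S1 : Subgroup E} (h01 : S0 ≤ S1)
    (hc : ∀ s ∈ S1, ∀ t ∈ S1, s * t * s⁻¹ * t⁻¹ ∈ S0) (he : ∀ s ∈ S1, s ^ 2 ∈ S0)
    {x : E} (hx : x ^ p = 1) (hx1 : Nz x S1) (hx0 : Nz x S0)
    (hne : ∃ s ∈ S1, x * s * x⁻¹ * s⁻¹ ∉ S0) {A : Subgroup E} (hA1 : ∀ y ∈ A, Nz y S1)
    (hA0 : ∀ y ∈ A, Nz y S0) (hF : Full p A x)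
    (hirr : ∀ B : Subgroup E, S0 ≤ B → B ≤ S1 → (∀ y ∈ A, Nz y B) → B = S0 ∨ B = S1)
    {u : E} (hu1 : Nz u S1) (hu0 : Nz u S0) (hun : ∃ s ∈ S1, u * s * u⁻¹ * s⁻¹ ∉ S0)
    (hux : ∀ s ∈ S1, (u * x) * s * (u * x)⁻¹ * ((x * u) * s * (x * u)⁻¹)⁻¹ ∈ S0)
    (huA : ∀ y ∈ A, ∀ s ∈ S1, (u * y) * s * (u * y)⁻¹ * ((y * u) * s * (y * u)⁻¹)⁻¹ ∈ S0) :
    2 ^ (2 * (p - 1)) * Nat.card S0 ≤ Nat.card S1 := by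
  have hn := sec_normal hc
  have h := L0g2 (A := S1 ⧸ S0.subgroupOf S1) hp hpq
    (by
      intro a b
      induction a using QuotientGroup.induction_on with
      | H s =>
      induction b using QuotientGroup.induction_on with
      | H t =>
      rw [← QuotientGroup.mk_mul, ← QuotientGroup.mk_mul, mk_eq]
      have := hc s s.2 t t.2
      simpa [mul_assoc] using this)
    (by
      intro a
      induction a using QuotientGroup.induction_on with
      | H s =>
      rw [← QuotientGroup.mk_pow, ← QuotientGroup.mk_one, mk_eq]
      simpa using he s s.2)
    (act hx1 hx0)
    (by
      intro a
      rw [act_iter]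
      induction a using QuotientGroup.induction_on with
      | H s =>
      rw [act_mk, mk_eq]
      simp [hx])
    (by
      obtain ⟨s, hs, h⟩ := hne
      refine ⟨((⟨s, hs⟩ : S1) : S1 ⧸ S0.subgroupOf S1), ?_⟩
      rw [act_mk, Ne, mk_eq]
      exact h)
    (act hu1 hu0) (act_inj _ _)
    (by
      obtain ⟨s, hs, h⟩ := hun
      refine ⟨((⟨s, hs⟩ : S1) : S1 ⧸ S0.subgroupOf S1), ?_⟩
      rw [act_mk, Ne, mk_eq]
      exact h)
    (by
      intro a
      induction a using QuotientGroup.induction_on with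
      | H s =>
      simp only [act_mk]
      rw [mk_eq]
      have := hux s s.2
      simpa [mul_assoc] using this)
    {ψ | ∃ (y : E) (hy : y ∈ A), ψ = act (hA1 y hy) (hA0 y hy)}
    (by
      rintro ψ ⟨y, hy, rfl⟩ a
      induction a using QuotientGroup.induction_on with
      | H s =>
      simp only [act_mk]
      rw [mk_eq]
      have := huA y hy s s.2
      simpa [mul_assoc] using this)
    (by
      intro B hB
      let B' : Subgroup E := (B.comap (QuotientGroup.mk' (S0.subgroupOf S1))).map S1.subtype
      have hB' : ∀ s : S1, (s : E) ∈ B' ↔ (s : S1 ⧸ S0.subgroupOf S1) ∈ B := by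
        intro s
        constructor
        · rintro ⟨t, ht, hts⟩
          have : t = s := Subtype.ext hts
          rw [← this]; exact ht
        · intro h; exact ⟨s, h, rfl⟩
      have hle : B' ≤ S1 := Subgroup.map_subtype_le _
      have := hirr B' (by
        intro s hs
        rw [hB' ⟨s, h01 hs⟩]
        have : ((⟨s, h01 hs⟩ : S1) : S1 ⧸ S0.subgroupOf S1) = (1 : S1) := by
          rw [mk_eq]; simpa using hs
        rw [this]; exact one_mem B) hle (by
        intro y hy
        apply Nz.of_le
        intro t ht
        have h1 := (hB' ⟨t, hle ht⟩).1 ht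
        have h2 := hB _ ⟨y, hy, rfl⟩ _ h1
        rw [act_mk] at h2
        exact (hB' _).2 h2)
      rcases this with h | h
      · left
        rw [eq_bot_iff]
        intro a ha
        induction a using QuotientGroup.induction_on with
        | H s =>
        have := (hB' s).2 ha
        rw [h] at this
        rw [Subgroup.mem_bot, ← QuotientGroup.mk_one, mk_eq]
        simpa using this
      · right
        rw [eq_top_iff]
        intro a _
        induction a using QuotientGroup.induction_on with
        | H s =>
        rw [← hB', h]; exact s.2)
    (by
      intro k hk
      obtain ⟨y, hy, hyx⟩ := hF k hk
      refine ⟨act (hA1 y hy) (hA0 y hy), ⟨y, hy, rfl⟩, act_inj _ _, ?_⟩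
      intro a
      rw [act_iter]
      induction a using QuotientGroup.induction_on with
      | H s =>
      simp only [act_mk]
      rw [mk_eq]
      simp only [← hyx]
      simp [mul_assoc])
  have h2 := Subgroup.card_eq_card_quotient_mul_card_subgroup (S0.subgroupOf S1)
  rw [Nat.card_congr (Subgroup.subgroupOfEquivOfLe h01).toEquiv] at h2
  rw [h2]
  exact Nat.mul_le_mul_right _ h

/-- the first layer above S0 -/
theorem layer [Finite E] {q : ℕ} (hq : q.Prime) {S0 S : Subgroup E} (h01 : S0 ≤ S) (hne : S0 ≠ S)
    (hS : IsPGroup q S) : ∃ S1 : Subgroup E, S0 ≤ S1 ∧ S1 ≤ S ∧ S0 ≠ S1 ∧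
      (∀ s ∈ S1, ∀ t ∈ S1, s * t * s⁻¹ * t⁻¹ ∈ S0) ∧ (∀ s ∈ S1, s ^ q ∈ S0) ∧
      ∀ g, Nz g S → Nz g S0 → Nz g S1 := by
  have := Fact.mk hq
  let K : Subgroup E := S ⊓ Subgroup.normalizer (S0 : Set E)
  have hKS : K ≤ S := inf_le_left
  have h0K : S0 ≤ K := le_inf h01 Subgroup.le_normalizer
  have hKp : IsPGroup q K := hS.to_le hKS
  have hn : (S0.subgroupOf K).Normal := by
    refine ⟨fun a ha b => ?_⟩
    rw [Subgroup.mem_subgroupOf] at *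
    exact (Nz.iff.2 b.2.2 a).1 ha
  have hK0 : S0 ≠ K := by
    intro h
    have hnil := IsPGroup.isNilpotent hS
    have hnc := Group.normalizerCondition_of_isNilpotent (G := S)
    have hlt : S0.subgroupOf S < ⊤ := by
      rw [lt_top_iff_ne_top, Ne, Subgroup.subgroupOf_eq_top]
      intro h2; exact hne (le_antisymm h01 h2)
    have h3 := hnc _ hlt
    rw [SetLike.lt_iff_le_and_exists] at h3
    obtain ⟨_, s, hs, hs'⟩ := h3
    apply hs'
    rw [Subgroup.mem_subgroupOf, h]
    refine ⟨s.2, Nz.iff.1 ?_⟩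
    apply Nz.of_le
    intro t ht
    have := (Subgroup.mem_normalizer_iff.1 hs ⟨t, h01 ht⟩).1 (by rwa [Subgroup.mem_subgroupOf])
    rwa [Subgroup.mem_subgroupOf] at this
  let Q := K ⧸ S0.subgroupOf K
  have hmk : ∀ s t : K, (s : Q) = t ↔ (s : E) * (t : E)⁻¹ ∈ S0 := fun s t => mk_eq
  let Z1 : Subgroup Q :=
    { carrier := {z | z ∈ Subgroup.center Q ∧ z ^ q = 1}
      one_mem' := ⟨one_mem _, one_pow _⟩
      mul_mem' := fun {a b} ha hb => ⟨mul_mem ha.1 hb.1, by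
        have : Commute a b := (Subgroup.mem_center_iff.1 hb.1 a)
        rw [this.mul_pow, ha.2, hb.2, one_mul]⟩
      inv_mem' := fun {a} ha => ⟨inv_mem ha.1, by rw [inv_pow, ha.2, inv_one]⟩ }
  let S1 : Subgroup E := (Z1.comap (QuotientGroup.mk' (S0.subgroupOf K))).map K.subtype
  have hS1 : ∀ s : E, s ∈ S1 ↔ s ∈ K ∧ (∀ t ∈ K, s * t * s⁻¹ * t⁻¹ ∈ S0) ∧ s ^ q ∈ S0 := by
    intro s
    constructor
    · rintro ⟨s, ⟨h1, h2⟩, rfl⟩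
      refine ⟨s.2, ?_, ?_⟩
      · intro t ht
        have := Subgroup.mem_center_iff.1 h1 (⟨t, ht⟩ : K)
        have h3 : (((s * ⟨t, ht⟩ : K)) : Q) = ((⟨t, ht⟩ * s : K) : Q) := this.symm
        rw [hmk] at h3
        simpa [mul_assoc] using h3
      · have h3 : ((s ^ q : K) : Q) = (1 : K) := h2
        rw [hmk] at h3
        simpa using h3
    · rintro ⟨h1, h2, h3⟩
      refine ⟨⟨s, h1⟩, ⟨?_, ?_⟩, rfl⟩
      · rw [Subgroup.mem_center_iff]
        intro a
        induction a using QuotientGroup.induction_on with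
        | H t =>
        have h4 : (((⟨s, h1⟩ * t : K)) : Q) = ((t * ⟨s, h1⟩ : K) : Q) := by
          rw [hmk]
          simpa [mul_assoc] using h2 t t.2
        exact h4.symm
      · have h4 : (((⟨s, h1⟩ : K) ^ q : K) : Q) = (1 : K) := by
          rw [hmk]; simpa using h3
        exact h4
  refine ⟨S1, ?_, ?_, ?_, ?_, ?_, ?_⟩
  · intro s hs
    rw [hS1]
    refine ⟨h0K hs, ?_, pow_mem hs _⟩
    intro t ht
    have := (Nz.iff.2 ht.2 s⁻¹).1 (inv_mem hs)
    have := mul_mem hs this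
    simpa [mul_assoc] using this
  · intro s hs; exact hKS ((hS1 s).1 hs).1
  · intro h
    have hQnt : Nontrivial Q := by
      rw [QuotientGroup.nontrivial_iff]
      rw [Ne, Subgroup.subgroupOf_eq_top]
      intro h2; exact hK0 (le_antisymm h0K h2)
    have hQp : IsPGroup q Q := hKp.to_quotient _
    have hcn := hQp.center_nontrivial
    have hcp : IsPGroup q (Subgroup.center Q) := hQp.to_subgroup _
    obtain ⟨n, hn⟩ := IsPGroup.iff_card.1 hcp
    have hd : q ∣ Nat.card (Subgroup.center Q) := by
      rw [hn]; apply dvd_pow_self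
      rintro rfl
      have := Finite.one_lt_card (α := Subgroup.center Q)
      rw [hn] at this; simp at this
    obtain ⟨z, hz⟩ := exists_prime_orderOf_dvd_card' q hd
    obtain ⟨s, hs⟩ := QuotientGroup.mk_surjective (z : Q)
    have hzq : (z : Q) ^ q = 1 := by
      have := pow_orderOf_eq_one z
      rw [hz] at this
      exact congrArg Subtype.val this
    have : (s : E) ∈ S1 := ⟨s, by
      change (s : Q) ∈ Z1
      rw [hs]; exact ⟨z.2, hzq⟩, rfl⟩
    rw [← h] at this
    have h1 : (s : Q) = (1 : K) := by rw [hmk]; simpa using this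
    rw [hs] at h1
    have h2 : z = 1 := Subtype.ext h1
    rw [h2, orderOf_one] at hz
    exact hq.one_lt.ne hz
  · intro s hs t ht
    exact ((hS1 s).1 hs).2.1 t ((hS1 t).1 ht).1
  · intro s hs; exact ((hS1 s).1 hs).2.2
  · intro g hgS hg0
    have hgK : ∀ t, t ∈ K → g⁻¹ * t * g ∈ K := by
      rintro t ⟨h1, h2⟩
      refine ⟨conj_inv_mem hgS h1, Nz.iff.1 ?_⟩
      replace h2 := Nz.iff.2 h2
      exact (hg0.inv.mul h2).mul hg0
    have hgK' : ∀ t, t ∈ K → g * t * g⁻¹ ∈ K := by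
      rintro t ⟨h1, h2⟩
      refine ⟨(hgS t).1 h1, Nz.iff.1 ?_⟩
      replace h2 := Nz.iff.2 h2
      exact (hg0.mul h2).mul hg0.inv
    apply Nz.of_le
    intro s hs
    rw [hS1] at hs ⊢
    refine ⟨hgK' s hs.1, ?_, ?_⟩
    · intro t ht
      have := (hg0 _).1 (hs.2.1 _ (hgK t ht))
      simpa [mul_assoc] using this
    · rw [conj_pow]
      exact (hg0 _).1 hs.2.2

theorem not_dvd_card_pgroup [Finite E] {p q : ℕ} (hp : p.Prime) (hq : q.Prime) (hpq : p ≠ q) {S : Subgroup E}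
    (hS : IsPGroup q S) : ¬ p ∣ Nat.card S := by
  have := Fact.mk hq
  obtain ⟨n, hn⟩ := IsPGroup.iff_card.1 hS
  rw [hn]
  intro h
  exact hpq ((Nat.prime_dvd_prime_iff_eq hp hq).1 (hp.dvd_of_dvd_pow h))

/-- fixed point in a coset -/
theorem coset_fix [Finite E] {p : ℕ} (hp : p.Prime) {x s : E} {S0 : Subgroup E} (hx : x ^ p = 1) (hx0 : Nz x S0)
    (hc : ¬ p ∣ Nat.card S0) (h : x * s * x⁻¹ * s⁻¹ ∈ S0) : ∃ t ∈ S0, x * (t * s) = (t * s) * x := by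
  obtain ⟨a, ha, hax⟩ := T4 hp hx {a | a * s⁻¹ ∈ S0} (by
    intro a ha
    have ha' : a * s⁻¹ ∈ S0 := ha
    have := mul_mem ((hx0 _).1 ha') h
    change x * a * x⁻¹ * s⁻¹ ∈ S0
    simpa [mul_assoc] using this) (by
    have : Nat.card {a | a * s⁻¹ ∈ S0} = Nat.card S0 :=
      Nat.card_congr
        { toFun := fun a => ⟨a.1 * s⁻¹, a.2⟩
          invFun := fun a => ⟨a.1 * s, by simp⟩
          left_inv := fun a => by simp
          right_inv := fun a => by simp }
    rwa [this])
  exact ⟨a * s⁻¹, ha, by simpa using hax⟩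

theorem W' [Finite E] {p q : ℕ} (hp : p.Prime) (hq : q.Prime) (hpq : p ≠ q) {S0 S : Subgroup E} (h01 : S0 ≤ S)
    (hne : S0 ≠ S) (hS : IsPGroup q S)
    {x : E} (hx : x ^ p = 1) (hx1 : Nz x S) (hx0 : Nz x S0)
    {A : Subgroup E} (hA1 : ∀ y ∈ A, Nz y S)
    (hA0 : ∀ y ∈ A, Nz y S0) (hF : Full p A x) (hC : ∀ s ∈ S, x * s = s * x → s ∈ S0) :
    q ^ (p - 1) * Nat.card S0 ≤ Nat.card S := by
  obtain ⟨S1, h1, h2, h3, h4, h5, h6⟩ := layer hq h01 hne hS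
  refine le_trans (SL1 hp hq hpq h1 h4 h5 hx (h6 x hx1 hx0) hx0 ?_ (A := A)
    (fun y hy => h6 y (hA1 y hy) (hA0 y hy)) hA0 hF) (Subgroup.card_le_of_le h2)
  by_contra hcon
  push Not at hcon
  apply h3
  refine le_antisymm h1 (fun s hs => ?_)
  obtain ⟨t, ht, htx⟩ := coset_fix hp hx hx0 (not_dvd_card_pgroup hp hq hpq (hS.to_le h01)) (hcon s hs)
  have := hC _ (mul_mem (h01 ht) (h2 hs)) htx
  exact (Subgroup.mul_mem_cancel_left _ ht).1 this

end W9

namespace W9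
variable {E : Type*} [Group E]

/-- normalizer -/
def nz (S : Subgroup E) : Subgroup E := Subgroup.normalizer (S : Set E)
theorem mem_nz {g : E} {S : Subgroup E} : g ∈ nz S ↔ Nz g S := Nz.iff.symm
/-- centralizer of an element -/
def ct (x : E) : Subgroup E := Subgroup.centralizer {x}
theorem mem_ct {g x : E} : g ∈ ct x ↔ x * g = g * x := by
  simp [ct, Subgroup.mem_centralizer_iff]
/-- centralizer of a subgroup -/
def cen (R : Subgroup E) : Subgroup E := Subgroup.centralizer (R : Set E)
theorem mem_cen {g : E} {R : Subgroup E} : g ∈ cen R ↔ ∀ t ∈ R, t * g = g * t := by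
  simp [cen, Subgroup.mem_centralizer_iff]

theorem mem_ct_conj {g x : E} : g ∈ ct x ↔ g * x * g⁻¹ = x := by
  rw [mem_ct, mul_inv_eq_iff_eq_mul, eq_comm]

theorem Nz.inf {g : E} {S T : Subgroup E} (h : Nz g S) (h' : Nz g T) : Nz g (S ⊓ T) := fun t => by
  rw [Subgroup.mem_inf, Subgroup.mem_inf, h t, h' t]

theorem Nz.cen {g : E} {R : Subgroup E} (h : Nz g R) : Nz g (cen R) := by
  have key : ∀ g : E, Nz g R → ∀ t ∈ W9.cen R, g * t * g⁻¹ ∈ W9.cen R := by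
    intro g hg t ht
    rw [mem_cen] at *
    intro r hr
    have := ht _ (conj_inv_mem hg hr)
    have h2 := congrArg (fun a => g * a * g⁻¹) this
    simpa [mul_assoc] using h2
  intro t
  refine ⟨key g h t, fun ht => ?_⟩
  have := key _ h.inv _ ht
  simpa [mul_assoc] using this

theorem Nz.zpow {g x : E} {k : ℕ} [Finite E] (h : g * x * g⁻¹ = x ^ k) : Nz g (Subgroup.zpowers x) := by
  apply Nz.of_le
  rintro _ ⟨j, rfl⟩
  refine ⟨k * j, ?_⟩
  simp only [← conj_zpow, h]
  rw [zpow_mul, zpow_natCast]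

theorem ct_eq_cen (x : E) : ct x = cen (Subgroup.zpowers x) := by
  ext g
  rw [mem_ct, mem_cen]
  constructor
  · rintro h _ ⟨j, rfl⟩
    have : Commute x g := h
    exact this.zpow_left j
  · intro h; exact h x (Subgroup.mem_zpowers x)

theorem Nz.ct {g x : E} (h : Nz g (Subgroup.zpowers x)) : Nz g (ct x) := by
  rw [ct_eq_cen]; exact h.cen

theorem Full.inf [Finite E] {p : ℕ} {A : Subgroup E} {x : E} (h : Full p A x) :
    Full p (A ⊓ nz (Subgroup.zpowers x)) x := by
  intro k hk
  obtain ⟨y, hy, h⟩ := h k hk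
  exact ⟨y, ⟨hy, mem_nz.2 (Nz.zpow h)⟩, h⟩

theorem Full.mono {p : ℕ} {A B : Subgroup E} {x : E} (h : Full p A x) (hAB : A ≤ B) : Full p B x := by
  intro k hk
  obtain ⟨y, hy, h⟩ := h k hk
  exact ⟨y, hAB hy, h⟩

/-- rank lemma -/
theorem RL [Finite E] {p q : ℕ} (hp : p.Prime) (hq : q.Prime) (hpq : p ≠ q) {S : Subgroup E}
    (hS : IsPGroup q S) {x : E} (hx : x ^ p = 1) (hx1 : Nz x S)
    {A : Subgroup E} (hA1 : ∀ y ∈ A, Nz y S) (hF : Full p A x) (hne : ∃ s ∈ S, x * s ≠ s * x) :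
    q ^ (p - 1) * Nat.card (S ⊓ ct x : Subgroup E) ≤ Nat.card S := by
  refine W' hp hq hpq inf_le_left ?_ hS hx hx1 ?_ (A := A ⊓ nz (Subgroup.zpowers x)) (fun y hy => hA1 y hy.1) ?_ hF.inf ?_
  · intro h
    obtain ⟨s, hs, h2⟩ := hne
    rw [← h] at hs
    exact h2 (mem_ct.1 hs.2)
  · exact hx1.inf (Nz.of_mem (mem_ct.2 rfl))
  · intro y hy
    exact (hA1 y hy.1).inf (mem_nz.1 hy.2).ct
  · intro s hs h; exact ⟨hs, mem_ct.2 h⟩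

theorem T2x [Finite E] {p q : ℕ} (hp : p.Prime) [Fact q.Prime] {x : E} (hx : x ^ p = 1) {M S S' : Subgroup E}
    (hM : Nz x M) (hpM : ¬ p ∣ Nat.card M) (h : SylIn q S M) (h' : SylIn q S' M) (hS : Nz x S)
    (hS' : Nz x S') : ∃ m ∈ M, x * m = m * x ∧ cj m S = S' := by
  obtain ⟨m0, hm0, h0⟩ := T2 h h'
  obtain ⟨m, hm, hmx⟩ := T4 hp hx {m | m ∈ M ∧ cj m S = S'} (by
    rintro m ⟨hm, hmS⟩
    refine ⟨(hM m).1 hm, ?_⟩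
    rw [cj_mul, cj_mul, Nz.iff_cj.1 hS.inv, hmS, Nz.iff_cj.1 hS']) (by
    intro hd
    apply hpM
    refine hd.trans ?_
    have : Nat.card {m | m ∈ M ∧ cj m S = S'} = Nat.card (M ⊓ nz S : Subgroup E) :=
      Nat.card_congr
        { toFun := fun a => ⟨m0⁻¹ * a.1, M.mul_mem (M.inv_mem hm0) a.2.1, by
            refine mem_nz.2 (Nz.iff_cj.2 ?_)
            rw [cj_mul, a.2.2, ← h0, ← cj_mul, inv_mul_cancel, cj_one]⟩
          invFun := fun a => ⟨m0 * a.1, mul_mem hm0 a.2.1, by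
            rw [cj_mul, Nz.iff_cj.1 (mem_nz.1 a.2.2), h0]⟩
          left_inv := fun a => by simp
          right_inv := fun a => by simp }
    rw [this]
    exact Subgroup.card_dvd_of_le inf_le_left)
  exact ⟨m, hm.1, hmx, hm.2⟩

theorem pow_cop_gen {p k : ℕ} {x : E} (hx : x ^ p = 1) (hk : k.Coprime p) :
    ∃ j : ℕ, (x ^ k) ^ j = x :=
  exists_pow_eq_self_of_coprime (hk.coprime_dvd_right (orderOf_dvd_of_pow_eq_one hx))

theorem GLm [Finite E] {p r : ℕ} (hp : p.Prime) [Fact r.Prime] {x : E} (hx : x ^ p = 1) {M A : Subgroup E}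
    (hM : Nz x M) (hpM : ¬ p ∣ Nat.card M) (hA : ∀ y ∈ A, Nz y M) (hF : Full p A x) :
    ∃ S, SylIn r S M ∧ Nz x S ∧ Full p (nz S) x := by
  obtain ⟨S, hS, hxS⟩ := T3 (q := r) hp hx hM hpM
  refine ⟨S, hS, hxS, ?_⟩
  intro k hk
  obtain ⟨y, hy, hyx⟩ := hF k hk
  obtain ⟨j, hj⟩ := pow_cop_gen hx hk
  have h1 : Nz x (cj y S) := by
    rw [← hj]
    apply Nz.pow
    rw [← hyx, Nz.iff_cj, ← cj_mul, inv_mul_cancel_right, cj_mul, Nz.iff_cj.1 hxS]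
  obtain ⟨m, hm, hmx, hmS⟩ := T2x hp hx hM hpM (hS.cj' (hA y hy)) hS h1 hxS
  refine ⟨m * y, mem_nz.2 (Nz.iff_cj.2 (by rw [cj_mul, hmS])), ?_⟩
  have h2 : Commute x m := hmx
  calc m * y * x * (m * y)⁻¹ = m * (y * x * y⁻¹) * m⁻¹ := by simp [mul_assoc]
    _ = x ^ k := by rw [hyx, ← (h2.pow_left k).eq]; simp

theorem GLm' [Finite E] {p r : ℕ} (hp : p.Prime) [Fact r.Prime] (hpr : p ≠ r) {x : E} (hx : x ^ p = 1) {M A : Subgroup E}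
    (hM : Nz x M) (hpM : ¬ p ∣ Nat.card M) (hA : ∀ y ∈ A, Nz y M) (hF : Full p A x)
    (hr : ¬ r ^ (p - 1) ∣ Nat.card M) :
    ∃ S, SylIn r S M ∧ S ≤ ct x := by
  obtain ⟨S, hS, hxS, hSF⟩ := GLm (r := r) hp hx hM hpM hA hF
  refine ⟨S, hS, ?_⟩
  by_contra hcon
  apply hr
  have hr1 : r.Prime := Fact.out
  have := RL hp hr1 hpr hS.isPGroup hx hxS (fun y hy => mem_nz.1 hy) hSF (by
    rw [SetLike.le_def] at hcon; push Not at hcon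
    obtain ⟨s, hs, h⟩ := hcon
    exact ⟨s, hs, fun h2 => h (mem_ct.2 h2)⟩)
  have h2 : r ^ (p - 1) ≤ Nat.card S := (Nat.le_mul_of_pos_right _ Nat.card_pos).trans this
  rw [hS.2, Nat.pow_le_pow_iff_right hr1.one_lt] at h2
  exact (pow_dvd_pow r h2).trans (Nat.ordProj_dvd _ _)

theorem U1 [Finite E] {C M : Subgroup E} (h : C ≤ M) (hr : ∀ r : ℕ, r.Prime → ∃ S, SylIn r S M ∧ S ≤ C) : C = M := by
  apply Subgroup.eq_of_le_of_card_ge h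
  apply Nat.le_of_dvd Nat.card_pos
  rw [← Nat.factorization_le_iff_dvd Nat.card_pos.ne' Nat.card_pos.ne']
  intro r
  by_cases hp : r.Prime
  · obtain ⟨S, hS, hSC⟩ := hr r hp
    have := Subgroup.card_dvd_of_le hSC
    rw [hS.2, hp.pow_dvd_iff_le_factorization Nat.card_pos.ne'] at this
    exact this
  · simp [Nat.factorization_eq_zero_of_not_prime _ hp]

/-- product count -/
theorem PC [Finite E] (C S : Subgroup E) :
    Nat.card {a : E | ∃ c ∈ C, ∃ s ∈ S, a = c * s} * Nat.card (C ⊓ S : Subgroup E) = Nat.card C * Nat.card S := by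
  rw [← Nat.card_prod, ← Nat.card_prod]
  choose c hc s hs h using fun a : {a : E | ∃ c ∈ C, ∃ s ∈ S, a = c * s} => a.2
  refine Nat.card_congr
    { toFun := fun a => (⟨c a.1 * a.2.1, C.mul_mem (hc _) a.2.2.1⟩, ⟨a.2.1⁻¹ * s a.1, S.mul_mem (S.inv_mem a.2.2.2) (hs _)⟩)
      invFun := fun b => (⟨b.1.1 * b.2.1, b.1.1, b.1.2, b.2.1, b.2.2, rfl⟩,
        ⟨(c ⟨b.1.1 * b.2.1, b.1.1, b.1.2, b.2.1, b.2.2, rfl⟩)⁻¹ * b.1.1, C.mul_mem (C.inv_mem (hc _)) b.1.2, by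
          have := h ⟨b.1.1 * b.2.1, b.1.1, b.1.2, b.2.1, b.2.2, rfl⟩
          have h3 := S.mul_mem (hs ⟨b.1.1 * b.2.1, b.1.1, b.1.2, b.2.1, b.2.2, rfl⟩) (S.inv_mem b.2.2)
          have h4 : (c ⟨b.1.1 * b.2.1, b.1.1, b.1.2, b.2.1, b.2.2, rfl⟩)⁻¹ * b.1.1 =
            s ⟨b.1.1 * b.2.1, b.1.1, b.1.2, b.2.1, b.2.2, rfl⟩ * (b.2.1 : E)⁻¹ := by
            rw [eq_mul_inv_iff_mul_eq, mul_assoc, inv_mul_eq_iff_eq_mul]; exact this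
          rw [h4]; exact h3⟩)
      left_inv := ?_
      right_inv := ?_ }
  · rintro ⟨a, d⟩
    have h1 : c a * d.1 * (d.1⁻¹ * s a) = a.1 := by rw [h a]; simp [mul_assoc]
    have h2 : (⟨c a * d.1 * (d.1⁻¹ * s a), _, C.mul_mem (hc _) d.2.1, _, S.mul_mem (S.inv_mem d.2.2) (hs _), rfl⟩ :
      {a : E | ∃ c ∈ C, ∃ s ∈ S, a = c * s}) = a := Subtype.ext h1
    ext
    · exact h1
    · simp only
      rw [h2]; simp
  · rintro ⟨b1, b2⟩
    ext
    · simp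
    · have := h ⟨b1.1 * b2.1, b1.1, b1.2, b2.1, b2.2, rfl⟩
      simp only [mul_inv_rev, inv_inv]
      rw [mul_assoc, ← this]; simp

theorem PC1 [Finite E] {C S M : Subgroup E} (hC : C ≤ M) (hS : S ≤ M) (h : ∀ m ∈ M, ∃ c ∈ C, ∃ s ∈ S, m = c * s) :
    Nat.card M * Nat.card (C ⊓ S : Subgroup E) = Nat.card C * Nat.card S := by
  rw [← PC C S]
  congr 1
  apply Nat.card_congr
  apply Equiv.setCongr
  ext m
  refine ⟨h m, ?_⟩
  rintro ⟨c, hc, s, hs, rfl⟩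
  exact mul_mem (hC hc) (hS hs)

theorem PC2 [Finite E] {C S M : Subgroup E} (hC : C ≤ M) (hS : S ≤ M)
    (h : Nat.card M * Nat.card (C ⊓ S : Subgroup E) ≤ Nat.card C * Nat.card S) :
    ∀ m ∈ M, ∃ c ∈ C, ∃ s ∈ S, m = c * s := by
  rw [← PC C S] at h
  have h1 := Nat.le_of_mul_le_mul_right h Nat.card_pos
  have hsub : {a : E | ∃ c ∈ C, ∃ s ∈ S, a = c * s} ⊆ M := by
    rintro _ ⟨c, hc, s, hs, rfl⟩
    exact mul_mem (hC hc) (hS hs)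
  have := Set.eq_of_subset_of_ncard_le hsub (by simpa [← Nat.card_coe_set_eq] using h1) (Set.toFinite _)
  intro m hm
  have hm' : m ∈ (M : Set E) := hm
  rw [← this] at hm'
  exact hm'

theorem prodL [Finite E] {C S M : Subgroup E} (hC : C ≤ M) (hS : SylIn 2 S M)
    (hr : ∀ r : ℕ, r.Prime → r ≠ 2 → ∃ R, SylIn r R M ∧ R ≤ C) :
    (∀ m ∈ M, ∃ c ∈ C, ∃ s ∈ S, m = c * s) ∧ SylIn 2 (C ⊓ S) C := by
  have := Fact.mk Nat.prime_two
  have hp2 : IsPGroup 2 (C ⊓ S : Subgroup E) := hS.isPGroup.to_le inf_le_right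
  obtain ⟨T, hT⟩ := T1' 2 C
  have hd : Nat.card (C ⊓ S : Subgroup E) ∣ Nat.card T := hT.card_dvd inf_le_left hp2
  have hle := Nat.le_of_dvd Nat.card_pos hd
  have hdvd : Nat.card M * Nat.card T ∣ Nat.card C * Nat.card S := by
    have h0 : Nat.card M ≠ 0 := Nat.card_pos.ne'
    have h1 : Nat.card T ≠ 0 := Nat.card_pos.ne'
    have h2 : Nat.card C ≠ 0 := Nat.card_pos.ne'
    have h3 : Nat.card S ≠ 0 := Nat.card_pos.ne'
    rw [← Nat.factorization_le_iff_dvd (mul_ne_zero h0 h1) (mul_ne_zero h2 h3),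
      Nat.factorization_mul h0 h1, Nat.factorization_mul h2 h3]
    intro r
    rw [Finsupp.add_apply, Finsupp.add_apply, hT.2, hS.2, Nat.prime_two.factorization_pow, Nat.prime_two.factorization_pow]
    by_cases hp : r.Prime
    · by_cases hr2 : r = 2
      · subst hr2
        simp; omega
      · obtain ⟨R, hR, hRC⟩ := hr r hp hr2
        have := Subgroup.card_dvd_of_le hRC
        rw [hR.2, hp.pow_dvd_iff_le_factorization Nat.card_pos.ne'] at this
        rw [Finsupp.single_eq_of_ne hr2, Finsupp.single_eq_of_ne hr2]
        simpa using this
    · have hr2 : r ≠ 2 := by rintro rfl; exact hp Nat.prime_two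
      simp [Nat.factorization_eq_zero_of_not_prime _ hp, hr2]
  have hmt := Nat.le_of_dvd (Nat.mul_pos Nat.card_pos Nat.card_pos) hdvd
  have h1 := PC2 hC hS.1 (le_trans (Nat.mul_le_mul_left _ hle) hmt)
  refine ⟨h1, inf_le_left, ?_⟩
  have h2 := PC1 hC hS.1 h1
  rw [← h2] at hmt
  have := Nat.le_of_mul_le_mul_left hmt Nat.card_pos
  rw [le_antisymm hle this, hT.2]

/-- Frattini lifting -/
theorem FL [Finite E] {G : Type*} [Group G] (π : E →* G) {p : ℕ} [Fact p.Prime] {σ τ : G} {Y R : Subgroup E}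
    (hR : SylIn p R Y) (hRσ : R.map π = Subgroup.zpowers σ) {y0 : E} (hy0 : y0 ∈ Y) (hτ : π y0 = τ)
    {k : ℕ} (hk : τ * σ * τ⁻¹ = σ ^ k) : ∃ y ∈ Y, Nz y R ∧ π y = τ := by
  set N1 : Subgroup E := Y ⊓ (Subgroup.zpowers σ).comap π with hN1
  have hRN : R ≤ N1 := le_inf hR.1 (by rw [← Subgroup.map_le_iff_le_comap, hRσ])
  have h1 : SylIn p R N1 := hR.of_le hRN inf_le_left
  have h2 : cj y0 R ≤ N1 := by
    rintro _ ⟨r, hr, rfl⟩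
    refine ⟨?_, ?_⟩
    · exact Y.mul_mem (Y.mul_mem hy0 (hR.1 hr)) (Y.inv_mem hy0)
    · change π (y0 * r * y0⁻¹) ∈ Subgroup.zpowers σ
      obtain ⟨j, hj⟩ := Subgroup.mem_zpowers_iff.1 (hRN hr).2
      rw [map_mul, map_mul, map_inv, hτ, ← hj, ← conj_zpow, hk]
      exact zpow_mem (pow_mem (Subgroup.mem_zpowers σ) _) _
  have h3 : SylIn p (cj y0 R) N1 := ⟨h2, by rw [card_cj, h1.2]⟩
  obtain ⟨n, hn, hnR⟩ := T2 h3 h1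
  obtain ⟨r, hr, hrn⟩ : π n ∈ R.map π := by rw [hRσ]; exact hn.2
  refine ⟨r⁻¹ * (n * y0), Y.mul_mem (Y.inv_mem (hR.1 hr)) (Y.mul_mem hn.1 hy0), ?_, ?_⟩
  · refine (Nz.of_mem (R.inv_mem hr)).mul (Nz.iff_cj.2 ?_)
    rw [cj_mul, hnR]
  · rw [map_mul, map_mul, map_inv, hrn, hτ]; simp

theorem card_map_ker [Finite E] {G : Type*} [Group G] (π : E →* G) (Y : Subgroup E) :
    Nat.card Y = Nat.card (Y.map π) * Nat.card (Y ⊓ π.ker : Subgroup E) := by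
  have h := Subgroup.card_eq_card_quotient_mul_card_subgroup (π.comp Y.subtype).ker
  rw [h, Nat.card_congr (QuotientGroup.quotientKerEquivRange (π.comp Y.subtype)).toEquiv]
  congr 1
  · rw [MonoidHom.range_comp, Subgroup.range_subtype]
  · apply Nat.card_congr
    exact { toFun := fun a => ⟨a.1, a.1.2, a.2⟩, invFun := fun a => ⟨⟨a.1, a.2.1⟩, a.2.2⟩, left_inv := fun _ => rfl, right_inv := fun _ => rfl }

theorem Zb [Finite E] {G : Type*} [Group G] [Finite G] (π : E →* G) {p : ℕ} [Fact p.Prime] {σ τ : G} (hσ : orderOf σ = p)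
    (hG : ¬ p ^ 2 ∣ Nat.card G) {Y : Subgroup E} {z : E} (hz : z ∈ Y) (hzp : z ^ p = 1) (hzσ : π z = σ)
    (hY : ¬ p ∣ Nat.card (Y ⊓ π.ker : Subgroup E)) {y0 : E} (hy0 : y0 ∈ Y) (hτ : π y0 = τ)
    {k : ℕ} (hk : τ * σ * τ⁻¹ = σ ^ k) : ∃ y ∈ Y, π y = τ ∧ y * z * y⁻¹ = z ^ k := by
  have hp : p.Prime := Fact.out
  have hzo : orderOf z = p := by
    apply Nat.dvd_antisymm (orderOf_dvd_of_pow_eq_one hzp)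
    rw [← hσ, ← hzσ]; exact orderOf_map_dvd π z
  have hS : SylIn p (Subgroup.zpowers z) Y := by
    refine ⟨by simpa using hz, ?_⟩
    rw [Nat.card_zpowers, hzo]
    have h1 : (Nat.card Y).factorization p = 1 := by
      apply le_antisymm
      · by_contra hcon
        have h2 : p ^ 2 ∣ Nat.card Y := (hp.pow_dvd_iff_le_factorization Nat.card_pos.ne').2 (by omega)
        rw [card_map_ker π Y] at h2
        apply hG
        refine dvd_trans ?_ (Subgroup.card_subgroup_dvd_card (Y.map π))
        exact Nat.Coprime.dvd_of_dvd_mul_right (Nat.Coprime.pow_left 2 ((Nat.Prime.coprime_iff_not_dvd hp).2 hY)) h2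
      · rw [← hp.dvd_iff_one_le_factorization Nat.card_pos.ne', ← hzo, ← Nat.card_zpowers]
        exact Subgroup.card_dvd_of_le (by simpa using hz)
    rw [h1, pow_one]
  obtain ⟨y, hy, hyR, hyt⟩ := FL π hS (by rw [MonoidHom.map_zpowers, hzσ]) hy0 hτ hk
  refine ⟨y, hy, hyt, ?_⟩
  obtain ⟨j, hj⟩ := Subgroup.mem_zpowers_iff.1 ((hyR z).1 (Subgroup.mem_zpowers z))
  have h2 := congrArg π hj
  simp only [map_mul, map_inv, map_zpow, hyt, hzσ, hk] at h2
  rw [← hj, ← zpow_natCast, zpow_eq_zpow_iff_modEq, hzo, ← hσ, ← zpow_eq_zpow_iff_modEq, h2, zpow_natCast]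

end W9

namespace W9

/-- standing hypotheses -/
structure Hyp {E G : Type*} [Group E] [Group G] (π : E →* G) (p : ℕ) (σ : G) : Prop where
  hp : p.Prime
  h5 : 5 ≤ p
  hsurj : Function.Surjective π
  hσ : orderOf σ = p
  hG : ¬ p ^ 2 ∣ Nat.card G
  hpN : p ∣ Nat.card π.ker
  hpN2 : ¬ p ^ 2 ∣ Nat.card π.ker
  hs : ∃ s, s ^ p = 1 ∧ π s = σ
  hperf : ∀ Q : Subgroup E, (∀ a ∈ π.ker, ∀ b ∈ π.ker, a * b * a⁻¹ * b⁻¹ ∈ Q) → π.ker ≤ Q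
  hodd : ∀ q : ℕ, q.Prime → q ≠ 2 → q ≠ p → ¬ q ^ (p - 1) ∣ Nat.card π.ker
  h2 : ¬ 2 ^ (2 * (p - 1)) ∣ Nat.card π.ker
  hk : ∀ k : ℕ, k.Coprime p → ∃ τ : G, τ * σ * τ⁻¹ = σ ^ k

/-- structure of the p-part -/
structure Pd {E G : Type*} [Group E] [Group G] (π : E →* G) (p : ℕ) (σ : G) (P V : Subgroup E) (x w : E) : Prop where
  hP : SylIn p P π.ker
  hPc : Nat.card P = p
  hx : x ^ p = 1
  hxσ : π x = σ
  hV : SylIn p V ⊤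
  hVc : ∀ a ∈ V, ∀ b ∈ V, a * b = b * a
  hVe : ∀ a ∈ V, a ^ p = 1
  hxV : x ∈ V
  hPV : P ≤ V
  hVP : ∀ v ∈ V, ∃ i : ℕ, ∃ t ∈ P, v = x ^ i * t
  hVker : V ⊓ π.ker = P
  hVm : V.map π = Subgroup.zpowers σ
  hw : w ∈ π.ker
  hwx : w * x = x * w
  hwP : Nz w P
  hwP' : w ∉ cen P
  hwV : Nz w V
  hS3 : ∀ g, Nz g V → Nz g (Subgroup.zpowers x)
  hS3' : ∀ g ∈ π.ker, Nz g V → g ∈ ct x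

section
variable {E G : Type*} [Group E] [Group G] [Finite E] [Finite G] {π : E →* G} {p : ℕ} {σ : G}

theorem ker_nz (π : E →* G) (g : E) : Nz g π.ker := by
  apply Nz.of_le
  intro t ht
  exact (inferInstance : π.ker.Normal).conj_mem t ht g

theorem Pfix {P : Subgroup E} (hp : p.Prime) (hc : Nat.card P = p) {g : E} (hg' : g ∉ cen P) :
    ∀ t ∈ P, g * t = t * g → t = 1 := by
  intro t ht h
  by_contra hne
  apply hg'
  have h1 : P ⊓ ct g ≤ P := inf_le_left
  have h2 : Nat.card (P ⊓ ct g : Subgroup E) ∣ p := by rw [← hc]; exact Subgroup.card_dvd_of_le h1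
  rcases (Nat.dvd_prime hp).1 h2 with h3 | h3
  · have := Subgroup.card_eq_one.1 h3
    have h4 : t ∈ P ⊓ ct g := ⟨ht, mem_ct.2 h⟩
    rw [this] at h4
    exact absurd h4 hne
  · have := Subgroup.eq_of_le_of_card_ge h1 (by rw [hc, h3])
    rw [mem_cen]
    intro r hr
    rw [← this] at hr
    exact (mem_ct.1 hr.2).symm

theorem Pgen {P : Subgroup E} (hp : p.Prime) (hc : Nat.card P = p) {t : E} (ht : t ∈ P) (h1 : t ≠ 1) :
    P = Subgroup.zpowers t := by
  have hle : Subgroup.zpowers t ≤ P := by simpa using ht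
  have h2 : Nat.card (Subgroup.zpowers t) ∣ p := by rw [← hc]; exact Subgroup.card_dvd_of_le hle
  rcases (Nat.dvd_prime hp).1 h2 with h3 | h3
  · exact absurd (Subgroup.zpowers_eq_bot.1 (Subgroup.card_eq_one.1 h3)) h1
  · exact (Subgroup.eq_of_le_of_card_ge hle (by rw [hc, h3])).symm

theorem Pcomm {P : Subgroup E} (hp : p.Prime) (hc : Nat.card P = p) : ∀ a ∈ P, ∀ b ∈ P, a * b = b * a := by
  intro a ha b hb
  by_cases h1 : a = 1
  · simp [h1]
  · rw [Pgen hp hc ha h1] at hb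
    obtain ⟨j, rfl⟩ := hb
    exact ((Commute.refl a).zpow_right j).eq

/-- automorphisms of a group of prime order commute -/
theorem Paut {P : Subgroup E} (hp : p.Prime) (hc : Nat.card P = p) {g w : E} (hg : Nz g P) (hw : Nz w P) :
    ∀ t ∈ P, (g⁻¹ * w * g) * t * (g⁻¹ * w * g)⁻¹ = w * t * w⁻¹ := by
  intro t ht
  by_cases h1 : t = 1
  · simp [h1]
  have hgen := Pgen hp hc ht h1
  have h2 := (hg t).1 ht
  have h3 := (hw t).1 ht
  rw [hgen] at h2 h3
  obtain ⟨b, hb⟩ := h2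
  obtain ⟨a, ha⟩ := h3
  simp only at ha hb
  calc (g⁻¹ * w * g) * t * (g⁻¹ * w * g)⁻¹ = g⁻¹ * (w * (g * t * g⁻¹) * w⁻¹) * g := by simp [mul_assoc]
    _ = g⁻¹ * ((w * t * w⁻¹) ^ b) * g := by rw [← hb, conj_zpow]
    _ = g⁻¹ * ((t ^ b) ^ a) * g := by rw [← ha, ← zpow_mul, ← zpow_mul, mul_comm]
    _ = g⁻¹ * (g * t ^ a * g⁻¹) * g := by rw [hb, conj_zpow]
    _ = w * t * w⁻¹ := by rw [← ha]; simp [mul_assoc]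

theorem fact1 {n : ℕ} (hp : p.Prime) (hn : n ≠ 0) (h1 : p ∣ n) (h2 : ¬ p ^ 2 ∣ n) : n.factorization p = 1 := by
  apply le_antisymm
  · by_contra hcon
    exact h2 ((hp.pow_dvd_iff_le_factorization hn).2 (by omega))
  · rwa [← hp.dvd_iff_one_le_factorization hn]

theorem S1step (H : Hyp π p σ) {P : Subgroup E} (hP : SylIn p P π.ker) (hc : Nat.card P = p) :
    ∃ m ∈ π.ker, Nz m P ∧ m ∉ cen P := by
  have := Fact.mk H.hp
  by_contra hcon
  push Not at hcon
  obtain ⟨Q, hQ, hQn, hpQ, hQP, -⟩ := T5 hP (fun m hm hmP t ht => (mem_cen.1 (hcon m hm hmP) t ht).symm)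
  have h1 := H.hperf Q (by
    intro a ha b hb
    obtain ⟨q1, hq1, t1, ht1, rfl⟩ := hQP a ha
    obtain ⟨q2, hq2, t2, ht2, rfl⟩ := hQP b hb
    have hcm := Pcomm H.hp hc t1 ht1 t2 ht2
    have e : q1 * t1 * (q2 * t2) * (q1 * t1)⁻¹ * (q2 * t2)⁻¹ =
      q1 * (t1 * q2 * t1⁻¹) * (t2 * q1⁻¹ * t2⁻¹) * q2⁻¹ := by
      have h2 : t1 * t2 * t1⁻¹ = t2 := by rw [hcm]; simp
      calc _ = q1 * (t1 * q2 * t1⁻¹) * (t1 * t2 * t1⁻¹) * q1⁻¹ * t2⁻¹ * q2⁻¹ := by simp [mul_assoc]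
        _ = _ := by rw [h2]; simp [mul_assoc]
    rw [e]
    exact Q.mul_mem (Q.mul_mem (Q.mul_mem hq1 ((hQn t1 (hP.1 ht1) _).1 hq2)) ((hQn t2 (hP.1 ht2) _).1 (Q.inv_mem hq1)))
      (Q.inv_mem hq2))
  exact hpQ (H.hpN.trans (Subgroup.card_dvd_of_le h1))

theorem exists_Pd (H : Hyp π p σ) : ∃ P V x w, Pd π p σ P V x w := by
  have hp := H.hp
  have := Fact.mk H.hp
  obtain ⟨s, hs, hsσ⟩ := H.hs
  have hkerpos : Nat.card π.ker ≠ 0 := Nat.card_pos.ne'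
  have hGp : p ∣ Nat.card G := by rw [← H.hσ]; exact orderOf_dvd_natCard σ
  have hsP : IsPGroup p (Subgroup.zpowers s) := by
    have h : s ≠ 1 := by
      rintro rfl
      rw [map_one] at hsσ
      have h2 := H.hσ
      rw [← hsσ, orderOf_one] at h2
      exact hp.one_lt.ne h2
    apply IsPGroup.of_card (n := 1)
    rw [Nat.card_zpowers, pow_one]; exact orderOf_eq_prime hs h
  obtain ⟨V, hV, hsV⟩ := T1 (le_top : Subgroup.zpowers s ≤ ⊤) hsP
  have hsV : s ∈ V := hsV (Subgroup.mem_zpowers s)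
  have hEc : Nat.card E = Nat.card G * Nat.card π.ker := by
    have := card_map_ker π ⊤
    rwa [Subgroup.map_top_of_surjective π H.hsurj, Subgroup.card_top, Subgroup.card_top, top_inf_eq] at this
  have hVcard : Nat.card V = p ^ 2 := by
    rw [hV.2, Subgroup.card_top, hEc, Nat.factorization_mul Nat.card_pos.ne' hkerpos, Finsupp.add_apply,
      fact1 hp Nat.card_pos.ne' hGp H.hG, fact1 hp hkerpos H.hpN H.hpN2]
  have hVcomm : ∀ a ∈ V, ∀ b ∈ V, a * b = b * a := by
    intro a ha b hb
    have := IsPGroup.isMulCommutative_of_card_eq_prime_sq hVcard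
    exact congrArg Subtype.val (this.1.1 ⟨a, ha⟩ ⟨b, hb⟩)
  have hVpi : V.map π = Subgroup.zpowers σ := by
    symm
    apply Subgroup.eq_of_le_of_card_ge
    · rw [Subgroup.zpowers_le]; exact ⟨s, hsV, hsσ⟩
    · rw [Nat.card_zpowers, H.hσ]
      have hpg : IsPGroup p (V.map π) := hV.isPGroup.map π
      obtain ⟨n, hn⟩ := IsPGroup.iff_card.1 hpg
      rw [hn]
      have : n ≤ 1 := by
        by_contra hcon
        apply H.hG
        exact (pow_dvd_pow p (by omega : 2 ≤ n)).trans (by rw [← hn]; exact Subgroup.card_subgroup_dvd_card _)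
      calc p ^ n ≤ p ^ 1 := Nat.pow_le_pow_right hp.pos this
        _ = p := pow_one p
  set P := V ⊓ π.ker with hPdef
  have hPc : Nat.card P = p := by
    have := card_map_ker π V
    rw [hVcard, hVpi, Nat.card_zpowers, H.hσ, pow_two] at this
    exact (Nat.eq_of_mul_eq_mul_left hp.pos this).symm
  have hP : SylIn p P π.ker := ⟨inf_le_right, by rw [hPc, fact1 hp hkerpos H.hpN H.hpN2, pow_one]⟩
  have hPcomm := Pcomm hp hPc
  have hPe : ∀ a ∈ P, a ^ p = 1 := by
    intro a ha
    have := pow_card_eq_one' (x := (⟨a, ha⟩ : P))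
    rw [hPc] at this
    exact congrArg Subtype.val this
  -- decomposition along an element above σ
  have hdec : ∀ s ∈ V, π s = σ → ∀ v ∈ V, ∃ i : ℕ, ∃ t ∈ P, v = s ^ i * t := by
    intro s hsV hsσ v hv
    have h1 : π v ∈ V.map π := ⟨v, hv, rfl⟩
    rw [hVpi] at h1
    obtain ⟨i, hi⟩ := mem_powers_iff_mem_zpowers.2 h1
    refine ⟨i, (s ^ i)⁻¹ * v, ⟨V.mul_mem (V.inv_mem (V.pow_mem hsV i)) hv, ?_⟩, by simp⟩
    change π _ = 1
    simp only at hi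
    rw [map_mul, map_inv, map_pow, hsσ, hi]; simp
  have hVe : ∀ a ∈ V, a ^ p = 1 := by
    intro a ha
    obtain ⟨i, t, ht, rfl⟩ := hdec s hsV hsσ a ha
    have hcm : Commute (s ^ i) t := hVcomm _ (V.pow_mem hsV i) t ht.1
    rw [hcm.mul_pow, hPe t ht, ← pow_mul, mul_comm, pow_mul, hs]; simp
  have hPnz : ∀ g, Nz g V → Nz g P := fun g hg => hg.inf (ker_nz π g)
  -- w
  obtain ⟨m, hm, hmP, hmc⟩ := S1step H hP hPc
  obtain ⟨w, hw, hwV, hwc⟩ : ∃ w ∈ π.ker, Nz w V ∧ w ∉ cen P := by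
    let L : Subgroup E := (Subgroup.zpowers σ).comap π ⊓ cen P
    have hVL : V ≤ L := by
      intro v hv
      refine ⟨?_, mem_cen.2 (fun t ht => hVcomm t ht.1 v hv)⟩
      change π v ∈ Subgroup.zpowers σ
      rw [← hVpi]; exact ⟨v, hv, rfl⟩
    have h1 : SylIn p V L := hV.of_le hVL le_top
    have h2 : cj m V ≤ L := by
      rintro _ ⟨v, hv, rfl⟩
      refine ⟨?_, (hmP.cen v).1 (hVL hv).2⟩
      change π (m * v * m⁻¹) ∈ Subgroup.zpowers σ
      rw [map_mul, map_mul, map_inv, (hm : π m = 1)]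
      simpa using (hVL hv).1
    have h3 : SylIn p (cj m V) L := ⟨h2, by rw [card_cj, h1.2]⟩
    obtain ⟨l, hl, hlV⟩ := T2 h3 h1
    obtain ⟨v, hv, hvl⟩ : π l ∈ V.map π := by rw [hVpi]; exact hl.1
    have hvc : v⁻¹ * l ∈ cen P := (cen P).mul_mem ((cen P).inv_mem (hVL hv).2) hl.2
    refine ⟨v⁻¹ * (l * m), ?_, ?_, ?_⟩
    · change π _ = 1
      rw [map_mul, map_mul, map_inv, hvl, (hm : π m = 1)]; simp
    · refine (Nz.of_mem (V.inv_mem hv)).mul (Nz.iff_cj.2 ?_)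
      rw [cj_mul, hlV]
    · intro h
      apply hmc
      rw [← mul_assoc] at h
      exact ((cen P).mul_mem_cancel_left hvc).1 h
  have hwP := hPnz w hwV
  -- x
  obtain ⟨t, ht, htx⟩ : ∃ t ∈ P, w * (s * t) = (s * t) * w := by
    have hinj : Function.Injective (fun t : P => (⟨w * t * w⁻¹ * (t : E)⁻¹, P.mul_mem ((hwP _).1 t.2) (P.inv_mem t.2)⟩ : P)) := by
      intro a b hab
      have h1 : w * a * w⁻¹ * (a : E)⁻¹ = w * b * w⁻¹ * (b : E)⁻¹ := congrArg Subtype.val hab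
      have h2 := Pfix hp hPc hwc ((b : E)⁻¹ * a) (P.mul_mem (P.inv_mem b.2) a.2) (by
        have hba := hPcomm _ (P.inv_mem b.2) _ ((hwP _).1 a.2)
        rw [mul_inv_eq_iff_eq_mul] at h1
        have h3 : w * a = w * b * w⁻¹ * (b : E)⁻¹ * a * w := by
          rw [← h1]; simp
        have hc2 := hPcomm _ ((hwP _).1 b.2) _ (P.mul_mem (P.inv_mem b.2) a.2)
        calc w * ((b : E)⁻¹ * a) = (w * (b : E) * w⁻¹)⁻¹ * (w * a) := by simp [mul_assoc]
          _ = (w * (b : E) * w⁻¹)⁻¹ * ((w * b * w⁻¹) * ((b : E)⁻¹ * a) * w) := by rw [h3]; simp [mul_assoc]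
          _ = _ := by simp [mul_assoc])
      exact Subtype.ext (inv_mul_eq_one.1 h2).symm
    have hsurj := Finite.surjective_of_injective hinj
    have ht0 : s⁻¹ * (w * s * w⁻¹) ∈ P := by
      refine ⟨V.mul_mem (V.inv_mem hsV) ((hwV s).1 hsV), ?_⟩
      change π _ = 1
      rw [map_mul, map_mul, map_mul, map_inv, map_inv, (hw : π w = 1)]; simp
    obtain ⟨t, ht⟩ := hsurj ⟨_, P.inv_mem ht0⟩
    have ht' : w * t * w⁻¹ * (t : E)⁻¹ = (s⁻¹ * (w * s * w⁻¹))⁻¹ := congrArg Subtype.val ht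
    refine ⟨t, t.2, ?_⟩
    rw [mul_inv_eq_iff_eq_mul] at ht'
    calc w * (s * t) = (w * s * w⁻¹) * (w * t * w⁻¹) * w := by simp [mul_assoc]
      _ = (s * t) * w := by rw [ht']; simp [mul_assoc]
  set x := s * t with hxdef
  have hxV : x ∈ V := V.mul_mem hsV ht.1
  have hxσ : π x = σ := by rw [hxdef, map_mul, hsσ, (ht.2 : π t = 1), mul_one]
  have hS3 : ∀ g, Nz g V → Nz g (Subgroup.zpowers x) := by
    intro g hg
    have hgP := hPnz g hg
    set w' := g⁻¹ * w * g with hw'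
    set d := w⁻¹ * w' with hd
    have hdcen : d ∈ cen P := by
      rw [mem_cen]
      intro r hr
      have h1 := Paut hp hPc hgP hwP r hr
      rw [← hw'] at h1
      have h2 : d * r * d⁻¹ = r := by
        calc d * r * d⁻¹ = w⁻¹ * (w' * r * w'⁻¹) * w := by simp [hd, mul_assoc]
          _ = r := by rw [h1]; simp [mul_assoc]
      exact (mul_inv_eq_iff_eq_mul.1 h2).symm
    have hdV : Nz d V := hwV.inv.mul ((hg.inv.mul hwV).mul hg)
    have hdx : d * x = x * d := by
      set u := x⁻¹ * (d * x * d⁻¹) with hu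
      have hdker : π d = 1 := by simp [hd, hw', MonoidHom.mem_ker.1 hw]
      have huP : u ∈ P := by
        refine ⟨V.mul_mem (V.inv_mem hxV) ((hdV x).1 hxV), ?_⟩
        change π _ = 1
        simp [hu, hdker]
      have hdpow : ∀ i : ℕ, d ^ i * x * (d ^ i)⁻¹ = x * u ^ i := by
        intro i; induction i with
        | zero => simp
        | succ i ih =>
          have hcu : d * u ^ i * d⁻¹ = u ^ i := by
            rw [mul_inv_eq_iff_eq_mul]
            exact (mem_cen.1 hdcen _ (P.pow_mem huP i)).symm
          calc d ^ (i+1) * x * (d ^ (i+1))⁻¹ = d * (d ^ i * x * (d ^ i)⁻¹) * d⁻¹ := by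
                rw [pow_succ']; simp [mul_assoc]
            _ = (d * x * d⁻¹) * (d * u ^ i * d⁻¹) := by rw [ih]; simp [mul_assoc]
            _ = x * u ^ (i+1) := by rw [hcu, pow_succ', hu]; simp [mul_assoc]
      -- p-part
      set mm := orderOf d / p ^ (orderOf d).factorization p with hmm
      have hmmul : p ^ (orderOf d).factorization p * mm = orderOf d := Nat.ordProj_mul_ordCompl_eq_self _ _
      have hmc : p.Coprime mm := Nat.coprime_ordCompl hp (orderOf_pos d).ne'
      have hpg : IsPGroup p (Subgroup.zpowers (d ^ mm)) := by
        intro y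
        refine ⟨(orderOf d).factorization p, ?_⟩
        obtain ⟨j, hj⟩ := y.2
        apply Subtype.ext
        simp only at hj
        rw [Subgroup.coe_pow, ← hj, ← zpow_natCast, zpow_comm, zpow_natCast, ← pow_mul, mul_comm, hmmul, pow_orderOf_eq_one]
        simp
      have hsup : IsPGroup p (Subgroup.zpowers (d ^ mm) ⊔ V : Subgroup E) :=
        IsPGroup.to_sup_of_normal_right' hpg hV.isPGroup (by
          rw [Subgroup.zpowers_le]; exact Nz.iff.1 (hdV.pow mm))
      have hVeq := hV.maximal le_sup_right le_top hsup
      have hdmV : d ^ mm ∈ V := by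
        rw [← hVeq]; exact (le_sup_left : Subgroup.zpowers (d ^ mm) ≤ _) (Subgroup.mem_zpowers _)
      have h1 := hdpow mm
      rw [hVcomm _ hdmV x hxV, mul_inv_cancel_right] at h1
      have h2 : u ^ mm = 1 := by simpa using h1.symm
      have h3 : u ^ p = 1 := hPe u huP
      have h4 : u = 1 := by
        have := orderOf_dvd_of_pow_eq_one h2
        have h5 := orderOf_dvd_of_pow_eq_one h3
        exact orderOf_eq_one_iff.1 (Nat.dvd_one.1 (hmc ▸ Nat.dvd_gcd h5 this))
      have h5 : d * x * d⁻¹ = x := by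
        have := congrArg (fun a => x * a) h4
        simpa [hu] using this
      exact mul_inv_eq_iff_eq_mul.1 h5
    have hw'x : w' * x = x * w' := by
      have : w' = w * d := by simp [hd]
      rw [this, mul_assoc, hdx, ← mul_assoc, htx, mul_assoc]
    have hgx : w * (g * x * g⁻¹) = (g * x * g⁻¹) * w := by
      have := congrArg (fun a => g * a * g⁻¹) hw'x
      simpa [hw', mul_assoc] using this
    obtain ⟨i, r, hr, hir⟩ := hdec x hxV hxσ _ ((hg x).1 hxV)
    have hr1 : r = 1 := by
      apply Pfix hp hPc hwc r hr
      rw [hir] at hgx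
      have hcwx : w * x ^ i = x ^ i * w := ((show Commute w x from htx).pow_right i).eq
      have : x ^ i * (w * r) = x ^ i * (r * w) := by
        rw [← mul_assoc, ← hcwx, mul_assoc, hgx, mul_assoc]
      exact mul_left_cancel this
    rw [hr1, mul_one] at hir
    exact Nz.zpow hir
  refine ⟨P, V, x, w, hP, hPc, hVe x hxV, hxσ, hV, hVcomm, hVe, hxV, inf_le_left, hdec x hxV hxσ, rfl, hVpi, hw, htx, hwP, hwc, hwV,
    hS3, ?_⟩
  intro g hg hgV
  obtain ⟨j, hj⟩ := (hS3 g hgV x).1 (Subgroup.mem_zpowers x)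
  simp only at hj
  have h2 := congrArg π hj
  simp only [map_mul, map_inv, map_zpow, MonoidHom.mem_ker.1 hg, hxσ] at h2
  rw [mem_ct_conj, ← hj]
  have h3 : σ ^ j = σ ^ (1 : ℤ) := by rw [h2]; simp
  have hxo : orderOf x = p := by
    apply Nat.dvd_antisymm (orderOf_dvd_of_pow_eq_one (hVe x hxV))
    rw [← H.hσ, ← hxσ]; exact orderOf_map_dvd π x
  rw [zpow_eq_zpow_iff_modEq, H.hσ, ← hxo, ← zpow_eq_zpow_iff_modEq, zpow_one] at h3
  exact h3

end
end W9

namespace W9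
section
variable {E G : Type*} [Group E] [Group G] [Finite E] [Finite G] {π : E →* G} {p : ℕ} {σ : G}
  {P V : Subgroup E} {x w : E}

theorem Nz.cj_cj {r : E} {S : Subgroup E} (h : Nz r S) (m : E) : Nz (m * r * m⁻¹) (cj m S) := by
  rw [Nz.iff_cj] at h ⊢
  rw [← cj_mul, inv_mul_cancel_right, cj_mul, h]

theorem ordp (H : Hyp π p σ) {z : E} (hz : z ^ p = 1) (hzσ : π z = σ) : orderOf z = p := by
  apply Nat.dvd_antisymm (orderOf_dvd_of_pow_eq_one hz)
  rw [← H.hσ, ← hzσ]; exact orderOf_map_dvd π z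

theorem xpow (H : Hyp π p σ) {z : E} (hz : z ^ p = 1) (hzσ : π z = σ) {y : E} (hy : Nz y (Subgroup.zpowers z)) {k : ℕ}
    (hk : π y * σ * (π y)⁻¹ = σ ^ k) : y * z * y⁻¹ = z ^ k := by
  obtain ⟨j, hj⟩ := (hy z).1 (Subgroup.mem_zpowers z)
  simp only at hj
  have h2 := congrArg π hj
  simp only [map_mul, map_inv, map_zpow, hzσ] at h2
  rw [hk] at h2
  rw [← hj]
  rw [← zpow_natCast, zpow_eq_zpow_iff_modEq, H.hσ, ← ordp H hz hzσ, ← zpow_eq_zpow_iff_modEq] at h2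
  rw [h2, zpow_natCast]

theorem S4 (H : Hyp π p σ) (D : Pd π p σ P V x w) {τ : G} {k : ℕ} (hk : τ * σ * τ⁻¹ = σ ^ k) :
    ∃ y, Nz y V ∧ π y = τ ∧ y * x * y⁻¹ = x ^ k := by
  have := Fact.mk H.hp
  obtain ⟨y0, hy0⟩ := H.hsurj τ
  obtain ⟨y, -, hy, hyτ⟩ := FL π D.hV D.hVm (Subgroup.mem_top y0) hy0 hk
  exact ⟨y, hy, hyτ, xpow H D.hx D.hxσ (D.hS3 y hy) (by rw [hyτ, hk])⟩

theorem frat (H : Hyp π p σ) {q : ℕ} [Fact q.Prime] {S : Subgroup E} (hS : SylIn q S π.ker) (τ : G) :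
    ∃ y, Nz y S ∧ π y = τ := by
  obtain ⟨g, hg⟩ := H.hsurj τ
  obtain ⟨m, hm, hmS⟩ := T2 (hS.cj' (ker_nz π g)) hS
  exact ⟨m * g, Nz.iff_cj.2 (by rw [cj_mul, hmS]), by rw [map_mul, (hm : π m = 1), hg, one_mul]⟩

theorem fratM (H : Hyp π p σ) {q : ℕ} [Fact q.Prime] {S : Subgroup E} (hS : SylIn q S π.ker) :
    (nz S).map π = ⊤ := by
  rw [eq_top_iff]
  rintro τ -
  obtain ⟨y, hy, hyt⟩ := frat H hS τ
  exact ⟨y, mem_nz.2 hy, hyt⟩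

theorem zdec (H : Hyp π p σ) (D : Pd π p σ P V x w) {z : E} (hz : z ∈ V) (hzσ : π z = σ) : ∃ t ∈ P, z = x * t := by
  refine ⟨x⁻¹ * z, ?_, by simp⟩
  rw [← D.hVker]
  refine ⟨V.mul_mem (V.inv_mem D.hxV) hz, ?_⟩
  change π _ = 1
  rw [map_mul, map_inv, hzσ, D.hxσ]; simp

theorem zfull (H : Hyp π p σ) {Y : Subgroup E} (hYm : ∀ k : ℕ, k.Coprime p → ∃ y ∈ Y, π y * σ * (π y)⁻¹ = σ ^ k)
    (hY : ¬ p ∣ Nat.card (Y ⊓ π.ker : Subgroup E)) {z : E} (hz : z ∈ Y) (hzp : z ^ p = 1) (hzσ : π z = σ) : Full p Y z := by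
  have := Fact.mk H.hp
  intro k hk
  obtain ⟨y0, hy0, h⟩ := hYm k hk
  obtain ⟨y, hy, -, h2⟩ := Zb π H.hσ H.hG hz hzp hzσ hY hy0 rfl h
  exact ⟨y, hy, h2⟩

theorem nzk (H : Hyp π p σ) {q : ℕ} [Fact q.Prime] {S : Subgroup E} (hS : SylIn q S π.ker) :
    ∀ k : ℕ, k.Coprime p → ∃ y ∈ nz S, π y * σ * (π y)⁻¹ = σ ^ k := by
  intro k hk
  obtain ⟨τ, hτ⟩ := H.hk k hk
  obtain ⟨y, hy, hyt⟩ := frat H hS τ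
  exact ⟨y, mem_nz.2 hy, by rw [hyt, hτ]⟩

theorem Tri (H : Hyp π p σ) (D : Pd π p σ P V x w) {q : ℕ} [Fact q.Prime] :
    ∃ S, SylIn q S π.ker ∧ ((Nz x S ∧ Full p (nz S) x) ∨
      (¬ p ∣ Nat.card (nz S ⊓ π.ker : Subgroup E) ∧ ∃ z ∈ V, Nz z S ∧ π z = σ ∧ z ≠ x ∧ Full p (nz S) z)) := by
  have hp := H.hp
  have := Fact.mk H.hp
  have hkerpos : Nat.card π.ker ≠ 0 := Nat.card_pos.ne'
  have hGp : p ∣ Nat.card G := by rw [← H.hσ]; exact orderOf_dvd_natCard σ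
  by_cases hcase : ∃ S, SylIn q S π.ker ∧ p ∣ Nat.card (nz S ⊓ π.ker : Subgroup E)
  · obtain ⟨S, hS, hpS⟩ := hcase
    obtain ⟨R, hR⟩ := T1' p (nz S)
    have hRV : SylIn p R ⊤ := by
      refine ⟨le_top, ?_⟩
      rw [hR.2]
      congr 1
      have h1 := card_map_ker π (nz S)
      rw [fratM H hS, Subgroup.card_top] at h1
      have h2 := card_map_ker π ⊤
      rw [Subgroup.map_top_of_surjective π H.hsurj, Subgroup.card_top, Subgroup.card_top, top_inf_eq] at h2
      rw [h1, Subgroup.card_top, h2, Nat.factorization_mul Nat.card_pos.ne' Nat.card_pos.ne',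
        Nat.factorization_mul Nat.card_pos.ne' Nat.card_pos.ne', Finsupp.add_apply, Finsupp.add_apply,
        fact1 hp hkerpos H.hpN H.hpN2, fact1 hp Nat.card_pos.ne' hpS
          (fun h => H.hpN2 (h.trans (Subgroup.card_dvd_of_le inf_le_right)))]
    obtain ⟨m, -, hm⟩ := T2 hRV D.hV
    have hVS : V ≤ nz (cj m S) := by
      rw [← hm]
      rintro _ ⟨r, hr, rfl⟩
      exact mem_nz.2 ((mem_nz.1 (hR.1 hr)).cj_cj m)
    have hS' := hS.cj' (ker_nz π m)
    refine ⟨cj m S, hS', Or.inl ⟨mem_nz.1 (hVS D.hxV), ?_⟩⟩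
    intro k hk
    obtain ⟨τ, hτ⟩ := H.hk k hk
    obtain ⟨y0, hy0, hyt⟩ := frat H hS' τ
    obtain ⟨y, hy, hyV, hyτ⟩ := FL π (D.hV.of_le hVS le_top) D.hVm (mem_nz.2 hy0) hyt hτ
    exact ⟨y, hy, xpow H D.hx D.hxσ (D.hS3 y hyV) (by rw [hyτ, hτ])⟩
  · push Not at hcase
    obtain ⟨S, hS⟩ := T1' q π.ker
    obtain ⟨R, hR⟩ := T1' p (nz S)
    obtain ⟨m, -, hm⟩ := T2' D.hV le_top hR.isPGroup
    have hS' := hS.cj' (ker_nz π m)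
    have hRS : cj m R ≤ nz (cj m S) := by
      rintro _ ⟨r, hr, rfl⟩
      exact mem_nz.2 ((mem_nz.1 (hR.1 hr)).cj_cj m)
    have hpc : p ∣ Nat.card (cj m R) := by
      rw [card_cj, hR.2]
      apply dvd_pow_self
      intro h0
      have h1 := card_map_ker π (nz S)
      rw [fratM H hS, Subgroup.card_top] at h1
      have h2 : p ∣ Nat.card (nz S) := by rw [h1]; exact hGp.mul_right _
      have := (hp.dvd_iff_one_le_factorization Nat.card_pos.ne').1 h2
      omega
    have hn := hcase _ hS'
    rw [card_map_ker π (cj m R)] at hpc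
    have h3 : p ∣ Nat.card ((cj m R).map π) := by
      rcases hp.dvd_mul.1 hpc with h | h
      · exact h
      · exact absurd (h.trans (Subgroup.card_dvd_of_le (inf_le_inf_right _ hRS))) hn
    have h4 : (cj m R).map π = Subgroup.zpowers σ := by
      apply Subgroup.eq_of_le_of_card_ge
      · rw [← D.hVm]; exact Subgroup.map_mono hm
      · rw [Nat.card_zpowers, H.hσ]; exact Nat.le_of_dvd Nat.card_pos h3
    obtain ⟨z, hz, hzσ⟩ : σ ∈ (cj m R).map π := by rw [h4]; exact Subgroup.mem_zpowers σ
    have hF : Full p (nz (cj m S)) z := zfull H (nzk H hS') hn (hRS hz) (D.hVe z (hm hz)) hzσ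
    refine ⟨cj m S, hS', ?_⟩
    by_cases hzx : z = x
    · left; rw [← hzx]; exact ⟨mem_nz.1 (hRS hz), hF⟩
    · right; exact ⟨hn, z, hm hz, mem_nz.1 (hRS hz), hzσ, hzx, hF⟩

theorem S7 (H : Hyp π p σ) (D : Pd π p σ P V x w) {z : E} (hz : z ∈ V) (hzσ : π z = σ) (hzx : z ≠ x) :
    ∃ Q : Subgroup E, Q ≤ π.ker ⊓ ct z ∧ (∀ m ∈ π.ker ⊓ ct z, Nz m Q) ∧ ¬ p ∣ Nat.card Q ∧
      (∀ m ∈ π.ker ⊓ ct z, ∃ a ∈ Q, ∃ b ∈ P, m = a * b) ∧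
      Nat.card Q * Nat.card P = Nat.card (π.ker ⊓ ct z : Subgroup E) := by
  have hp := H.hp
  have := Fact.mk H.hp
  have hPc : P ≤ π.ker ⊓ ct z := fun t ht => ⟨D.hP.1 ht, mem_ct.2 (D.hVc z hz t (D.hPV ht))⟩
  apply T5 (D.hP.of_le hPc inf_le_left)
  intro m hm hmP
  obtain ⟨t0, ht0, hzt⟩ := zdec H D hz hzσ
  have hmz : m * z * m⁻¹ = z := mem_ct_conj.1 hm.2
  have hxz : x = z * t0⁻¹ := by rw [hzt]; simp
  have hmV : Nz m V := by
    apply Nz.of_le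
    intro v hv
    obtain ⟨i, t, ht, rfl⟩ := D.hVP v hv
    have h1 : m * x * m⁻¹ ∈ V := by
      have : m * x * m⁻¹ = (m * z * m⁻¹) * (m * t0⁻¹ * m⁻¹) := by rw [hxz]; simp [mul_assoc]
      rw [this, hmz]
      exact V.mul_mem hz (D.hPV ((hmP _).1 (P.inv_mem ht0)))
    have : m * (x ^ i * t) * m⁻¹ = (m * x * m⁻¹) ^ i * (m * t * m⁻¹) := by rw [conj_pow]; simp [mul_assoc]
    rw [this]
    exact V.mul_mem (V.pow_mem h1 i) (D.hPV ((hmP _).1 ht))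
  have hmx := D.hS3' m hm.1 hmV
  have ht1 : t0 ≠ 1 := by
    rintro rfl
    exact hzx (by rw [hzt, mul_one])
  have hgen := Pgen hp D.hPc ht0 ht1
  have hmt : m * t0 = t0 * m := by
    have h1 : x * m = m * x := mem_ct.1 hmx
    have h2 : z * m = m * z := mem_ct.1 hm.2
    have h3 : t0 = x⁻¹ * z := by rw [hzt]; simp
    have h4 : Commute m t0 := by
      rw [h3]
      exact (Commute.inv_right (show Commute m x from h1.symm)).mul_right (show Commute m z from h2.symm)
    exact h4
  intro t ht
  rw [hgen] at ht
  obtain ⟨j, rfl⟩ := ht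
  exact ((show Commute m t0 from hmt).zpow_right j).eq

theorem noP (H : Hyp π p σ) {q : ℕ} [Fact q.Prime] {S S' : Subgroup E} (hS : SylIn q S π.ker)
    (hn : ¬ p ∣ Nat.card (nz S ⊓ π.ker : Subgroup E)) {t : E} (ht : t ∈ π.ker) (htp : t ^ p = 1) (ht1 : t ≠ 1)
    (hS' : SylIn q S' π.ker) (htS : Nz t S') : False := by
  have := Fact.mk H.hp
  obtain ⟨m, hm, hmS⟩ := T2 hS' hS
  apply hn
  have h1 : m * t * m⁻¹ ∈ (nz S ⊓ π.ker : Subgroup E) := by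
    refine ⟨?_, (ker_nz π m t).1 ht⟩
    rw [← hmS]
    exact mem_nz.2 (htS.cj_cj m)
  have h2 : orderOf (m * t * m⁻¹) = p := by
    apply orderOf_eq_prime
    · rw [conj_pow, htp]; simp
    · intro h; apply ht1; simpa using h
  rw [← h2]
  exact Subgroup.orderOf_dvd_natCard _ h1

theorem gen (H : Hyp π p σ) (D : Pd π p σ P V x w) {q : ℕ} [Fact q.Prime] (hqp : q ≠ p) {S : Subgroup E} (hS : SylIn q S π.ker)
    (hn : ¬ p ∣ Nat.card (nz S ⊓ π.ker : Subgroup E)) {z : E} (hz : z ∈ V) (hzσ : π z = σ) (hzx : z ≠ x) : ¬ S ≤ ct z := by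
  intro hle
  have hp := H.hp
  obtain ⟨Q, hQ, hQn, hpQ, -, hQc⟩ := S7 H D hz hzσ hzx
  obtain ⟨t0, ht0, hzt⟩ := zdec H D hz hzσ
  have ht1 : t0 ≠ 1 := by
    rintro rfl
    exact hzx (by rw [hzt, mul_one])
  have htp : t0 ^ p = 1 := D.hVe t0 (D.hPV ht0)
  have htQ : Nz t0 Q := hQn t0 ⟨D.hP.1 ht0, mem_ct.2 (D.hVc z hz t0 (D.hPV ht0))⟩
  obtain ⟨S', hS', htS⟩ := T3 (q := q) hp htp htQ hpQ
  refine noP H hS hn (D.hP.1 ht0) htp ht1 (S' := S') ⟨hS'.1.trans (hQ.trans inf_le_left), ?_⟩ htS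
  have h1 := hS.of_le (le_inf hS.1 hle) inf_le_left
  rw [hS'.2, ← hS.2, h1.2, ← hQc, D.hPc, Nat.factorization_mul Nat.card_pos.ne' hp.ne_zero, Finsupp.add_apply,
    hp.factorization]
  simp [hqp.symm]

theorem RLc (hp : p.Prime) {q : ℕ} (hq : q.Prime) (hpq : p ≠ q) {S M A : Subgroup E} (hS : SylIn q S M)
    (hM : ¬ q ^ (p - 1) ∣ Nat.card M) {z : E} (hz : z ^ p = 1) (hzS : Nz z S) (hA : ∀ y ∈ A, Nz y S) (hF : Full p A z) :
    S ≤ ct z := by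
  by_contra hcon
  obtain ⟨s, hs, hsz⟩ := SetLike.not_le_iff_exists.1 hcon
  have h1 := RL hp hq hpq hS.isPGroup hz hzS hA hF ⟨s, hs, fun h => hsz (mem_ct.2 h)⟩
  apply hM
  have h2 : q ^ (p - 1) ≤ Nat.card S := le_trans (Nat.le_mul_of_pos_right _ Nat.card_pos) h1
  rw [hS.2] at h2
  have h3 := (Nat.pow_le_pow_iff_right hq.one_lt).1 h2
  exact (hq.pow_dvd_iff_le_factorization Nat.card_pos.ne').2 h3

theorem S8 (H : Hyp π p σ) (D : Pd π p σ P V x w) {q : ℕ} (hq : q.Prime) (hq2 : q ≠ 2) :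
    ∃ S, SylIn q S π.ker ∧ S ≤ π.ker ⊓ ct x := by
  have := Fact.mk hq
  by_cases hqp : q = p
  · subst hqp
    exact ⟨P, D.hP, fun t ht => ⟨D.hP.1 ht, mem_ct.2 (D.hVc x D.hxV t (D.hPV ht))⟩⟩
  obtain ⟨S, hS, ⟨h1, h2⟩ | ⟨hn, z, hz, hzS, hzσ, hzx, hF⟩⟩ := Tri H D (q := q)
  · exact ⟨S, hS, le_inf hS.1 (RLc H.hp hq (Ne.symm hqp) hS (H.hodd q hq hq2 hqp) D.hx h1 (fun y hy => mem_nz.1 hy) h2)⟩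
  · exact absurd (RLc H.hp hq (Ne.symm hqp) hS (H.hodd q hq hq2 hqp) (D.hVe z hz) hzS (fun y hy => mem_nz.1 hy) hF)
      (gen H D hqp hS hn hz hzσ hzx)

theorem S9 (H : Hyp π p σ) (D : Pd π p σ P V x w) {S : Subgroup E} (hS : SylIn 2 S π.ker) :
    (∀ m ∈ π.ker, ∃ c ∈ π.ker ⊓ ct x, ∃ s ∈ S, m = c * s) ∧ SylIn 2 ((π.ker ⊓ ct x) ⊓ S) (π.ker ⊓ ct x) :=
  prodL inf_le_left hS (fun _ hr hr2 => S8 H D hr hr2)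

theorem good (H : Hyp π p σ) (D : Pd π p σ P V x w) {S : Subgroup E} (hS : SylIn 2 S π.ker) (hxS : Nz x S) :
    ∃ O : Subgroup E, O ≤ π.ker ∧ IsPGroup 2 O ∧ (∀ m ∈ π.ker, Nz m O) ∧ ∀ m ∈ π.ker, x * m * x⁻¹ * m⁻¹ ∈ O := by
  have h1 : ∀ m ∈ π.ker, x * m * x⁻¹ * m⁻¹ ∈ S := by
    intro m hm
    obtain ⟨c, hc, s, hs, hcs⟩ := (S9 H D hS).1 m⁻¹ (π.ker.inv_mem hm)
    have h2 : m = s⁻¹ * c⁻¹ := by rw [← inv_inv m, hcs]; simp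
    have h3 : x * m * x⁻¹ * m⁻¹ = (x * s⁻¹ * x⁻¹) * s := by
      have hcx : x * c⁻¹ = c⁻¹ * x := mem_ct.1 ((ct x).inv_mem hc.2)
      have h4 : c⁻¹ * x⁻¹ * c = x⁻¹ := by
        rw [← mul_right_inj x, ← mul_assoc, ← mul_assoc, hcx]; simp
      calc x * m * x⁻¹ * m⁻¹ = x * s⁻¹ * (c⁻¹ * x⁻¹ * c) * s := by rw [h2]; simp [mul_assoc]
        _ = _ := by rw [h4]
    rw [h3]
    exact S.mul_mem ((hxS _).1 (S.inv_mem hs)) hs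
  let O : Subgroup E := Subgroup.closure {a | ∃ m ∈ π.ker, a = x * m * x⁻¹ * m⁻¹}
  have hOS : O ≤ S := by
    rw [Subgroup.closure_le]
    rintro _ ⟨m, hm, rfl⟩
    exact h1 m hm
  have hO : ∀ m ∈ π.ker, x * m * x⁻¹ * m⁻¹ ∈ O := fun m hm => Subgroup.subset_closure ⟨m, hm, rfl⟩
  refine ⟨O, hOS.trans hS.1, hS.isPGroup.to_le hOS, ?_, hO⟩
  intro m hm
  apply Nz.of_le
  intro t ht
  induction ht using Subgroup.closure_induction with
  | mem t ht =>
    obtain ⟨n, hn, rfl⟩ := ht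
    have : m * (x * n * x⁻¹ * n⁻¹) * m⁻¹ = (x * m * x⁻¹ * m⁻¹)⁻¹ * (x * (m * n) * x⁻¹ * (m * n)⁻¹) := by
      simp [mul_assoc]
    rw [this]
    exact O.mul_mem (O.inv_mem (hO m hm)) (hO _ (π.ker.mul_mem hm hn))
  | one => simp
  | mul a b _ _ ha hb =>
    have : m * (a * b) * m⁻¹ = (m * a * m⁻¹) * (m * b * m⁻¹) := by simp [mul_assoc]
    rw [this]; exact O.mul_mem ha hb
  | inv a _ ha =>
    have : m * a⁻¹ * m⁻¹ = (m * a * m⁻¹)⁻¹ := by simp [mul_assoc]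
    rw [this]; exact O.inv_mem ha

end
end W9

namespace W9

structure Bad {E G : Type*} [Group E] [Group G] (π : E →* G) (p : ℕ) (σ : G) (V : Subgroup E) (x z : E) (S : Subgroup E) : Prop where
  hS : SylIn 2 S π.ker
  hn : ¬ p ∣ Nat.card (nz S ⊓ π.ker : Subgroup E)
  hz : z ∈ V
  hzS : Nz z S
  hzσ : π z = σ
  hzx : z ≠ x

section
variable {E G : Type*} [Group E] [Group G] [Finite E] [Finite G] {π : E →* G} {p : ℕ} {σ : G}
  {P V : Subgroup E} {x w z : E} {S : Subgroup E}

theorem pcm {Q : Subgroup E} {a : E} (ha : a ∈ Q) : a ^ Nat.card Q = 1 :=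
  congrArg Subtype.val (pow_card_eq_one' (x := (⟨a, ha⟩ : Q)))

theorem Nz.comm {g y : E} (h : g * y = y * g) : Nz g (Subgroup.zpowers y) := by
  apply Nz.zpow (k := 1)
  rw [pow_one, h]; simp

theorem BD1 (H : Hyp π p σ) (D : Pd π p σ P V x w) (B : Bad π p σ V x z S) {τ : G} {k : ℕ} (hk : τ * σ * τ⁻¹ = σ ^ k) :
    ∃ y, Nz y S ∧ π y = τ ∧ y * x * y⁻¹ = x ^ k ∧ y * z * y⁻¹ = z ^ k := by
  have := Fact.mk H.hp
  obtain ⟨g, hgV, hgτ, hgx⟩ := S4 H D hk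
  obtain ⟨m, hm, hmS⟩ := T2 B.hS (B.hS.cj' (ker_nz π g))
  obtain ⟨c, hc, s, hs, rfl⟩ := (S9 H D B.hS).1 m hm
  have hcS : cj c S = cj g S := by
    rw [← hmS, cj_mul, Nz.iff_cj.1 (Nz.of_mem hs)]
  have h1 : Nz (c⁻¹ * g) S := by
    rw [Nz.iff_cj, cj_mul, ← hcS, ← cj_mul, inv_mul_cancel, cj_one]
  have h2 : (c⁻¹ * g) * x * (c⁻¹ * g)⁻¹ = x ^ k := by
    calc (c⁻¹ * g) * x * (c⁻¹ * g)⁻¹ = c⁻¹ * (g * x * g⁻¹) * c := by simp [mul_assoc]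
      _ = c⁻¹ * x ^ k * c := by rw [hgx]
      _ = x ^ k := by
        have : Commute (x ^ k) c := (show Commute x c from mem_ct.1 hc.2).pow_left k
        rw [mul_assoc, this.eq]; simp
  have h3 : π (c⁻¹ * g) = τ := by rw [map_mul, map_inv, (hc.1 : π c = 1), hgτ]; simp
  obtain ⟨y, hy, hyτ, hyz⟩ := Zb π H.hσ H.hG (Y := nz S ⊓ nz (Subgroup.zpowers x)) (z := z)
    ⟨mem_nz.2 B.hzS, mem_nz.2 (Nz.comm (D.hVc z B.hz x D.hxV))⟩ (D.hVe z B.hz) B.hzσ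
    (fun h => B.hn (h.trans (Subgroup.card_dvd_of_le (inf_le_inf_right _ inf_le_left))))
    (y0 := c⁻¹ * g) ⟨mem_nz.2 h1, mem_nz.2 (Nz.zpow h2)⟩ h3 hk
  exact ⟨y, mem_nz.1 hy.1, hyτ, xpow H D.hx D.hxσ (mem_nz.1 hy.2) (by rw [hyτ, hk]), hyz⟩

/-- the acting group -/
def AA (S : Subgroup E) (x z : E) : Subgroup E := nz S ⊓ (nz (Subgroup.zpowers x) ⊓ nz (Subgroup.zpowers z))

theorem AAfull (H : Hyp π p σ) (D : Pd π p σ P V x w) (B : Bad π p σ V x z S) :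
    Full p (AA S x z) x ∧ Full p (AA S x z) z := by
  constructor <;> intro k hk
  all_goals
    obtain ⟨τ, hτ⟩ := H.hk k hk
    obtain ⟨y, h1, h2, h3, h4⟩ := BD1 H D B hτ
    refine ⟨y, ⟨mem_nz.2 h1, mem_nz.2 (Nz.zpow h3), mem_nz.2 (Nz.zpow h4)⟩, by assumption⟩

theorem cardS (H : Hyp π p σ) (B : Bad π p σ V x z S) : Nat.card S < 2 ^ (2 * (p - 1)) := by
  rw [B.hS.2]
  apply Nat.pow_lt_pow_right (by norm_num)
  by_contra hcon
  exact H.h2 ((Nat.prime_two.pow_dvd_iff_le_factorization Nat.card_pos.ne').2 (by omega))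

theorem pne2 (H : Hyp π p σ) : p ≠ 2 := by have := H.h5; omega

theorem small_of {p a b : ℕ} (h1 : 2 ^ (p - 1) * a ≤ b) (h2 : b < 2 ^ (2 * (p - 1))) : a < 2 ^ (p - 1) := by
  by_contra hcon
  push Not at hcon
  have : 2 ^ (2 * (p - 1)) ≤ b := by
    calc 2 ^ (2 * (p - 1)) = 2 ^ (p - 1) * 2 ^ (p - 1) := by rw [← pow_add]; congr 1; omega
      _ ≤ 2 ^ (p - 1) * a := Nat.mul_le_mul_left _ hcon
      _ ≤ b := h1
  omega

theorem BD2 (H : Hyp π p σ) (D : Pd π p σ P V x w) (B : Bad π p σ V x z S) :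
    2 ^ (p - 1) * Nat.card (S ⊓ ct z : Subgroup E) ≤ Nat.card S := by
  obtain ⟨s, hs, hsz⟩ := SetLike.not_le_iff_exists.1 (gen H D (pne2 H).symm B.hS B.hn B.hz B.hzσ B.hzx)
  exact RL H.hp Nat.prime_two (pne2 H) B.hS.isPGroup (D.hVe z B.hz) B.hzS (A := AA S x z)
    (fun y hy => mem_nz.1 hy.1) (AAfull H D B).2 ⟨s, hs, fun h => hsz (mem_ct.2 h)⟩

theorem count {R T : Subgroup E} {x : E} (h : ∀ c ∈ R, ∃ t ∈ T, c * x * c⁻¹ = t * x * t⁻¹) :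
    Nat.card R ≤ Nat.card (R ⊓ ct x : Subgroup E) * Nat.card T := by
  choose! t ht hc using h
  have key : Nat.card R = Nat.card (R ⧸ (R ⊓ ct x).subgroupOf R) * Nat.card ((R ⊓ ct x).subgroupOf R) :=
    Subgroup.card_eq_card_quotient_mul_card_subgroup _
  rw [Nat.card_congr (Subgroup.subgroupOfEquivOfLe (inf_le_left : R ⊓ ct x ≤ R)).toEquiv] at key
  rw [key, mul_comm]
  apply Nat.mul_le_mul_left
  apply Nat.card_le_card_of_injective (fun a => (⟨t a.out, ht _ a.out.2⟩ : T))
  intro a b hab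
  have h1 : t a.out = t b.out := congrArg Subtype.val hab
  have h2 : (a.out : E) * x * (a.out : E)⁻¹ = (b.out : E) * x * (b.out : E)⁻¹ := by
    rw [hc _ a.out.2, hc _ b.out.2, h1]
  rw [← Quotient.out_eq a, ← Quotient.out_eq b]
  change ((a.out : R) : R ⧸ (R ⊓ ct x).subgroupOf R) = ((b.out : R) : R ⧸ (R ⊓ ct x).subgroupOf R)
  rw [QuotientGroup.eq, Subgroup.mem_subgroupOf]
  refine ⟨(a.out⁻¹ * b.out : R).2, mem_ct_conj.2 ?_⟩
  have h3 := congrArg (fun e => (a.out : E)⁻¹ * e * (a.out : E)) h2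
  simp only [mul_assoc, inv_mul_cancel_left, inv_mul_cancel, mul_one] at h3
  simp only [Subgroup.coe_mul, Subgroup.coe_inv, mul_inv_rev, inv_inv, mul_assoc]
  exact h3.symm

theorem BD3a (H : Hyp π p σ) (D : Pd π p σ P V x w) (B : Bad π p σ V x z S) {c : E} (hc : c ∈ π.ker ⊓ ct z) :
    ∃ t ∈ S ⊓ ct z, c * x * c⁻¹ = t * x * t⁻¹ := by
  obtain ⟨c1, hc1, s, hs, hcs⟩ := (S9 H D B.hS).1 c⁻¹ (π.ker.inv_mem hc.1)
  have h2 : c = s⁻¹ * c1⁻¹ := by rw [← inv_inv c, hcs]; simp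
  have hxz : x * z = z * x := D.hVc x D.hxV z B.hz
  have h0 : s⁻¹ * x * s⁻¹⁻¹ = c * x * c⁻¹ := by
    have : c1⁻¹ * x * c1⁻¹⁻¹ = x := mem_ct_conj.1 ((ct x).inv_mem hc1.2)
    calc s⁻¹ * x * s⁻¹⁻¹ = s⁻¹ * (c1⁻¹ * x * c1⁻¹⁻¹) * s⁻¹⁻¹ := by rw [this]
      _ = c * x * c⁻¹ := by rw [h2]; simp [mul_assoc]
  have hzc : z * c = c * z := mem_ct.1 hc.2
  let X : Set E := {t | t ∈ S ∧ t * x * t⁻¹ = c * x * c⁻¹}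
  have hXc : Nat.card X = Nat.card (S ⊓ ct x : Subgroup E) := by
    refine Nat.card_congr ⟨fun t => ⟨s * t, S.mul_mem hs t.2.1, ?_⟩, fun t => ⟨s⁻¹ * t, S.mul_mem (S.inv_mem hs) t.2.1, ?_⟩, ?_, ?_⟩
    · refine mem_ct_conj.2 ?_
      have := t.2.2
      rw [← h0] at this
      calc (s * (t : E)) * x * (s * (t : E))⁻¹ = s * ((t : E) * x * (t : E)⁻¹) * s⁻¹ := by simp [mul_assoc]
        _ = x := by rw [this]; simp [mul_assoc]
    · have := mem_ct_conj.1 t.2.2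
      calc (s⁻¹ * (t : E)) * x * (s⁻¹ * (t : E))⁻¹ = s⁻¹ * ((t : E) * x * (t : E)⁻¹) * s⁻¹⁻¹ := by simp [mul_assoc]
        _ = _ := by rw [this, h0]
    · intro t; simp
    · intro t; simp
  obtain ⟨t, ht, htz⟩ := T4 H.hp (D.hVe z B.hz) X (by
    rintro t ⟨htS, htx⟩
    refine ⟨(B.hzS t).1 htS, ?_⟩
    have hzx' : z⁻¹ * x * z = x := by rw [mul_assoc, hxz]; simp
    calc (z * t * z⁻¹) * x * (z * t * z⁻¹)⁻¹ = z * (t * (z⁻¹ * x * z) * t⁻¹) * z⁻¹ := by simp [mul_assoc]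
      _ = (z * c) * x * (z * c)⁻¹ := by rw [hzx', htx]; simp [mul_assoc]
      _ = c * (z * x * z⁻¹) * c⁻¹ := by rw [hzc]; simp [mul_assoc]
      _ = c * x * c⁻¹ := by rw [← hxz]; simp) (by
    rw [hXc]
    exact not_dvd_card_pgroup H.hp Nat.prime_two (pne2 H) (B.hS.isPGroup.to_le inf_le_left))
  exact ⟨t, ⟨ht.1, mem_ct.2 htz⟩, ht.2.symm⟩

theorem BD3 (H : Hyp π p σ) (D : Pd π p σ P V x w) (B : Bad π p σ V x z S) : π.ker ⊓ ct z ≤ ct x := by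
  have hp := H.hp
  obtain ⟨Q, hQ, hQn, hpQ, hQP, hQc⟩ := S7 H D B.hz B.hzσ B.hzx
  obtain ⟨t0, ht0, hzt⟩ := zdec H D B.hz B.hzσ
  have hsm := small_of (BD2 H D B) (cardS H B)
  -- Q is characteristic
  have hQchar : ∀ y, Nz y (π.ker ⊓ ct z) → Nz y Q := by
    intro y hy
    apply Nz.of_le
    intro a ha
    obtain ⟨a', ha', b, hb, hab⟩ := hQP _ ((hy a).1 (hQ ha))
    have hbQ : Nz b Q := hQn b ⟨D.hP.1 hb, mem_ct.2 (D.hVc z B.hz b (D.hPV hb))⟩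
    have hpow : ∀ i : ℕ, ∃ e ∈ Q, (a' * b) ^ i = e * b ^ i := by
      intro i; induction i with
      | zero => exact ⟨1, Q.one_mem, by simp⟩
      | succ i ih =>
        obtain ⟨e, he, h⟩ := ih
        refine ⟨e * (b ^ i * a' * (b ^ i)⁻¹), Q.mul_mem he ((hbQ.pow i a').1 ha'), ?_⟩
        rw [pow_succ, h, pow_succ]; simp [mul_assoc]
    obtain ⟨e, he, h1⟩ := hpow (Nat.card Q)
    have h2 : a ^ Nat.card Q = 1 := pcm ha
    rw [← hab, conj_pow, h2] at h1
    have h3 : b ^ Nat.card Q ∈ Q := by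
      have : b ^ Nat.card Q = e⁻¹ := by
        exact (inv_eq_of_mul_eq_one_right (by rw [← h1]; simp)).symm
      rw [this]; exact Q.inv_mem he
    have hbp : b ^ p = 1 := D.hVe b (D.hPV hb)
    have hcop : (Nat.card Q * Nat.card Q).Coprime p := by
      have : (Nat.card Q).Coprime p := ((hp.coprime_iff_not_dvd).2 hpQ).symm
      exact this.mul_left this
    have h4 : b ^ (Nat.card Q * Nat.card Q) = 1 := by rw [pow_mul]; exact pcm h3
    have h5 : b = 1 := by
      have h6 := orderOf_dvd_of_pow_eq_one h4
      have h7 := orderOf_dvd_of_pow_eq_one hbp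
      exact orderOf_eq_one_iff.1 (Nat.dvd_one.1 (hcop ▸ Nat.dvd_gcd h6 h7))
    rw [hab, h5, mul_one]; exact ha'
  have hxQ : Nz x Q := by
    apply hQchar
    exact (ker_nz π x).inf (Nz.ct (Nz.comm (D.hVc x D.hxV z B.hz)))
  have hQx : Q ⊓ ct x = Q := by
    apply U1 inf_le_left
    intro r hr
    have := Fact.mk hr
    by_cases hrp : r = p
    · subst hrp
      obtain ⟨R, hR⟩ := T1' r Q
      refine ⟨R, hR, ?_⟩
      have : Nat.card R = 1 := by rw [hR.2, Nat.factorization_eq_zero_of_not_dvd hpQ, pow_zero]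
      rw [Subgroup.card_eq_one.1 this]; exact bot_le
    obtain ⟨R, hR, hxR, hF⟩ := GLm (r := r) hp D.hx hxQ hpQ (A := AA S x z) (by
      intro y hy
      exact hQchar y ((ker_nz π y).inf (Nz.ct (mem_nz.1 hy.2.2)))) (AAfull H D B).1
    refine ⟨R, hR, le_inf hR.1 ?_⟩
    by_contra hcon
    obtain ⟨s, hs, hsx⟩ := SetLike.not_le_iff_exists.1 hcon
    have h1 := RL hp hr (Ne.symm hrp) hR.isPGroup D.hx hxR (fun y hy => mem_nz.1 hy) hF ⟨s, hs, fun h => hsx (mem_ct.2 h)⟩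
    have h2 := count (R := R) (T := S ⊓ ct z) (x := x) (fun c hc => BD3a H D B (hQ (hR.1 hc)))
    have h3 : 0 < Nat.card (R ⊓ ct x : Subgroup E) := Nat.card_pos
    have h4 : 2 ^ (p - 1) ≤ r ^ (p - 1) := Nat.pow_le_pow_left hr.two_le _
    have h5 : 2 ^ (p - 1) * Nat.card (R ⊓ ct x : Subgroup E) ≤ Nat.card (S ⊓ ct z : Subgroup E) * Nat.card (R ⊓ ct x : Subgroup E) :=
      (Nat.mul_le_mul_right _ h4).trans (h1.trans (h2.trans (mul_comm _ _).le))
    have := Nat.le_of_mul_le_mul_right h5 h3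
    omega
  intro m hm
  obtain ⟨a, ha, b, hb, rfl⟩ := hQP m hm
  rw [← hQx] at ha
  exact (ct x).mul_mem ha.2 (mem_ct.2 (D.hVc x D.hxV b (D.hPV hb)))

end
end W9

namespace W9
section
variable {E G : Type*} [Group E] [Group G] [Finite E] [Finite G] {π : E →* G} {p : ℕ} {σ : G}
  {P V : Subgroup E} {x w z : E} {S : Subgroup E}

theorem zAA (D : Pd π p σ P V x w) (B : Bad π p σ V x z S) : z ∈ AA S x z :=
  ⟨mem_nz.2 B.hzS, mem_nz.2 (Nz.comm (D.hVc z B.hz x D.hxV)), mem_nz.2 (Nz.comm rfl)⟩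

theorem SCne (H : Hyp π p σ) (D : Pd π p σ P V x w) (B : Bad π p σ V x z S) : S ⊓ ct x ≠ S := by
  intro h
  have hSx : S ≤ ct x := inf_eq_left.1 h
  obtain ⟨t0, ht0, hzt⟩ := zdec H D B.hz B.hzσ
  have ht1 : t0 ≠ 1 := by
    rintro rfl
    exact B.hzx (by rw [hzt, mul_one])
  have hxS : Nz x S := by
    apply Nz.of_le
    intro s hs
    rw [mem_ct.1 (hSx hs)]; simpa using hs
  refine noP H B.hS B.hn (D.hP.1 ht0) (D.hVe t0 (D.hPV ht0)) ht1 B.hS ?_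
  have : t0 = x⁻¹ * z := by rw [hzt]; simp
  rw [this]; exact hxS.inv.mul B.hzS

theorem BD4a (H : Hyp π p σ) (D : Pd π p σ P V x w) (B : Bad π p σ V x z S) :
    2 ^ (p - 1) * Nat.card (S ⊓ ct x : Subgroup E) ≤ Nat.card S := by
  have hA : ∀ y ∈ AA S x z, Nz y (S ⊓ ct x) := fun y hy => (mem_nz.1 hy.1).inf (Nz.ct (mem_nz.1 hy.2.1))
  exact W' H.hp Nat.prime_two (pne2 H) inf_le_left (SCne H D B) B.hS.isPGroup (D.hVe z B.hz) B.hzS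
    (hA z (zAA D B)) (A := AA S x z) (fun y hy => mem_nz.1 hy.1) hA (AAfull H D B).2
    (fun s hs hsz => ⟨hs, BD3 H D B ⟨B.hS.1 hs, mem_ct.2 hsz⟩⟩)

theorem BD4 (H : Hyp π p σ) (D : Pd π p σ P V x w) (B : Bad π p σ V x z S) : S ⊓ ct x = S ⊓ ct z := by
  have hA : ∀ y ∈ AA S x z, Nz y (S ⊓ ct x) := fun y hy => (mem_nz.1 hy.1).inf (Nz.ct (mem_nz.1 hy.2.1))
  apply le_antisymm
  · refine le_inf inf_le_left ?_
    by_contra hcon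
    obtain ⟨s, hs, hsx⟩ := SetLike.not_le_iff_exists.1 hcon
    have h1 := RL H.hp Nat.prime_two (pne2 H) (B.hS.isPGroup.to_le inf_le_left) (D.hVe z B.hz) (hA z (zAA D B)) hA
      (AAfull H D B).2 ⟨s, hs, fun h => hsx (mem_ct.2 h)⟩
    have h2 := small_of (BD4a H D B) (cardS H B)
    have h3 : 0 < Nat.card ((S ⊓ ct x) ⊓ ct z : Subgroup E) := Nat.card_pos
    have := Nat.le_mul_of_pos_right (2 ^ (p - 1)) h3
    omega
  · exact fun s hs => ⟨hs.1, BD3 H D B ⟨B.hS.1 hs.1, hs.2⟩⟩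

theorem Ptriv (H : Hyp π p σ) (D : Pd π p σ P V x w) (B : Bad π p σ V x z S) {c : E} (hcx : c ∈ ct x) (hcz : c ∈ ct z) :
    c ∈ cen P := by
  obtain ⟨t0, ht0, hzt⟩ := zdec H D B.hz B.hzσ
  have ht1 : t0 ≠ 1 := by
    rintro rfl
    exact B.hzx (by rw [hzt, mul_one])
  rw [mem_cen]
  intro t ht
  rw [Pgen H.hp D.hPc ht0 ht1] at ht
  obtain ⟨j, rfl⟩ := ht
  have h3 : t0 = x⁻¹ * z := by rw [hzt]; simp
  have h4 : Commute t0 c := by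
    rw [h3]
    exact (Commute.inv_left (show Commute x c from mem_ct.1 hcx)).mul_left (show Commute z c from mem_ct.1 hcz)
  exact (h4.zpow_left j).eq

theorem five (H : Hyp π p σ) (D : Pd π p σ P V x w) (B : Bad π p σ V x z S) (h5 : p = 5)
    (h32 : ¬ 2 ^ 5 ∣ Nat.card π.ker) : False := by
  subst h5
  have hcard : Nat.card S ≤ 2 ^ 4 := by
    rw [B.hS.2]
    apply Nat.pow_le_pow_right (by norm_num)
    by_contra hcon
    exact h32 ((Nat.prime_two.pow_dvd_iff_le_factorization Nat.card_pos.ne').2 (by omega))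
  have h1 := BD4a H D B
  have h2 : 0 < Nat.card (S ⊓ ct x : Subgroup E) := Nat.card_pos
  have h3 : Nat.card (S ⊓ ct x : Subgroup E) = 1 := by
    have e1 : (2:ℕ) ^ (5 - 1) = 16 := by norm_num
    have e2 : (2:ℕ) ^ 4 = 16 := by norm_num
    rw [e1] at h1
    rw [e2] at hcard
    omega
  have h4 : (π.ker ⊓ ct x) ⊓ S = S ⊓ ct x := by
    ext a; constructor
    · exact fun h => ⟨h.2, h.1.2⟩
    · exact fun h => ⟨⟨B.hS.1 h.1, h.2⟩, h.1⟩
  have h5 := (S9 H D B.hS).2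
  rw [h4] at h5
  have h6 : ¬ 2 ∣ Nat.card (π.ker ⊓ ct x : Subgroup E) := by
    intro h
    have h7 := h5.2
    rw [h3] at h7
    have h8 := (Nat.prime_two.dvd_iff_one_le_factorization Nat.card_pos.ne').1 h
    have : 2 ^ 1 ≤ 2 ^ (Nat.card (π.ker ⊓ ct x : Subgroup E)).factorization 2 := Nat.pow_le_pow_right (by norm_num) h8
    omega
  have hwm : w ^ Nat.card (π.ker ⊓ ct x : Subgroup E) = 1 := pcm ⟨D.hw, mem_ct.2 D.hwx.symm⟩
  have hw4 : w ^ 4 ∈ cen P := by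
    rw [mem_cen]
    intro t ht
    by_cases ht1 : t = 1
    · simp [ht1]
    have hgen := Pgen H.hp D.hPc ht ht1
    have h2 := (D.hwP t).1 ht
    rw [hgen] at h2
    obtain ⟨a, ha⟩ := mem_powers_iff_mem_zpowers.2 h2
    simp only at ha
    have h3 : ∀ i : ℕ, w ^ i * t * (w ^ i)⁻¹ = t ^ (a ^ i) := by
      intro i; induction i with
      | zero => simp
      | succ i ih =>
        calc w ^ (i+1) * t * (w ^ (i+1))⁻¹ = w * (w ^ i * t * (w ^ i)⁻¹) * w⁻¹ := by rw [pow_succ']; simp [mul_assoc]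
          _ = (w * t * w⁻¹) ^ (a ^ i) := by rw [ih, conj_pow]
          _ = _ := by rw [← ha, ← pow_mul, pow_succ']
    have h4 := h3 4
    have ht5 : t ^ 5 = 1 := D.hVe t (D.hPV ht)
    have hto : orderOf t = 5 := orderOf_eq_prime ht5 ht1 (hp := ⟨H.hp⟩)
    have h5 : t ^ (a ^ 4) = t ^ 1 := by
      rw [pow_eq_pow_iff_modEq, hto]
      have ha5 : a % 5 ≠ 0 := by
        intro h
        have : t ^ a = 1 := by rw [← orderOf_dvd_iff_pow_eq_one, hto]; exact Nat.dvd_of_mod_eq_zero h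
        rw [this] at ha
        apply ht1
        have := ha.symm
        simpa using this
      have : a % 5 < 5 := Nat.mod_lt _ (by norm_num)
      unfold Nat.ModEq
      rw [Nat.pow_mod]
      interval_cases (a % 5) <;> simp_all
    rw [h5, pow_one] at h4
    exact (mul_inv_eq_iff_eq_mul.1 h4).symm
  apply D.hwP'
  have hcop : Nat.gcd 4 (Nat.card (π.ker ⊓ ct x : Subgroup E)) = 1 := by
    have : Nat.Coprime 2 (Nat.card (π.ker ⊓ ct x : Subgroup E)) := (Nat.prime_two.coprime_iff_not_dvd).2 h6
    have := this.pow_left 2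
    simpa using this
  have hb := Nat.gcd_eq_gcd_ab 4 (Nat.card (π.ker ⊓ ct x : Subgroup E))
  rw [hcop] at hb
  have : w = w ^ (((1 : ℕ) : ℤ)) := by simp
  rw [this, hb, zpow_add, zpow_mul, zpow_mul, zpow_natCast, zpow_natCast, hwm]
  simp only [one_zpow, mul_one]
  exact (cen P).zpow_mem hw4 _

/-- irreducibility -/
theorem irr (H : Hyp π p σ) (D : Pd π p σ P V x w) (B : Bad π p σ V x z S) {A : Subgroup E} (hzA : z ∈ A)
    (hAS : A ≤ nz S) (hAz : A ≤ nz (Subgroup.zpowers z)) (hF : Full p A z) :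
    ∀ K : Subgroup E, S ⊓ ct x ≤ K → K ≤ S → (∀ y ∈ A, Nz y K) → K = S ⊓ ct x ∨ K = S := by
  intro K h1 h2 h3
  by_contra hcon
  push Not at hcon
  have hA : ∀ y ∈ A, Nz y (S ⊓ ct x) := by
    intro y hy
    rw [BD4 H D B]
    exact (mem_nz.1 (hAS hy)).inf (Nz.ct (mem_nz.1 (hAz hy)))
  have hC : ∀ s ∈ S, z * s = s * z → s ∈ S ⊓ ct x := by
    intro s hs hsz
    rw [BD4 H D B]; exact ⟨hs, mem_ct.2 hsz⟩
  have e1 := W' H.hp Nat.prime_two (pne2 H) h2 hcon.2 B.hS.isPGroup (D.hVe z B.hz) B.hzS (h3 z hzA)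
    (fun y hy => mem_nz.1 (hAS hy)) h3 hF (fun s hs hsz => h1 (hC s hs hsz))
  have e2 := W' H.hp Nat.prime_two (pne2 H) h1 (Ne.symm hcon.1) (B.hS.isPGroup.to_le h2) (D.hVe z B.hz) (h3 z hzA) (hA z hzA)
    h3 hA hF (fun s hs hsz => hC s (h2 hs) hsz)
  have e3 := small_of e1 (cardS H B)
  have e4 : 0 < Nat.card (S ⊓ ct x : Subgroup E) := Nat.card_pos
  have := Nat.le_mul_of_pos_right (2 ^ (p - 1)) e4
  omega

theorem hneS (H : Hyp π p σ) (D : Pd π p σ P V x w) (B : Bad π p σ V x z S) :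
    ∃ s ∈ S, z * s * z⁻¹ * s⁻¹ ∉ S ⊓ ct x := by
  by_contra hcon
  push Not at hcon
  apply SCne H D B
  apply le_antisymm inf_le_left
  intro s hs
  obtain ⟨t, ht, h⟩ := coset_fix H.hp (D.hVe z B.hz) (S0 := S ⊓ ct x) (s := s) (B.hzS.inf (Nz.ct (Nz.comm (D.hVc z B.hz x D.hxV))))
    (not_dvd_card_pgroup H.hp Nat.prime_two (pne2 H) (B.hS.isPGroup.to_le inf_le_left)) (hcon s hs)
  have h1 : t * s ∈ S ⊓ ct x := by
    rw [BD4 H D B]; exact ⟨S.mul_mem ht.1 hs, mem_ct.2 h⟩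
  exact ((S ⊓ ct x).mul_mem_cancel_left ht).1 h1

/-- elements centralizing `D0` modulo `S` -/
def Y1 (S D0 : Subgroup E) : Subgroup E where
  carrier := {y | Nz y S ∧ ∀ u ∈ D0, y * u * y⁻¹ * u⁻¹ ∈ S}
  one_mem' := ⟨Nz.one S, by intro u _; simp⟩
  mul_mem' := by
    rintro a b ⟨ha, ha'⟩ ⟨hb, hb'⟩
    refine ⟨ha.mul hb, fun u hu => ?_⟩
    have : a * b * u * (a * b)⁻¹ * u⁻¹ = (a * (b * u * b⁻¹ * u⁻¹) * a⁻¹) * (a * u * a⁻¹ * u⁻¹) := by simp [mul_assoc]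
    rw [this]
    exact S.mul_mem ((ha _).1 (hb' u hu)) (ha' u hu)
  inv_mem' := by
    rintro a ⟨ha, ha'⟩
    refine ⟨ha.inv, fun u hu => ?_⟩
    have : a⁻¹ * u * a⁻¹⁻¹ * u⁻¹ = a⁻¹ * (a * u * a⁻¹ * u⁻¹)⁻¹ * a := by simp [mul_assoc]
    rw [this]
    exact conj_inv_mem ha (S.inv_mem (ha' u hu))

theorem Y1conj {S D0 : Subgroup E} {g y : E} (hg : Nz g S) (hgD : Nz g D0) (hy : y ∈ Y1 S D0) : g * y * g⁻¹ ∈ Y1 S D0 := by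
  refine ⟨(hg.mul hy.1).mul hg.inv, fun u hu => ?_⟩
  have : g * y * g⁻¹ * u * (g * y * g⁻¹)⁻¹ * u⁻¹ = g * (y * (g⁻¹ * u * g) * y⁻¹ * (g⁻¹ * u * g)⁻¹) * g⁻¹ := by simp [mul_assoc]
  rw [this]
  exact (hg _).1 (hy.2 _ (conj_inv_mem hgD hu))

theorem D0dec (H : Hyp π p σ) (D : Pd π p σ P V x w) (B : Bad π p σ V x z S) :
    ∀ u ∈ nz S ⊓ π.ker, ∃ c ∈ (nz S ⊓ π.ker) ⊓ ct z, ∃ s ∈ S, u = c * s := by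
  have hSD : S ≤ nz S ⊓ π.ker := fun s hs => ⟨mem_nz.2 (Nz.of_mem hs), B.hS.1 hs⟩
  refine (prodL inf_le_left (B.hS.of_le hSD inf_le_right) ?_).1
  intro r hr hr2
  have := Fact.mk hr
  by_cases hrp : r = p
  · subst hrp
    obtain ⟨R, hR⟩ := T1' r (nz S ⊓ π.ker)
    refine ⟨R, hR, ?_⟩
    have : Nat.card R = 1 := by rw [hR.2, Nat.factorization_eq_zero_of_not_dvd B.hn, pow_zero]
    rw [Subgroup.card_eq_one.1 this]; exact bot_le
  have hn : ∀ y ∈ nz S, Nz y (nz S ⊓ π.ker) := fun y hy => (Nz.of_mem hy).inf (ker_nz π y)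
  obtain ⟨R, hR, hRz⟩ := GLm' H.hp (Ne.symm hrp) (D.hVe z B.hz) (hn z (mem_nz.2 B.hzS)) B.hn hn
    ((AAfull H D B).2.mono inf_le_left)
    (fun h => H.hodd r hr hr2 hrp (h.trans (Subgroup.card_dvd_of_le inf_le_right)))
  exact ⟨R, hR, le_inf hR.1 hRz⟩

theorem A1full (H : Hyp π p σ) (D : Pd π p σ P V x w) (B : Bad π p σ V x z S)
    (star : ∀ k : ℕ, k.Coprime p → ∃ τ ∈ Subgroup.normalClosure {σ}, τ * σ * τ⁻¹ = σ ^ k) :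
    z ∈ Y1 S (nz S ⊓ π.ker) ∧ Full p (Y1 S (nz S ⊓ π.ker)) z := by
  have hz : z ∈ Y1 S (nz S ⊓ π.ker) := by
    refine ⟨B.hzS, fun u hu => ?_⟩
    obtain ⟨c, hc, s, hs, rfl⟩ := D0dec H D B u hu
    have hcz : z * c = c * z := mem_ct.1 hc.2
    have : z * (c * s) * z⁻¹ * (c * s)⁻¹ = c * (z * s * z⁻¹ * s⁻¹) * c⁻¹ := by
      rw [← mul_assoc z c s, hcz]; simp [mul_assoc]
    rw [this]
    exact (mem_nz.1 hc.1.1 _).1 (S.mul_mem ((B.hzS s).1 hs) (S.inv_mem hs))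
  refine ⟨hz, zfull H ?_ ?_ hz (D.hVe z B.hz) B.hzσ⟩
  · intro k hk
    obtain ⟨τ, hτ, h⟩ := star k hk
    have hnorm : ((Y1 S (nz S ⊓ π.ker)).map π).Normal := by
      constructor
      rintro _ ⟨y, hy, rfl⟩ g
      obtain ⟨h, hh, rfl⟩ := frat H B.hS g
      refine ⟨h * y * h⁻¹, Y1conj hh ((Nz.of_mem (mem_nz.2 hh)).inf (ker_nz π h)) hy, by simp⟩
    have hle : Subgroup.normalClosure {σ} ≤ (Y1 S (nz S ⊓ π.ker)).map π := by
      apply Subgroup.normalClosure_le_normal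
      rintro _ rfl
      exact ⟨z, hz, B.hzσ⟩
    obtain ⟨y, hy, rfl⟩ := hle hτ
    exact ⟨y, hy, h⟩
  · intro h
    apply B.hn
    refine h.trans (Subgroup.card_dvd_of_le (inf_le_inf_right _ ?_))
    exact fun y hy => mem_nz.2 hy.1

theorem BD5 (H : Hyp π p σ) (D : Pd π p σ P V x w) (B : Bad π p σ V x z S) :
    (∀ s ∈ S, ∀ t ∈ S, s * t * s⁻¹ * t⁻¹ ∈ S ⊓ ct x) ∧ (∀ s ∈ S, s ^ 2 ∈ S ⊓ ct x) := by
  obtain ⟨S1, h1, h2, h3, h4, h5, h6⟩ := layer Nat.prime_two (inf_le_left : S ⊓ ct x ≤ S) (SCne H D B) B.hS.isPGroup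
  have hS1 : S1 = S := by
    rcases irr H D B (A := AA S x z) (zAA D B) inf_le_left (inf_le_right.trans inf_le_right) (AAfull H D B).2 S1 h1 h2
      (fun y hy => h6 y (mem_nz.1 hy.1) ((mem_nz.1 hy.1).inf (Nz.ct (mem_nz.1 hy.2.1)))) with h | h
    · exact absurd h.symm h3
    · exact h
  rw [hS1] at h4 h5
  exact ⟨h4, h5⟩

theorem BD6 (H : Hyp π p σ) (D : Pd π p σ P V x w) (B : Bad π p σ V x z S)
    (star : ∀ k : ℕ, k.Coprime p → ∃ τ ∈ Subgroup.normalClosure {σ}, τ * σ * τ⁻¹ = σ ^ k)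
    {u : E} (hu : u ∈ nz S ⊓ π.ker) (hu0 : Nz u (S ⊓ ct x)) : ∀ s ∈ S, u * s * u⁻¹ * s⁻¹ ∈ S ⊓ ct x := by
  obtain ⟨hc, he⟩ := BD5 H D B
  obtain ⟨c, hcD, t, ht, rfl⟩ := D0dec H D B u hu
  have hSn : ∀ t ∈ S, Nz t (S ⊓ ct x) := by
    intro t ht
    apply Nz.of_le
    intro s hs
    have := (S ⊓ ct x).mul_mem (hc t ht s hs.1) hs
    simpa using this
  have hcn : Nz c (S ⊓ ct x) := by
    have := hu0.mul (hSn t ht).inv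
    simpa using this
  have hcS : Nz c S := mem_nz.1 hcD.1.1
  have key : ∀ s ∈ S, c * s * c⁻¹ * s⁻¹ ∈ S ⊓ ct x := by
    by_contra hcon
    push Not at hcon
    have hcz : z * c = c * z := mem_ct.1 hcD.2
    obtain ⟨hzY, hYF⟩ := A1full H D B star
    have hA1S : Y1 S (nz S ⊓ π.ker) ⊓ nz (Subgroup.zpowers z) ≤ nz S := fun y hy => mem_nz.2 hy.1.1
    have hA0 : ∀ y ∈ Y1 S (nz S ⊓ π.ker) ⊓ nz (Subgroup.zpowers z), Nz y (S ⊓ ct x) := by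
      intro y hy
      rw [BD4 H D B]
      exact hy.1.1.inf (Nz.ct (mem_nz.1 hy.2))
    have hzA : z ∈ Y1 S (nz S ⊓ π.ker) ⊓ nz (Subgroup.zpowers z) := ⟨hzY, mem_nz.2 (Nz.comm rfl)⟩
    have h1 := SL2 H.hp (pne2 H) (inf_le_left : S ⊓ ct x ≤ S) hc he (D.hVe z B.hz) B.hzS (hA0 z hzA) (hneS H D B)
      (fun y hy => mem_nz.1 (hA1S hy)) hA0 hYF.inf (irr H D B hzA hA1S inf_le_right hYF.inf) hcS hcn hcon
      (by intro s _; rw [hcz, mul_inv_cancel]; exact (S ⊓ ct x).one_mem)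
      (by
        intro y hy s hs
        have hk := hy.1.2 c hcD.1
        have hs' : c * y * s * (c * y)⁻¹ ∈ S := ((hcS.mul hy.1.1) s).1 hs
        have h2 := hc _ hs' _ hk
        have h3 : c * y * s * (c * y)⁻¹ * (y * c * s * (y * c)⁻¹)⁻¹ =
          c * y * s * (c * y)⁻¹ * (y * c * y⁻¹ * c⁻¹) * (c * y * s * (c * y)⁻¹)⁻¹ * (y * c * y⁻¹ * c⁻¹)⁻¹ := by
          simp [mul_assoc]
        rw [h3]; exact h2)
    have h2 : 0 < Nat.card (S ⊓ ct x : Subgroup E) := Nat.card_pos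
    have h3 := Nat.le_mul_of_pos_right (2 ^ (2 * (p - 1))) h2
    have h4 := cardS H B
    omega
  intro s hs
  have h1 : c * t * s * (c * t)⁻¹ * s⁻¹ = (c * (t * s * t⁻¹ * s⁻¹) * c⁻¹) * (c * s * c⁻¹ * s⁻¹) := by simp [mul_assoc]
  rw [h1]
  exact (S ⊓ ct x).mul_mem ((hcn _).1 (hc t ht s hs)) (key s hs)

end
end W9

namespace W9
section
variable {E : Type*} [Group E] [Finite E]

theorem nsub {K L : Subgroup E} (h : ∀ l ∈ L, Nz l K) : (K.subgroupOf L).Normal := by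
  constructor
  intro k hk g
  exact (h g g.2 k).1 hk

theorem card_sub {K L : Subgroup E} (h : K ≤ L) : Nat.card (K.subgroupOf L) = Nat.card K :=
  Nat.card_congr (Subgroup.subgroupOfEquivOfLe h).toEquiv

theorem pow_rel {K L : Subgroup E} (hKL : K ≤ L) (h : ∀ l ∈ L, Nz l K) {n : ℕ} (hn : Nat.card L = n * Nat.card K) :
    ∀ l ∈ L, l ^ n ∈ K := by
  intro l hl
  have := nsub h
  have h1 := Subgroup.pow_index_mem (K.subgroupOf L) (⟨l, hl⟩ : L)
  have h2 : (K.subgroupOf L).index = n := by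
    have h3 := Subgroup.index_mul_card (K.subgroupOf L)
    rw [card_sub hKL, hn] at h3
    exact Nat.eq_of_mul_eq_mul_right Nat.card_pos h3
  rw [h2] at h1
  exact h1

theorem T5s {S0 S M : Subgroup E} (h0 : S0 ≤ S) (hS : SylIn 2 S M) (hn : ∀ m ∈ M, Nz m S0)
    (hc : ∀ m ∈ M, Nz m S → ∀ s ∈ S, m * s * m⁻¹ * s⁻¹ ∈ S0) :
    ∃ B : Subgroup E, S0 ≤ B ∧ B ≤ M ∧ (∀ m ∈ M, Nz m B) ∧ Nat.card B * Nat.card S = Nat.card M * Nat.card S0 := by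
  have := nsub hn
  have := Fact.mk Nat.prime_two
  have h0M : S0 ≤ M := h0.trans hS.1
  set K := S0.subgroupOf M with hK
  let φ : M →* M ⧸ K := QuotientGroup.mk' K
  have hker : φ.ker = K := QuotientGroup.ker_mk' K
  have hsur : Function.Surjective φ := QuotientGroup.mk'_surjective K
  have hKc : Nat.card K = Nat.card S0 := card_sub h0M
  have hKS : K ≤ S.subgroupOf M := fun a ha => h0 ha
  have c1 : Nat.card M = Nat.card (M ⧸ K) * Nat.card S0 := by
    have := card_map_ker φ ⊤
    rwa [Subgroup.map_top_of_surjective φ hsur, Subgroup.card_top, Subgroup.card_top, top_inf_eq, hker, hKc] at this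
  have c2 : Nat.card S = Nat.card ((S.subgroupOf M).map φ) * Nat.card S0 := by
    have := card_map_ker φ (S.subgroupOf M)
    rwa [hker, inf_eq_right.2 hKS, hKc, card_sub hS.1] at this
  have hS0 : Nat.card S0 = 2 ^ (Nat.card S0).factorization 2 := by
    obtain ⟨n, hn⟩ := IsPGroup.iff_card.1 (hS.isPGroup.to_le h0)
    rw [hn, Nat.prime_two.factorization_pow]; simp
  have hP : SylIn 2 ((S.subgroupOf M).map φ) ⊤ := by
    refine ⟨le_top, ?_⟩
    rw [Subgroup.card_top]
    have h1 := hS.2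
    rw [c1, Nat.factorization_mul Nat.card_pos.ne' Nat.card_pos.ne', Finsupp.add_apply, pow_add, ← hS0, c2] at h1
    exact Nat.eq_of_mul_eq_mul_right Nat.card_pos h1
  obtain ⟨Q, -, hQn, -, -, hQc⟩ := T5 hP (by
    intro m _ hmP t ht
    obtain ⟨u, rfl⟩ := hsur m
    obtain ⟨s, hs, rfl⟩ := ht
    have huS : Nz (u : E) S := by
      apply Nz.of_le
      intro a ha
      obtain ⟨b, hb, hba⟩ := (hmP (φ ⟨a, hS.1 ha⟩)).1 ⟨_, ha, rfl⟩
      rw [← map_inv, ← map_mul, ← map_mul] at hba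
      have h1 : b⁻¹ * (u * ⟨a, hS.1 ha⟩ * u⁻¹) ∈ K := QuotientGroup.eq.1 hba
      have h2 : (b : E)⁻¹ * (u * a * (u : E)⁻¹) ∈ S := hKS h1
      exact (S.mul_mem_cancel_left (S.inv_mem hb)).1 h2
    have h3 := hc u u.2 huS s hs
    have h4 : φ (u * s * u⁻¹ * s⁻¹) = 1 := by
      rw [← MonoidHom.mem_ker, hker]; exact h3
    rw [map_mul, map_mul, map_mul, map_inv, map_inv, mul_inv_eq_one, mul_inv_eq_iff_eq_mul] at h4
    exact h4)
  rw [Subgroup.card_top] at hQc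
  have hB : Nat.card ((Q.comap φ).map M.subtype) = Nat.card Q * Nat.card S0 := by
    have h1 := card_map_ker φ (Q.comap φ)
    rw [Subgroup.map_comap_eq_self_of_surjective hsur, inf_eq_right.2 (by
      intro a ha; change φ a ∈ Q; rw [MonoidHom.mem_ker.1 ha]; exact Q.one_mem), hker, hKc] at h1
    rw [← h1]
    exact Nat.card_congr (Subgroup.equivMapOfInjective _ _ M.subtype_injective).toEquiv.symm
  refine ⟨(Q.comap φ).map M.subtype, ?_, ?_, ?_, ?_⟩
  · intro a ha
    refine ⟨⟨a, h0M ha⟩, ?_, rfl⟩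
    change φ _ ∈ Q
    have : (⟨a, h0M ha⟩ : M) ∈ φ.ker := by rw [hker]; exact ha
    rw [MonoidHom.mem_ker.1 this]; exact Q.one_mem
  · rintro _ ⟨a, -, rfl⟩; exact a.2
  · intro m hm
    apply Nz.of_le
    rintro _ ⟨a, ha, rfl⟩
    refine ⟨⟨m, hm⟩ * a * ⟨m, hm⟩⁻¹, ?_, rfl⟩
    change φ _ ∈ Q
    rw [map_mul, map_mul, map_inv]
    exact (hQn (φ ⟨m, hm⟩) (Subgroup.mem_top _) _).1 ha
  · rw [hB, c1, c2, ← hQc]; ring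

/-- product of commuting subgroups -/
def pr (A B : Subgroup E) (h : ∀ a ∈ A, ∀ b ∈ B, a * b = b * a) : Subgroup E where
  carrier := {g | ∃ a ∈ A, ∃ b ∈ B, g = a * b}
  one_mem' := ⟨1, A.one_mem, 1, B.one_mem, by simp⟩
  mul_mem' := by
    rintro _ _ ⟨a, ha, b, hb, rfl⟩ ⟨c, hc, d, hd, rfl⟩
    refine ⟨a * c, A.mul_mem ha hc, b * d, B.mul_mem hb hd, ?_⟩
    have := h c hc b hb
    calc a * b * (c * d) = a * (b * c) * d := by simp [mul_assoc]
      _ = _ := by rw [← this]; simp [mul_assoc]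
  inv_mem' := by
    rintro _ ⟨a, ha, b, hb, rfl⟩
    refine ⟨a⁻¹, A.inv_mem ha, b⁻¹, B.inv_mem hb, ?_⟩
    rw [h a ha b hb, mul_inv_rev]

end

section
variable {E G : Type*} [Group E] [Group G] [Finite E] [Finite G] {π : E →* G} {p : ℕ} {σ : G}
  {P V : Subgroup E} {x w z : E} {S : Subgroup E}

theorem BD7 (H : Hyp π p σ) (D : Pd π p σ P V x w) (B : Bad π p σ V x z S)
    (star : ∀ k : ℕ, k.Coprime p → ∃ τ ∈ Subgroup.normalClosure {σ}, τ * σ * τ⁻¹ = σ ^ k)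
    {M L : Subgroup E} (hM : M = nz (S ⊓ ct x) ⊓ π.ker) (hL : L = M ⊓ ct x) :
    S ≤ M ∧ (∀ m ∈ M, Nz m L) ∧ (∀ m ∈ M, ∃ l ∈ L, ∃ s ∈ S, m = l * s) ∧ SylIn 2 (S ⊓ ct x) L := by
  have := Fact.mk Nat.prime_two
  obtain ⟨hc, -⟩ := BD5 H D B
  have hSM : S ≤ M := by
    rw [hM]
    intro t ht
    refine ⟨mem_nz.2 ?_, B.hS.1 ht⟩
    apply Nz.of_le
    intro s hs
    have := (S ⊓ ct x).mul_mem (hc t ht s hs.1) hs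
    simpa using this
  have hMk : M ≤ π.ker := by rw [hM]; exact inf_le_right
  have hMn : ∀ m ∈ M, Nz m (S ⊓ ct x) := by rw [hM]; exact fun m hm => mem_nz.1 hm.1
  have hML : ∀ m ∈ M, ∃ l ∈ L, ∃ s ∈ S, m = l * s := by
    intro m hm
    obtain ⟨c, hc, s, hs, rfl⟩ := (S9 H D B.hS).1 m (hMk hm)
    refine ⟨c, ?_, s, hs, rfl⟩
    rw [hL]
    exact ⟨(M.mul_mem_cancel_right (hSM hs)).1 hm, hc.2⟩
  have hSL : S ⊓ ct x ≤ L := by rw [hL]; exact inf_le_inf_right _ hSM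
  have hLM : L ≤ M := by rw [hL]; exact inf_le_left
  have h4 : (π.ker ⊓ ct x) ⊓ S = S ⊓ ct x := by
    ext a; constructor
    · exact fun h => ⟨h.2, h.1.2⟩
    · exact fun h => ⟨⟨B.hS.1 h.1, h.2⟩, h.1⟩
  have h5 := (S9 H D B.hS).2
  rw [h4] at h5
  have hsyl : SylIn 2 (S ⊓ ct x) L := h5.of_le hSL (by rw [hL]; exact inf_le_inf_right _ hMk)
  obtain ⟨B0, b1, b2, b3, b4⟩ := T5s (inf_le_left : S ⊓ ct x ≤ S) (B.hS.of_le hSM hMk) hMn (by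
    intro m hm hmS
    exact BD6 H D B star ⟨mem_nz.2 hmS, hMk hm⟩ (hMn m hm))
  have hLS : L ⊓ S = S ⊓ ct x := by
    rw [hL]
    ext a; constructor
    · exact fun h => ⟨h.2, h.1.2⟩
    · exact fun h => ⟨⟨hSM h.1, h.2⟩, h.1⟩
  have hcard := PC1 hLM hSM hML
  rw [hLS, ← b4] at hcard
  have hcard' : Nat.card B0 = Nat.card L := Nat.eq_of_mul_eq_mul_right Nat.card_pos hcard
  have hLB : L ≤ B0 := by
    obtain ⟨n, hn⟩ := Subgroup.card_dvd_of_le hSL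
    obtain ⟨k, hk⟩ := Subgroup.card_dvd_of_le b2
    have hnodd : Nat.Coprime 2 n := by
      rw [Nat.prime_two.coprime_iff_not_dvd]
      intro h2
      have h6 := hsyl.2
      have h7 : 2 ^ ((Nat.card L).factorization 2 + 1) ∣ Nat.card L := by
        rw [pow_succ, ← h6, hn]
        exact Nat.mul_dvd_mul_left _ h2
      have := (Nat.prime_two.pow_dvd_iff_le_factorization Nat.card_pos.ne').1 h7
      omega
    have hk2 : ∃ e, k = 2 ^ e := by
      have h6 : Nat.card S = k * Nat.card (S ⊓ ct x : Subgroup E) := by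
        rw [hk, mul_assoc] at b4
        exact Nat.eq_of_mul_eq_mul_left Nat.card_pos b4
      obtain ⟨n, hn⟩ := IsPGroup.iff_card.1 B.hS.isPGroup
      have : k ∣ 2 ^ n := ⟨_, hn ▸ h6⟩
      obtain ⟨e, -, he⟩ := (Nat.dvd_prime_pow Nat.prime_two).1 this
      exact ⟨e, he⟩
    obtain ⟨e, rfl⟩ := hk2
    intro l hl
    have p1 := b1 (pow_rel hSL (fun l hl => hMn l (hLM hl)) (by rw [hn, mul_comm]) l hl)
    have p2 := pow_rel b2 b3 (by rw [hk, mul_comm]) l (hLM hl)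
    have hcop : Nat.gcd n (2 ^ e) = 1 := (hnodd.pow_left e).symm
    have hb := Nat.gcd_eq_gcd_ab n (2 ^ e)
    rw [hcop] at hb
    have : l = l ^ (((1 : ℕ) : ℤ)) := by simp
    rw [this, hb, zpow_add, zpow_mul, zpow_mul, zpow_natCast, zpow_natCast]
    exact B0.mul_mem (B0.zpow_mem p1 _) (B0.zpow_mem p2 _)
  have hEq : L = B0 := Subgroup.eq_of_le_of_card_ge hLB hcard'.le
  rw [← hEq] at b3
  exact ⟨hSM, b3, hML, hsyl⟩

theorem BD8 (H : Hyp π p σ) (D : Pd π p σ P V x w) (B : Bad π p σ V x z S)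
    (star : ∀ k : ℕ, k.Coprime p → ∃ τ ∈ Subgroup.normalClosure {σ}, τ * σ * τ⁻¹ = σ ^ k) : False := by
  have := Fact.mk Nat.prime_two
  set M := nz (S ⊓ ct x) ⊓ π.ker with hM
  set L := M ⊓ ct x with hL
  obtain ⟨hSM, hMnL, hML, hsyl⟩ := BD7 H D B star hM hL
  have hSL := hsyl.1
  have hLM : L ≤ M := inf_le_left
  have hMk : M ≤ π.ker := inf_le_right
  have hPS : ∀ s ∈ S ⊓ ct x, s ∈ cen P := by
    intro s hs
    have h2 := hs
    rw [BD4 H D B] at h2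
    exact Ptriv H D B hs.2 h2.2
  have hcn : ∀ {g : E} {R : Subgroup E}, (∀ s ∈ R, g * s = s * g) → Nz g R := by
    intro g R h
    apply Nz.of_le
    intro s hs
    rw [h s hs]; simpa using hs
  have hPL : P ≤ L := by
    intro t ht
    refine ⟨⟨mem_nz.2 (hcn ?_), D.hP.1 ht⟩, mem_ct.2 (D.hVc x D.hxV t (D.hPV ht))⟩
    intro s hs
    exact mem_cen.1 (hPS s hs) t ht
  have hxM : Nz x M := by
    refine Nz.inf ?_ (ker_nz π x)
    refine Nz.of_mem (mem_nz.2 (hcn ?_))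
    intro s hs
    exact mem_ct.1 hs.2
  let M2 : Subgroup E := M ⊓ cen L
  have hM2M : M2 ≤ M := inf_le_left
  have hcomm : ∀ a ∈ M2, ∀ b ∈ L, a * b = b * a := fun a ha b hb => (mem_cen.1 ha.2 b hb).symm
  let K := pr M2 L hcomm
  have hLK : L ≤ K := fun l hl => ⟨1, M2.one_mem, l, hl, by simp⟩
  have hM2K : M2 ≤ K := fun l hl => ⟨l, hl, 1, L.one_mem, by simp⟩
  have hxM2 : ∀ h ∈ M, x⁻¹ * h * x * h⁻¹ ∈ M2 := by
    intro h hh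
    refine ⟨M.mul_mem (conj_inv_mem hxM hh) (M.inv_mem hh), mem_cen.2 fun l hl => ?_⟩
    have h1 : h⁻¹ * l * h ∈ L := conj_inv_mem (hMnL h hh) hl
    have h2 : Commute x (h⁻¹ * l * h) := mem_ct.1 h1.2
    have h3 : Commute x l := mem_ct.1 hl.2
    have h4 : Commute (h * x * h⁻¹) l := by
      have : h * x * h⁻¹ * l = l * (h * x * h⁻¹) := by
        calc h * x * h⁻¹ * l = h * (x * (h⁻¹ * l * h)) * h⁻¹ := by simp [mul_assoc]
          _ = h * ((h⁻¹ * l * h) * x) * h⁻¹ := by rw [h2.eq]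
          _ = _ := by simp [mul_assoc]
      exact this
    have h5 : Commute (x⁻¹ * (h * x * h⁻¹)) l := h3.inv_left.mul_left h4
    have h6 : x⁻¹ * h * x * h⁻¹ = x⁻¹ * (h * x * h⁻¹) := by simp [mul_assoc]
    rw [h6]; exact h5.eq.symm
  have hAM : ∀ y ∈ AA S x z, Nz y M := fun y hy =>
    (show Nz y (nz (S ⊓ ct x)) from by
      have hy0 : Nz y (S ⊓ ct x) := (mem_nz.1 hy.1).inf (Nz.ct (mem_nz.1 hy.2.1))
      exact Nz.of_mem (mem_nz.2 hy0)).inf (ker_nz π y)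
  have hAL : ∀ y ∈ AA S x z, Nz y L := fun y hy => (hAM y hy).inf (Nz.ct (mem_nz.1 hy.2.1))
  have hAM2 : ∀ y ∈ AA S x z, Nz y M2 := fun y hy => (hAM y hy).inf (hAL y hy).cen
  have hAK : ∀ y ∈ AA S x z, Nz y K := by
    intro y hy
    apply Nz.of_le
    rintro _ ⟨a, ha, b, hb, rfl⟩
    exact ⟨y * a * y⁻¹, (hAM2 y hy a).1 ha, y * b * y⁻¹, (hAL y hy b).1 hb, by simp [mul_assoc]⟩
  have hSK : S ≤ K := by
    rcases irr H D B (A := AA S x z) (zAA D B) inf_le_left (inf_le_right.trans inf_le_right) (AAfull H D B).2 (S ⊓ K)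
      (le_inf inf_le_left (hSL.trans hLK)) inf_le_left
      (fun y hy => (mem_nz.1 hy.1).inf (hAK y hy)) with h | h
    · exfalso
      obtain ⟨s, hs, hsz⟩ := hneS H D B
      apply hsz
      obtain ⟨t, ht, hzt⟩ := zdec H D B.hz B.hzσ
      have hs' : z * s * z⁻¹ ∈ S := (B.hzS s).1 hs
      have h1 := hxM2 _ (hSM hs')
      rw [← h]
      refine ⟨S.mul_mem hs' (S.inv_mem hs), ?_⟩
      have h3 : z * s * z⁻¹ * s⁻¹ = (t⁻¹ * ((x⁻¹ * (z * s * z⁻¹) * x * (z * s * z⁻¹)⁻¹) *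
          ((z * s * z⁻¹) * t * (z * s * z⁻¹)⁻¹)))⁻¹ := by
        have h4 : t⁻¹ * ((x⁻¹ * (z * s * z⁻¹) * x * (z * s * z⁻¹)⁻¹) *
          ((z * s * z⁻¹) * t * (z * s * z⁻¹)⁻¹)) = (x * t)⁻¹ * z * s * (z⁻¹ * (x * t)) * (z * s * z⁻¹)⁻¹ := by group
        rw [h4, ← hzt]; group
      rw [h3]
      refine K.inv_mem (K.mul_mem (K.inv_mem (hLK (hPL ht))) (K.mul_mem (hM2K h1) (hLK ?_)))
      exact (hMnL _ (hSM hs') t).1 (hPL ht)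
    · exact inf_eq_left.1 h
  have hMK : ∀ m ∈ M, ∃ a ∈ M2, ∃ b ∈ L, m = a * b := by
    intro m hm
    obtain ⟨l, hl, s, hs, rfl⟩ := hML m hm
    exact K.mul_mem (hLK hl) (hSK hs)
  have hc1 := PC1 hM2M hLM hMK
  obtain ⟨R, hR⟩ := T1' 2 M2
  have hRS : ∀ a ∈ R, ∀ b ∈ S ⊓ ct x, a * b = b * a := fun a ha b hb => hcomm a (hR.1 ha) b (hSL hb)
  let T := pr R (S ⊓ ct x) hRS
  have hc2 : Nat.card T * Nat.card (R ⊓ (S ⊓ ct x) : Subgroup E) = Nat.card R * Nat.card (S ⊓ ct x : Subgroup E) := PC R (S ⊓ ct x)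
  have hTk : T ≤ π.ker := by
    rintro _ ⟨a, ha, b, hb, rfl⟩
    exact π.ker.mul_mem (hMk (hM2M (hR.1 ha))) (B.hS.1 hb.1)
  obtain ⟨i, hi⟩ := IsPGroup.iff_card.1 (hR.isPGroup.to_le (inf_le_left : R ⊓ (S ⊓ ct x) ≤ R))
  have hT2 : IsPGroup 2 T := by
    have : Nat.card T ∣ 2 ^ ((Nat.card M2).factorization 2 + (Nat.card L).factorization 2) := by
      rw [pow_add, ← hR.2, ← hsyl.2, ← hc2]; exact Dvd.intro _ rfl
    obtain ⟨e, -, he⟩ := (Nat.dvd_prime_pow Nat.prime_two).1 this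
    exact IsPGroup.of_card he
  obtain ⟨j, hj⟩ := IsPGroup.iff_card.1 hT2
  have hSsyl := B.hS.of_le hSM hMk
  have hle : Nat.card S ≤ Nat.card T := by
    have f := congrArg (fun n => n.factorization 2) hc1
    beta_reduce at f
    rw [Nat.factorization_mul Nat.card_pos.ne' Nat.card_pos.ne', Nat.factorization_mul Nat.card_pos.ne' Nat.card_pos.ne',
      Finsupp.add_apply, Finsupp.add_apply] at f
    rw [hi, hj, hR.2, hsyl.2, ← pow_add, ← pow_add] at hc2
    have hc3 := Nat.pow_right_injective (le_refl 2) hc2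
    have hi2 : i ≤ (Nat.card (M2 ⊓ L : Subgroup E)).factorization 2 := by
      rw [← Nat.prime_two.pow_dvd_iff_le_factorization Nat.card_pos.ne', ← hi]
      exact Subgroup.card_dvd_of_le (inf_le_inf hR.1 hSL)
    rw [hSsyl.2, hj]
    apply Nat.pow_le_pow_right (by norm_num)
    omega
  have hTS : SylIn 2 T π.ker := by
    refine ⟨hTk, ?_⟩
    rw [← B.hS.2]
    exact le_antisymm (Nat.le_of_dvd Nat.card_pos (B.hS.card_dvd hTk hT2)) hle
  obtain ⟨t0, ht0, hzt⟩ := zdec H D B.hz B.hzσ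
  have ht1 : t0 ≠ 1 := by
    rintro rfl
    exact B.hzx (by rw [hzt, mul_one])
  refine noP H B.hS B.hn (D.hP.1 ht0) (D.hVe t0 (D.hPV ht0)) ht1 hTS (hcn ?_)
  rintro _ ⟨a, ha, b, hb, rfl⟩
  have h1 : Commute t0 a := (hcomm a (hR.1 ha) t0 (hPL ht0)).symm
  have h2 : Commute t0 b := mem_cen.1 (hPS b hb) t0 ht0
  exact (h1.mul_right h2).eq

theorem core (H : Hyp π p σ)
    (hopt : (∀ k : ℕ, k.Coprime p → ∃ τ ∈ Subgroup.normalClosure {σ}, τ * σ * τ⁻¹ = σ ^ k) ∨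
      ¬ 2 ^ (p - 1) ∣ Nat.card π.ker ∨ (p = 5 ∧ ¬ 2 ^ 5 ∣ Nat.card π.ker)) :
    ∃ x : E, π x = σ ∧ ∃ O : Subgroup E, O ≤ π.ker ∧ IsPGroup 2 O ∧ (∀ m ∈ π.ker, Nz m O) ∧
      ∀ m ∈ π.ker, x * m * x⁻¹ * m⁻¹ ∈ O := by
  have := Fact.mk Nat.prime_two
  obtain ⟨P, V, x, w, D⟩ := exists_Pd H
  refine ⟨x, D.hxσ, ?_⟩
  obtain ⟨S, hS, ⟨h1, -⟩ | ⟨hn, z, hz, hzS, hzσ, hzx, -⟩⟩ := Tri H D (q := 2)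
  · exact good H D hS h1
  · exfalso
    have B : Bad π p σ V x z S := ⟨hS, hn, hz, hzS, hzσ, hzx⟩
    rcases hopt with h | h | ⟨h, h'⟩
    · exact BD8 H D B h
    · apply h
      have h1 := BD2 H D B
      have h2 := Nat.le_mul_of_pos_right (2 ^ (p - 1)) (Nat.card_pos (α := (S ⊓ ct z : Subgroup E)))
      have h3 := h2.trans h1
      rw [hS.2] at h3
      exact (Nat.prime_two.pow_dvd_iff_le_factorization Nat.card_pos.ne').2 ((Nat.pow_le_pow_iff_right (by norm_num)).1 h3)
    · exact five H D B h h'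

end
end W9

namespace W9
section
open Equiv Subgroup

theorem perf_index {Q : Type*} [Group Q] (hperf : commutator Q = ⊤) (H : Subgroup Q)
    (h0 : H.index ≠ 0) (h2 : H.index ≤ 2) : H = ⊤ := by
  rcases (by omega : H.index = 1 ∨ H.index = 2) with h | h
  · exact Subgroup.index_eq_one.1 h
  · have hn : H.Normal := Subgroup.normal_of_index_eq_two h
    have hc : Nat.card (Q ⧸ H) = 2 := h
    have := Fact.mk Nat.prime_two
    have hcyc : IsCyclic (Q ⧸ H) := isCyclic_of_prime_card hc
    let _ : CommGroup (Q ⧸ H) := IsCyclic.commGroup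
    have h3 := Abelianization.commutator_subset_ker (QuotientGroup.mk' H)
    rw [hperf, QuotientGroup.ker_mk'] at h3
    exact top_le_iff.1 h3

theorem perf_hom {Q A : Type*} [Group Q] [Group A] (hA : ∀ a b : A, a * b = b * a)
    (hperf : commutator Q = ⊤) (φ : Q →* A) (q : Q) :
    φ q = 1 := by
  let _ : CommGroup A := { ‹Group A› with mul_comm := hA }
  have h3 := Abelianization.commutator_subset_ker φ
  rw [hperf] at h3
  exact h3 (Subgroup.mem_top q)

theorem perf_surj {Q R : Type*} [Group Q] [Group R] (hperf : commutator Q = ⊤) (φ : Q →* R)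
    (h : Function.Surjective φ) : commutator R = ⊤ := by
  rw [commutator_def] at *
  have h1 := Subgroup.map_commutator ⊤ ⊤ φ
  rw [hperf, Subgroup.map_top_of_surjective φ h] at h1
  exact h1.symm

theorem exists_psi {n : ℕ} (hn : 5 ≤ n) {Q : Type*} [Group Q] [Finite Q] [Nontrivial Q]
    (hperf : commutator Q = ⊤) (hcard : Nat.card Q ∣ n.factorial) (F : Perm (Fin n) →* MulAut Q)
    (g : Perm (Fin n) → Q) (hg : Function.Surjective g) (hfg : ∀ σ τ, g (σ * τ) = g σ * F σ (g τ))
    (hin : ∀ τ ∈ alternatingGroup (Fin n), F τ ∈ (MulAut.conj (G := Q)).range) :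
    ∃ ψ : Q →* alternatingGroup (Fin n), Function.Surjective ψ := by
  have hs : IsSimpleGroup (alternatingGroup (Fin n)) := alternatingGroup.isSimpleGroup (by simpa using hn)
  have : Nontrivial (Fin n) := Fin.nontrivial_iff_two_le.2 (by omega)
  have hA : 2 * Nat.card (alternatingGroup (Fin n)) = n.factorial := by
    rw [two_mul_nat_card_alternatingGroup, Nat.card_perm, Nat.card_fin]
  let φ : alternatingGroup (Fin n) →* (MulAut.conj (G := Q)).range :=
    (F.comp (alternatingGroup (Fin n)).subtype).codRestrict _ (fun τ => hin τ τ.2)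
  have hφ : ∀ τ, (φ τ : MulAut Q) = F τ := fun τ => rfl
  rcases hs.eq_bot_or_eq_top_of_normal φ.ker inferInstance with h | h
  · have hinj : Function.Injective φ := (MonoidHom.ker_eq_bot_iff φ).1 h
    have hsurj : Function.Surjective φ := by
      rw [← MonoidHom.range_eq_top]
      have h1 := perf_index (perf_surj hperf _ (MulAut.conj (G := Q)).rangeRestrict_surjective) φ.range
        index_ne_zero_of_finite ?_
      · exact h1
      have h2 := φ.range.index_mul_card
      have h3 : Nat.card φ.range = Nat.card (alternatingGroup (Fin n)) :=
        (Nat.card_congr (MonoidHom.ofInjective hinj).toEquiv).symm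
      have h4 : Nat.card (MulAut.conj (G := Q)).range ∣ n.factorial :=
        (Subgroup.card_range_dvd _).trans hcard
      have h5 := Nat.le_of_dvd (Nat.factorial_pos n) h4
      rw [← h2, h3, ← hA] at h5
      exact Nat.le_of_mul_le_mul_right h5 Nat.card_pos
    let e := MulEquiv.ofBijective φ ⟨hinj, hsurj⟩
    exact ⟨e.symm.toMonoidHom.comp (MulAut.conj (G := Q)).rangeRestrict,
      e.symm.surjective.comp (MulAut.conj (G := Q)).rangeRestrict_surjective⟩
  · have hF : ∀ τ ∈ alternatingGroup (Fin n), F τ = 1 := by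
      intro τ hτ
      have h1 : (⟨τ, hτ⟩ : alternatingGroup (Fin n)) ∈ φ.ker := by rw [h]; trivial
      have h2 := congrArg Subtype.val (MonoidHom.mem_ker.1 h1)
      exact h2
    let γ : alternatingGroup (Fin n) →* Q := MonoidHom.mk' (fun τ => g τ) (by
      intro a b
      change g (a * b) = _
      rw [hfg, hF a a.2]; rfl)
    have hγ : ∀ τ, γ τ = g τ := fun _ => rfl
    obtain ⟨t, ht⟩ := Perm.sign_surjective (Fin n) (-1)
    have hsurj : Function.Surjective γ := by
      rw [← MonoidHom.range_eq_top]
      refine perf_index hperf γ.range index_ne_zero_of_finite ?_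
      have h1 : Function.Surjective (fun x : γ.range × Bool => (x.1 : Q) * if x.2 then 1 else g t) := by
        intro q
        obtain ⟨τ, rfl⟩ := hg q
        rcases Int.units_eq_one_or (Perm.sign τ) with h | h
        · exact ⟨(⟨g τ, ⟨⟨τ, h⟩, rfl⟩⟩, true), by simp⟩
        · have h2 : τ * t⁻¹ ∈ alternatingGroup (Fin n) := by
            rw [Perm.mem_alternatingGroup]; simp [h, ht]
          refine ⟨(⟨g (τ * t⁻¹), ⟨⟨_, h2⟩, rfl⟩⟩, false), ?_⟩
          have h3 := hfg (τ * t⁻¹) t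
          rw [hF _ h2] at h3
          simpa using h3.symm
      have h2 := Nat.card_le_card_of_surjective _ h1
      rw [Nat.card_prod, ← γ.range.index_mul_card, mul_comm _ (Nat.card Bool)] at h2
      have h3 := Nat.le_of_mul_le_mul_right h2 Nat.card_pos
      simpa using h3
    have hinj : Function.Injective γ := by
      rw [← MonoidHom.ker_eq_bot_iff]
      rcases hs.eq_bot_or_eq_top_of_normal γ.ker inferInstance with h | h
      · exact h
      · exfalso
        obtain ⟨q, hq⟩ := exists_ne (1 : Q)
        obtain ⟨a, rfl⟩ := hsurj q
        exact hq (MonoidHom.mem_ker.1 (by rw [h]; trivial))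
    let e := MulEquiv.ofBijective γ ⟨hinj, hsurj⟩
    exact ⟨e.symm.toMonoidHom, e.symm.surjective⟩

/-- the 2-core -/
def O2 (N : Type*) [Group N] : Subgroup N := sSup {H : Subgroup N | H.Normal ∧ IsPGroup 2 H}

theorem O2_map {N : Type*} [Group N] (φ : MulAut N) : (O2 N).map φ.toMonoidHom = O2 N := by
  have key : ∀ ψ : MulAut N, (O2 N).map ψ.toMonoidHom ≤ O2 N := by
    intro ψ
    rw [Subgroup.map_le_iff_le_comap, O2, sSup_le_iff]
    rintro H ⟨h1, h2⟩
    rw [← Subgroup.map_le_iff_le_comap]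
    exact le_sSup ⟨h1.map _ ψ.surjective, h2.map _⟩
  apply le_antisymm (key φ)
  intro x hx
  exact ⟨φ⁻¹ x, key φ⁻¹ ⟨x, hx, rfl⟩, by simp⟩

instance O2_normal (N : Type*) [Group N] : (O2 N).Normal := by
  constructor
  intro x hx y
  rw [← O2_map (MulAut.conj y)]
  exact ⟨x, hx, rfl⟩

theorem O2_pgroup (N : Type*) [Group N] : IsPGroup 2 (O2 N) := by
  have := Fact.mk Nat.prime_two
  exact Sylow.sSup_of_normal _ (fun H h => h.2) (fun H h => h.1)

/-- induced action on the quotient by the 2-core -/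
def qact {N S : Type*} [Group N] [Group S] (f : S →* MulAut N) : S →* MulAut (N ⧸ O2 N) where
  toFun σ := QuotientGroup.congr (O2 N) (O2 N) (f σ) (O2_map (f σ))
  map_one' := by
    ext x
    obtain ⟨y, rfl⟩ := QuotientGroup.mk_surjective x
    simp
  map_mul' a b := by
    ext x
    obtain ⟨y, rfl⟩ := QuotientGroup.mk_surjective x
    simp only [QuotientGroup.congr_mk, map_mul, MulAut.mul_apply]
    rfl

theorem qact_mk {N S : Type*} [Group N] [Group S] (f : S →* MulAut N) (σ : S) (m : N) :
    qact f σ (m : N ⧸ O2 N) = ((f σ m : N) : N ⧸ O2 N) := rfl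

theorem wrap {n : ℕ} (hn : 5 ≤ n) (N : Type*) [Group N] [Finite N]
    (hcard : Nat.card N = n.factorial) (hperf : commutator N = ⊤)
    (f : Equiv.Perm (Fin n) →* MulAut N) (g : Equiv.Perm (Fin n) → N)
    (hg : Function.Bijective g)
    (hfg : ∀ σ τ : Equiv.Perm (Fin n), g (σ * τ) = g σ * f σ (g τ))
    (σ : Perm (Fin n)) (hσ : σ ∈ alternatingGroup (Fin n)) (hσ1 : σ ≠ 1) (O : Subgroup N) (hO : O.Normal)
    (hO2 : IsPGroup 2 O) (r : N) (hr : ∀ m, r * f σ m * r⁻¹ * m⁻¹ ∈ O) :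
    Nat.card (Subgroup.center N) = 2 ∧
      Nonempty ((N ⧸ Subgroup.center N) ≃* alternatingGroup (Fin n)) ∧
      ∀ σ ∈ alternatingGroup (Fin n), f σ ∈ (MulAut.conj (G := N)).range := by
  have hs : IsSimpleGroup (alternatingGroup (Fin n)) := alternatingGroup.isSimpleGroup (by simpa using hn)
  have : Nontrivial (Fin n) := Fin.nontrivial_iff_two_le.2 (by omega)
  have hA : 2 * Nat.card (alternatingGroup (Fin n)) = n.factorial := by
    rw [two_mul_nat_card_alternatingGroup, Nat.card_perm, Nat.card_fin]
  have hOK : O ≤ O2 N := le_sSup ⟨hO, hO2⟩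
  have hne : O2 N ≠ ⊤ := by
    intro h
    have h1 := O2_pgroup N
    obtain ⟨k, hk⟩ := IsPGroup.iff_card.1 h1
    rw [h, Subgroup.card_top, hcard] at hk
    have h3 : 3 ∣ 2 ^ k := by rw [← hk]; exact Nat.dvd_factorial (by norm_num) (by omega)
    have := Nat.prime_three.dvd_of_dvd_pow h3
    omega
  have : Nontrivial (N ⧸ O2 N) := QuotientGroup.nontrivial_iff.2 hne
  have hqm : ∀ r : N, ∀ τ, (∀ m, f τ m * (r * m * r⁻¹)⁻¹ ∈ O2 N) ↔ qact f τ = MulAut.conj (r : N ⧸ O2 N) := by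
    intro r τ
    constructor
    · intro h
      ext x
      obtain ⟨m, rfl⟩ := QuotientGroup.mk_surjective x
      rw [qact_mk]
      have h1 := (QuotientGroup.eq_one_iff _).2 (h m)
      rw [QuotientGroup.mk_mul, QuotientGroup.mk_inv, mul_inv_eq_one] at h1
      rw [h1]; rfl
    · intro h m
      rw [← QuotientGroup.eq_one_iff, QuotientGroup.mk_mul, QuotientGroup.mk_inv, mul_inv_eq_one, ← qact_mk, h]
      rfl
  have hσin : qact f σ ∈ (MulAut.conj (G := N ⧸ O2 N)).range := by
    refine ⟨_, ((hqm r⁻¹ σ).1 ?_).symm⟩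
    intro m
    have h1 := (O2_normal N).conj_mem _ (hOK (hr m)) r⁻¹
    convert h1 using 1
    group
  have hin : ∀ τ ∈ alternatingGroup (Fin n), qact f τ ∈ (MulAut.conj (G := N ⧸ O2 N)).range := by
    have hnr : (MulAut.conj (G := N ⧸ O2 N)).range.Normal := by
      constructor
      rintro _ ⟨a, rfl⟩ ψ
      refine ⟨ψ a, ?_⟩
      ext x
      simp
    let T := ((MulAut.conj (G := N ⧸ O2 N)).range.comap (qact f)).subgroupOf (alternatingGroup (Fin n))
    have hT : T.Normal := inferInstance
    rcases hs.eq_bot_or_eq_top_of_normal T hT with h | h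
    · exfalso
      have h1 : (⟨σ, hσ⟩ : alternatingGroup (Fin n)) ∈ T := hσin
      rw [h, Subgroup.mem_bot] at h1
      exact hσ1 (congrArg Subtype.val h1)
    · intro τ hτ
      have h1 : (⟨τ, hτ⟩ : alternatingGroup (Fin n)) ∈ T := by rw [h]; trivial
      exact h1
  obtain ⟨ψ0, hψ0⟩ := exists_psi hn (perf_surj hperf (QuotientGroup.mk' (O2 N)) (QuotientGroup.mk'_surjective _))
    (by rw [← hcard]; exact Subgroup.card_quotient_dvd_card _) (qact f) (fun τ => (g τ : N ⧸ O2 N))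
    ((QuotientGroup.mk_surjective).comp hg.2) (by intro a b; rw [hfg]; rfl) hin
  let ψ : N →* alternatingGroup (Fin n) := ψ0.comp (QuotientGroup.mk' (O2 N))
  have hψ : Function.Surjective ψ := hψ0.comp (QuotientGroup.mk'_surjective _)
  have hker : Nat.card ψ.ker = 2 := by
    have h1 := ψ.ker.index_mul_card
    rw [Subgroup.index_ker, MonoidHom.range_eq_top.2 hψ, Subgroup.card_top, hcard, ← hA, mul_comm] at h1
    exact Nat.eq_of_mul_eq_mul_right Nat.card_pos h1
  have hKker : O2 N ≤ ψ.ker := by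
    intro x hx
    rw [MonoidHom.mem_ker]
    change ψ0 (x : N ⧸ O2 N) = 1
    rw [(QuotientGroup.eq_one_iff x).2 hx, map_one]
  have hkz : ψ.ker = Subgroup.center N := by
    apply le_antisymm
    · obtain ⟨z, hz, hz2⟩ := (Nat.card_eq_two_iff' (1 : ψ.ker)).1 hker
      have huniq : ∀ x ∈ ψ.ker, x ≠ 1 → x = z := by
        intro x hx hx1
        have := hz2 ⟨x, hx⟩ (fun h => hx1 (congrArg Subtype.val h))
        exact congrArg Subtype.val this
      intro x hx
      by_cases hx1 : x = 1
      · rw [hx1]; exact one_mem _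
      rw [Subgroup.mem_center_iff]
      intro y
      have h1 : y * x * y⁻¹ = x := by
        rw [huniq x hx hx1]
        exact huniq _ (ψ.normal_ker.conj_mem _ z.2 y) (fun h => hz (Subtype.ext (by simpa using h)))
      exact mul_inv_eq_iff_eq_mul.1 h1
    · intro x hx
      rw [MonoidHom.mem_ker]
      have h1 : ψ x ∈ Subgroup.center (alternatingGroup (Fin n)) := by
        rw [Subgroup.mem_center_iff]
        intro y
        obtain ⟨y, rfl⟩ := hψ y
        rw [← map_mul, ← map_mul, Subgroup.mem_center_iff.1 hx y]
      have h2 : Subgroup.center (alternatingGroup (Fin n)) = ⊥ := by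
        apply alternatingGroup.center_eq_bot
        simp; omega
      rw [h2] at h1
      exact h1
  refine ⟨hkz ▸ hker, ⟨?_⟩, ?_⟩
  · exact (QuotientGroup.quotientMulEquivOfEq hkz.symm).trans (QuotientGroup.quotientKerEquivOfSurjective ψ hψ)
  · intro τ hτ
    obtain ⟨rb, hrb⟩ := hin τ hτ
    obtain ⟨r, rfl⟩ := QuotientGroup.mk_surjective rb
    have h1 := (hqm r τ).2 hrb.symm
    have h2 : ∀ m, f τ m * (r * m * r⁻¹)⁻¹ ∈ Subgroup.center N := fun m => hkz ▸ hKker (h1 m)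
    let ζ : N →* Subgroup.center N := MonoidHom.mk' (fun m => ⟨_, h2 m⟩) (by
      intro a b
      apply Subtype.ext
      have h3 := Subgroup.mem_center_iff.1 (h2 b) (r * a * r⁻¹)⁻¹
      change f τ (a * b) * (r * (a * b) * r⁻¹)⁻¹ = f τ a * (r * a * r⁻¹)⁻¹ * (f τ b * (r * b * r⁻¹)⁻¹)
      rw [mul_assoc (f τ a), h3, map_mul]
      group)
    refine ⟨r, ?_⟩
    ext m
    have h4 := congrArg Subtype.val (perf_hom (fun a b => Subtype.ext (Subgroup.mem_center_iff.1 b.2 a)) hperf ζ m)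
    have h5 : f τ m * (r * m * r⁻¹)⁻¹ = 1 := h4
    rw [mul_inv_eq_one] at h5
    rw [h5]; rfl

end
end W9

namespace W9
section
open Equiv Subgroup

theorem fac_bound {q k n : ℕ} (hq : q.Prime) (hn : n ≠ 0) (h : q ^ k ∣ n.factorial) : (q - 1) * k < n := by
  have := Fact.mk hq
  have h1 := (padicValNat_dvd_iff_le (Nat.factorial_pos n).ne').1 h
  have h2 := sub_one_mul_padicValNat_factorial_lt_of_ne_zero q hn
  exact (Nat.mul_le_mul_left _ h1).trans_lt h2

theorem v2_even (l : ℕ) : padicValNat 2 (2 * l).factorial = padicValNat 2 l.factorial + l := by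
  have := Fact.mk Nat.prime_two
  exact padicValNat_factorial_mul l

theorem v2_odd (l : ℕ) : padicValNat 2 (2 * l + 1).factorial = padicValNat 2 l.factorial + l := by
  have := Fact.mk Nat.prime_two
  rw [padicValNat_factorial_mul_add l (by norm_num), v2_even]

theorem v2_lt {n : ℕ} (hn : n ≠ 0) : padicValNat 2 n.factorial < n := by
  have := Fact.mk Nat.prime_two
  simpa using sub_one_mul_padicValNat_factorial_lt_of_ne_zero 2 hn

theorem v2_mod3 : ∀ m : ℕ, m ≠ 0 → m ≤ padicValNat 2 m.factorial + 1 → m % 3 ≠ 0 := by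
  intro m
  induction m using Nat.strong_induction_on with
  | _ m ih =>
    intro h0 h
    rcases Nat.even_or_odd' m with ⟨l, rfl | rfl⟩
    · rw [v2_even] at h
      have := ih l (by omega) (by omega) (by omega)
      omega
    · rw [v2_odd] at h
      by_cases hl : l = 0
      · subst hl; decide
      · have := v2_lt hl
        omega

theorem not2 {n k : ℕ} (h : padicValNat 2 n.factorial < k) : ¬ 2 ^ k ∣ n.factorial := by
  have := Fact.mk Nat.prime_two
  intro h1
  have := (padicValNat_dvd_iff_le (Nat.factorial_pos n).ne').1 h1
  omega

theorem prime_odd {p : ℕ} (hp : p.Prime) (h : 2 < p) : p % 2 = 1 :=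
  (hp.eq_two_or_odd).resolve_left (by omega)

theorem NT (n : ℕ) (hn : 5 ≤ n) : ∃ p : ℕ, p.Prime ∧ 5 ≤ p ∧ p ≤ n ∧ n + 1 < 2 * p ∧
    (p + 2 ≤ n ∨ ¬ 2 ^ (p - 1) ∣ n.factorial ∨ (p = 5 ∧ n = 6)) := by
  rcases Nat.even_or_odd' n with ⟨k, rfl | rfl⟩
  · obtain ⟨p, hp, h1, h2⟩ := Nat.exists_prime_lt_and_le_two_mul k (by omega)
    have ho := prime_odd hp (by omega)
    by_cases h3 : p + 2 ≤ 2 * k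
    · exact ⟨p, hp, by omega, h2, by omega, Or.inl h3⟩
    by_cases h4 : padicValNat 2 (2 * k).factorial < p - 1
    · exact ⟨p, hp, by omega, h2, by omega, Or.inr (Or.inl (not2 h4))⟩
    by_cases hk : k = 3
    · exact ⟨p, hp, by omega, h2, by omega, Or.inr (Or.inr (by omega))⟩
    obtain ⟨p', hp', h1', h2'⟩ := Nat.exists_prime_lt_and_le_two_mul (k - 1) (by omega)
    have ho' := prime_odd hp' (by omega)
    by_cases h5 : k < p'
    · exact ⟨p', hp', by omega, by omega, by omega, Or.inl (by omega)⟩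
    exfalso
    obtain rfl : k = p' := by omega
    obtain ⟨l, hl⟩ : ∃ l, k = 2 * l + 1 := ⟨k / 2, by omega⟩
    rw [v2_even, hl, v2_odd] at h4
    have h6 := v2_mod3 (2 * l) (by omega) (by rw [v2_even]; omega)
    have h7 : ¬ 3 ∣ k := fun h => by
      have := (Nat.prime_dvd_prime_iff_eq Nat.prime_three hp').1 h
      omega
    have h8 : ¬ 3 ∣ p := fun h => by
      have := (Nat.prime_dvd_prime_iff_eq Nat.prime_three hp).1 h
      omega
    rcases (by omega : l % 3 = 0 ∨ l % 3 = 1 ∨ l % 3 = 2) with h | h | h <;> omega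
  · rename' k => j
    obtain ⟨p, hp, h1, h2⟩ := Nat.exists_prime_lt_and_le_two_mul (j + 1) (by omega)
    have ho := prime_odd hp (by omega)
    by_cases h3 : p + 2 ≤ 2 * j + 1
    · exact ⟨p, hp, by omega, by omega, by omega, Or.inl h3⟩
    · refine ⟨p, hp, by omega, by omega, by omega, Or.inr (Or.inl (not2 ?_))⟩
      rw [v2_odd]
      have := v2_lt (n := j) (by omega)
      omega

theorem ct_prime {n p : ℕ} (hp : p.Prime) (h : n + 1 < 2 * p) (σ : Perm (Fin n)) (hσ : orderOf σ = p) :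
    σ.cycleType = {p} := by
  obtain ⟨k, hk⟩ := Perm.cycleType_prime_order (σ := σ) (by rw [hσ]; exact hp)
  have h1 : σ.cycleType.sum ≤ n := by
    rw [Perm.sum_cycleType]
    simpa using Finset.card_le_univ σ.support
  rw [hk, Multiset.sum_replicate, hσ, smul_eq_mul] at h1
  have : k = 0 := by
    by_contra h0
    have : 2 * p ≤ (k + 1) * p := Nat.mul_le_mul_right _ (by omega)
    omega
  rw [hk, this, hσ]; rfl

theorem exists_sigma {n p : ℕ} (hn : 5 ≤ n) (hp : p.Prime) (h5 : 5 ≤ p) (hpn : p ≤ n) (h : n + 1 < 2 * p) :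
    ∃ σ : Perm (Fin n), orderOf σ = p ∧ σ ∈ alternatingGroup (Fin n) ∧
      (∀ k : ℕ, k.Coprime p → ∃ τ, τ * σ * τ⁻¹ = σ ^ k) ∧
      (p + 2 ≤ n → ∀ k : ℕ, k.Coprime p → ∃ τ ∈ Subgroup.normalClosure {σ}, τ * σ * τ⁻¹ = σ ^ k) := by
  obtain ⟨σ, hσ⟩ := (Perm.exists_with_cycleType_iff (Fin n) (m := {p})).2 (by simp; omega)
  have hord : orderOf σ = p := by rw [← Perm.lcm_cycleType, hσ]; simp
  have halt : σ ∈ alternatingGroup (Fin n) := by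
    rw [Perm.mem_alternatingGroup, Perm.sign_of_cycleType, hσ]
    have := prime_odd hp (by omega)
    simp only [Multiset.sum_singleton, Multiset.card_singleton]
    apply Even.neg_one_pow
    rw [Nat.even_iff]; omega
  have hk : ∀ k : ℕ, k.Coprime p → ∃ τ, τ * σ * τ⁻¹ = σ ^ k := by
    intro k hk
    have h1 : orderOf (σ ^ k) = p := by
      rw [Nat.Coprime.orderOf_pow (by rw [hord]; exact hk.symm), hord]
    have h2 : IsConj σ (σ ^ k) := by
      rw [Perm.isConj_iff_cycleType_eq, hσ, ct_prime hp h _ h1]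
    exact isConj_iff.1 h2
  refine ⟨σ, hord, halt, hk, ?_⟩
  intro h2 k hkp
  have hs : IsSimpleGroup (alternatingGroup (Fin n)) := alternatingGroup.isSimpleGroup (by simpa using hn)
  have hle : alternatingGroup (Fin n) ≤ Subgroup.normalClosure {σ} := by
    let T := (Subgroup.normalClosure {σ}).subgroupOf (alternatingGroup (Fin n))
    rcases hs.eq_bot_or_eq_top_of_normal T inferInstance with h | h
    · exfalso
      have h1 : (⟨σ, halt⟩ : alternatingGroup (Fin n)) ∈ T :=
        Subgroup.subset_normalClosure (Set.mem_singleton σ)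
      rw [h, Subgroup.mem_bot] at h1
      have h3 : σ = 1 := congrArg Subtype.val h1
      rw [h3, orderOf_one] at hord
      omega
    · intro τ hτ
      have h1 : (⟨τ, hτ⟩ : alternatingGroup (Fin n)) ∈ T := by rw [h]; trivial
      exact h1
  obtain ⟨τ, hτ⟩ := hk k hkp
  rcases Int.units_eq_one_or (Perm.sign τ) with hs | hs
  · exact ⟨τ, hle hs, hτ⟩
  · have hcs : σ.support.card = p := by rw [← Perm.sum_cycleType, hσ]; simp
    have h3 : 1 < (σ.supportᶜ).card := by
      rw [Finset.card_compl, hcs, Fintype.card_fin]; omega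
    obtain ⟨a, ha, b, hb, hab⟩ := Finset.one_lt_card.1 h3
    have hd : Perm.Disjoint (swap a b) σ := by
      rw [Perm.disjoint_iff_disjoint_support, Perm.support_swap hab]
      rw [Finset.disjoint_left]
      intro x hx
      rw [Finset.mem_compl] at ha hb
      simp only [Finset.mem_insert, Finset.mem_singleton] at hx
      rcases hx with rfl | rfl
      · exact ha
      · exact hb
    refine ⟨τ * swap a b, hle ?_, ?_⟩
    · rw [Perm.mem_alternatingGroup, Perm.sign_mul, hs, Perm.sign_swap hab]; rfl
    · rw [← hτ]
      have h4 := hd.commute.eq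
      calc τ * swap a b * σ * (τ * swap a b)⁻¹ = τ * (swap a b * σ) * (swap a b)⁻¹ * τ⁻¹ := by group
        _ = τ * (σ * swap a b) * (swap a b)⁻¹ * τ⁻¹ := by rw [h4]
        _ = _ := by group

end
end W9

theorem stmt_9 (n : ℕ) (hn : 5 ≤ n) (N : Type*) [Group N]
    (hcard : Nat.card N = n.factorial) (hperf : commutator N = ⊤)
    (f : Equiv.Perm (Fin n) →* MulAut N) (g : Equiv.Perm (Fin n) → N)
    (hg : Function.Bijective g)
    (hfg : ∀ σ τ : Equiv.Perm (Fin n), g (σ * τ) = g σ * f σ (g τ)) :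
    Nat.card (Subgroup.center N) = 2 ∧
      Nonempty ((N ⧸ Subgroup.center N) ≃* alternatingGroup (Fin n)) ∧
      ∀ σ ∈ alternatingGroup (Fin n), f σ ∈ (MulAut.conj (G := N)).range := by
  have hfin : Finite N := Finite.of_surjective g hg.2
  obtain ⟨p, hp, h5, hpn, hnp, hopt⟩ := W9.NT n hn
  obtain ⟨σ, hord, halt, hk, hstar⟩ := W9.exists_sigma hn hp h5 hpn hnp
  have hE : Finite (N ⋊[f] Equiv.Perm (Fin n)) := Finite.of_equiv _ SemidirectProduct.equivProd.symm
  let π : N ⋊[f] Equiv.Perm (Fin n) →* Equiv.Perm (Fin n) := SemidirectProduct.rightHom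
  have hker : (SemidirectProduct.inl : N →* N ⋊[f] Equiv.Perm (Fin n)).range = π.ker :=
    SemidirectProduct.range_inl_eq_ker_rightHom
  have hkc : Nat.card π.ker = n.factorial := by
    rw [← hker, ← hcard]
    exact (Nat.card_congr (MonoidHom.ofInjective SemidirectProduct.inl_injective).toEquiv).symm
  have hinl : ∀ m : N, (SemidirectProduct.inl m : N ⋊[f] Equiv.Perm (Fin n)) ∈ π.ker := fun m => by
    rw [← hker]; exact ⟨m, rfl⟩
  have hp2 : ¬ p ^ 2 ∣ n.factorial := fun h => by
    have := W9.fac_bound hp (by omega) h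
    omega
  have H : W9.Hyp π p σ := {
    hp := hp
    h5 := h5
    hsurj := SemidirectProduct.rightHom_surjective
    hσ := hord
    hG := by rw [Nat.card_perm, Nat.card_fin]; exact hp2
    hpN := by rw [hkc]; exact Nat.dvd_factorial hp.pos hpn
    hpN2 := by rw [hkc]; exact hp2
    hs := ⟨SemidirectProduct.inr σ, by rw [← map_pow, ← hord, pow_orderOf_eq_one, map_one],
      SemidirectProduct.rightHom_inr σ⟩
    hperf := by
      intro Q hQ
      rw [← hker]
      rintro _ ⟨m, rfl⟩
      have h1 : commutator N ≤ Q.comap SemidirectProduct.inl := by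
        rw [commutator_def, Subgroup.commutator_le]
        intro a _ b _
        rw [Subgroup.mem_comap, commutatorElement_def]
        simpa using hQ _ (hinl a) _ (hinl b)
      rw [hperf] at h1
      exact h1 (Subgroup.mem_top m)
    hodd := by
      intro q hq hq2 hqp h
      rw [hkc] at h
      have h1 := W9.fac_bound hq (by omega) h
      have h2 : 2 ≤ q - 1 := by have := hq.two_le; omega
      have h3 := Nat.mul_le_mul_right (p - 1) h2
      omega
    h2 := by
      intro h
      rw [hkc] at h
      have h1 := W9.fac_bound Nat.prime_two (by omega) h
      omega
    hk := hk }
  obtain ⟨x, hx, O, hO, hO2, hOn, hxO⟩ := W9.core H (by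
    rw [hkc]
    rcases hopt with h | h | ⟨h, rfl⟩
    · exact Or.inl (hstar h)
    · exact Or.inr (Or.inl h)
    · exact Or.inr (Or.inr ⟨h, by decide⟩))
  refine W9.wrap hn N hcard hperf f g hg hfg σ halt ?_ (O.comap SemidirectProduct.inl) ?_ ?_ x.left ?_
  · rintro rfl
    rw [orderOf_one] at hord
    omega
  · constructor
    intro m hm r
    have := (hOn _ (hinl r) _).1 hm
    simpa [Subgroup.mem_comap] using this
  · exact hO2.comap_of_injective _ SemidirectProduct.inl_injective
  · intro m
    have h1 := hxO _ (hinl m)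
    have h2 : x = SemidirectProduct.inl x.left * SemidirectProduct.inr σ := by
      rw [← hx]; exact (SemidirectProduct.inl_left_mul_inr_right x).symm
    rw [Subgroup.mem_comap]
    simp only [map_mul, map_inv, SemidirectProduct.inl_aut]
    convert h1 using 1
    conv_rhs => rw [h2]
    group
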